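/- arXiv:1305.0656 — 3 statements merged into one kernel-verified Lean document; each statement's English description precedes it below -/
import Mathlib

section
/- Existence and essential uniqueness of the L² solution: let C, γ > 0, let μ ∈ M_a^{C,γ}(ℝ), let z ∈ ℂ with Im z > 0, and let a ∈ ℝ ∖ {t_n : n}. Then there exists a solution u₊ of the interface equation −u'' = z u for μ on [a, ∞), not identically zero, with ∫_a^∞ |u₊(r)|² dr < ∞; any two such solutions are complex scalar multiples of each other; and every such solution satisfies u₊(a) ≠ 0. -/
open Set Filter Topology MeasureTheory

/-- The part of the interval `J` off the atoms `{tₙ}`. -/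
def offAtoms (ts : ℕ → ℝ) (J : Set ℝ) : Set ℝ := J \ Set.range ts

/-- One-sided limits of `u` and its derivative exist at the atom `ts n`, and the
interface conditions `u(tₙ+) = √bₙ · u(tₙ-)`, `u'(tₙ+) = u'(tₙ-)/√bₙ` hold. -/
def InterfaceAt (ts bs : ℕ → ℝ) (S : Set ℝ) (u : ℝ → ℂ) (n : ℕ) : Prop :=
  ∃ uL uR duL duR : ℂ,
    Tendsto u (nhdsWithin (ts n) (S ∩ Iio (ts n))) (nhds uL) ∧
    Tendsto u (nhdsWithin (ts n) (S ∩ Ioi (ts n))) (nhds uR) ∧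
    Tendsto (derivWithin u S) (nhdsWithin (ts n) (S ∩ Iio (ts n))) (nhds duL) ∧
    Tendsto (derivWithin u S) (nhdsWithin (ts n) (S ∩ Ioi (ts n))) (nhds duR) ∧
    uR = (Real.sqrt (bs n) : ℂ) * uL ∧
    duR = duL / (Real.sqrt (bs n) : ℂ)

/-- `u` is a solution of the interface equation `-u'' = z·u` for the atomic measure
with atoms `ts n` and branching numbers `bs n`, on the interval `J`:
`u` is twice continuously differentiable on `J` off the atoms with `-u'' = z·u` there,
and at every atom in the interior of `J` it has one-sided limits satisfying
the interface conditions. -/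
def IsInterfaceSolution (ts bs : ℕ → ℝ) (z : ℂ) (J : Set ℝ) (u : ℝ → ℂ) : Prop :=
  ContDiffOn ℝ 2 u (offAtoms ts J) ∧
  (∀ x ∈ offAtoms ts J,
      -(derivWithin (derivWithin u (offAtoms ts J)) (offAtoms ts J) x) = z * u x) ∧
  (∀ n, ts n ∈ interior J → InterfaceAt ts bs (offAtoms ts J) u n)

/-- The Wronskian `W(f, g)(r) = f'(r)·g(r) - f(r)·g'(r)`, with derivatives taken
within the set `S`. -/
noncomputable def wron (S : Set ℝ) (f g : ℝ → ℂ) (r : ℝ) : ℂ :=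
  derivWithin f S r * g r - f r * derivWithin g S r

/-- The Wronskian `W(f, ḡ)(r)` of `f` and the pointwise complex conjugate of `g`. -/
noncomputable def wronConj (S : Set ℝ) (f g : ℝ → ℂ) (r : ℝ) : ℂ :=
  derivWithin f S r * (starRingEnd ℂ) (g r)
    - f r * (starRingEnd ℂ) (derivWithin g S r)

/-- The atomic measure `μ = Σₙ βₙ δ_{tₙ}` with weights `βₙ = (√bₙ + 1)/(√bₙ - 1)`. -/
noncomputable def treeMeasure (ts bs : ℕ → ℝ) : Measure ℝ :=
  Measure.sum fun n =>
    ENNReal.ofReal ((Real.sqrt (bs n) + 1) / (Real.sqrt (bs n) - 1)) • Measure.dirac (ts n)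

/-- `u` is a nontrivial square-integrable solution of the interface equation
`-u'' = z u` on `[a, ∞)`. -/
def IsL2Solution (ts bs : ℕ → ℝ) (z : ℂ) (a : ℝ) (u : ℝ → ℂ) : Prop :=
  IsInterfaceSolution ts bs z (Ici a) u ∧
  (∃ x ∈ offAtoms ts (Ici a), u x ≠ 0) ∧
  IntegrableOn (fun r => ‖u r‖ ^ 2) (Ioi a) volume

namespace L2Sol

/-- cosine -/
noncomputable def cc (k : ℂ) (x : ℝ) : ℂ := Complex.cos (k * x)
/-- sine over k -/
noncomputable def sn (k : ℂ) (x : ℝ) : ℂ := Complex.sin (k * x) / k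
/-- free solution -/
noncomputable def F (k : ℂ) (Y : ℂ × ℂ) (x : ℝ) : ℂ := Y.1 * cc k x + Y.2 * sn k x
/-- derivative of the free solution -/
noncomputable def G (k : ℂ) (Y : ℂ × ℂ) (x : ℝ) : ℂ := -(k ^ 2 * Y.1 * sn k x) + Y.2 * cc k x
/-- coefficients from Cauchy data at `x` -/
noncomputable def inv (k : ℂ) (x : ℝ) (U V : ℂ) : ℂ × ℂ :=
  (U * cc k x - V * sn k x, k ^ 2 * U * sn k x + V * cc k x)
/-- energy-type form -/
noncomputable def H (k : ℂ) (Y : ℂ × ℂ) (x : ℝ) : ℝ := (G k Y x * (starRingEnd ℂ) (F k Y x)).im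

lemma cs (k : ℂ) (hk : k ≠ 0) (x : ℝ) : cc k x ^ 2 + k ^ 2 * sn k x ^ 2 = 1 := by
  unfold cc sn
  have := Complex.sin_sq_add_cos_sq (k * x)
  field_simp
  linear_combination this

lemma cc_deriv (k : ℂ) (hk : k ≠ 0) (x : ℝ) : HasDerivAt (cc k) (-(k ^ 2 * sn k x)) x := by
  unfold cc sn
  have h1 : HasDerivAt (fun w : ℂ => Complex.cos (k * w)) (-Complex.sin (k * x) * (k * 1)) (x : ℂ) :=
    ((hasDerivAt_id (x : ℂ)).const_mul k).ccos
  convert h1.comp_ofReal using 1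
  field_simp

lemma sn_deriv (k : ℂ) (hk : k ≠ 0) (x : ℝ) : HasDerivAt (sn k) (cc k x) x := by
  unfold cc sn
  have h1 : HasDerivAt (fun w : ℂ => Complex.sin (k * w) / k)
      (Complex.cos (k * x) * (k * 1) / k) (x : ℂ) :=
    (((hasDerivAt_id (x : ℂ)).const_mul k).csin).div_const k
  convert h1.comp_ofReal using 1
  field_simp

lemma sn_ne (k : ℂ) (hk : k ≠ 0) (hi : k.im ≠ 0) (x : ℝ) (hx : x ≠ 0) : sn k x ≠ 0 := by
  unfold sn
  refine div_ne_zero ?_ hk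
  intro h
  rw [Complex.sin_eq_zero_iff] at h
  obtain ⟨n, hn⟩ := h
  have := congrArg Complex.im hn
  simp at this
  tauto

lemma F_add (k : ℂ) (hk : k ≠ 0) (Y : ℂ × ℂ) (x d : ℝ) :
    F k Y (x + d) = F k Y x * cc k d + G k Y x * sn k d := by
  unfold F G cc sn
  push_cast
  rw [mul_add, Complex.cos_add, Complex.sin_add]
  field_simp
  ring

lemma F_deriv (k : ℂ) (hk : k ≠ 0) (Y : ℂ × ℂ) (x : ℝ) : HasDerivAt (F k Y) (G k Y x) x := by
  have : HasDerivAt (F k Y) _ x :=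
    ((cc_deriv k hk x).const_mul Y.1).add ((sn_deriv k hk x).const_mul Y.2)
  refine this.congr_deriv ?_
  unfold G; ring

lemma G_deriv (k : ℂ) (hk : k ≠ 0) (Y : ℂ × ℂ) (x : ℝ) :
    HasDerivAt (G k Y) (-(k ^ 2 * F k Y x)) x := by
  have : HasDerivAt (G k Y) _ x :=
    ((sn_deriv k hk x).const_mul (k ^ 2 * Y.1)).neg.add ((cc_deriv k hk x).const_mul Y.2)
  refine this.congr_deriv ?_
  unfold F; ring

lemma F_cont (k : ℂ) (hk : k ≠ 0) (Y : ℂ × ℂ) : Continuous (F k Y) :=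
  continuous_iff_continuousAt.2 fun x => (F_deriv k hk Y x).continuousAt
lemma G_cont (k : ℂ) (hk : k ≠ 0) (Y : ℂ × ℂ) : Continuous (G k Y) :=
  continuous_iff_continuousAt.2 fun x => (G_deriv k hk Y x).continuousAt

lemma F_contDiff (k : ℂ) (hk : k ≠ 0) (Y : ℂ × ℂ) : ContDiff ℝ 2 (F k Y) := by
  have h1 : deriv (F k Y) = G k Y := funext fun x => (F_deriv k hk Y x).deriv
  have h2 : deriv (G k Y) = fun x => -(k ^ 2 * F k Y x) := funext fun x => (G_deriv k hk Y x).deriv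
  have hG : ContDiff ℝ 1 (G k Y) := by
    rw [contDiff_one_iff_deriv, h2]
    refine ⟨fun x => (G_deriv k hk Y x).differentiableAt, ?_⟩
    have := F_cont k hk Y
    fun_prop
  rw [show (2 : WithTop ℕ∞) = 1 + 1 by norm_num, contDiff_succ_iff_deriv, h1]
  exact ⟨fun x => (F_deriv k hk Y x).differentiableAt, by simp, hG⟩

lemma F_inv (k : ℂ) (hk : k ≠ 0) (x : ℝ) (U V : ℂ) : F k (inv k x U V) x = U := by
  unfold F inv
  linear_combination U * cs k hk x

lemma G_inv (k : ℂ) (hk : k ≠ 0) (x : ℝ) (U V : ℂ) : G k (inv k x U V) x = V := by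
  unfold G inv
  linear_combination V * cs k hk x

lemma inv_FG (k : ℂ) (hk : k ≠ 0) (x : ℝ) (Y : ℂ × ℂ) : inv k x (F k Y x) (G k Y x) = Y := by
  unfold F G inv
  ext
  · simp only; linear_combination Y.1 * cs k hk x
  · simp only; linear_combination Y.2 * cs k hk x

lemma H_deriv (k : ℂ) (hk : k ≠ 0) (Y : ℂ × ℂ) (x : ℝ) :
    HasDerivAt (H k Y) (-((k ^ 2).im * ‖F k Y x‖ ^ 2)) x := by
  have hF := F_deriv k hk Y x
  have h := (G_deriv k hk Y x).mul (hF.star)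
  have h2 : HasDerivAt (H k Y) _ x := (Complex.imCLM.hasFDerivAt.comp_hasDerivAt x h)
  refine h2.congr_deriv ?_
  rw [← Complex.normSq_eq_norm_sq, Complex.normSq_apply]
  simp only [Complex.imCLM_apply, Complex.add_im, Complex.mul_im, Complex.neg_im, Complex.neg_re,
    Complex.star_def, Complex.conj_re, Complex.conj_im, Complex.mul_re]
  ring

lemma H_int (k : ℂ) (hk : k ≠ 0) (Y : ℂ × ℂ) (x y : ℝ) :
    H k Y y = H k Y x - (k ^ 2).im * ∫ r in x..y, ‖F k Y r‖ ^ 2 := by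
  have := intervalIntegral.integral_eq_sub_of_hasDerivAt
    (a := x) (b := y) (fun r _ => H_deriv k hk Y r) (by
      have := F_cont k hk Y
      apply Continuous.intervalIntegrable; fun_prop)
  rw [intervalIntegral.integral_neg, intervalIntegral.integral_const_mul] at this
  linarith

/-- jump map at `t` with ratio `r` -/
noncomputable def J (k : ℂ) (t : ℝ) (r : ℂ) : (ℂ × ℂ) →ₗ[ℂ] (ℂ × ℂ) where
  toFun Y := inv k t (r * F k Y t) (G k Y t / r)
  map_add' Y Z := by
    unfold inv F G; ext <;> simp <;> ring
  map_smul' m Y := by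
    unfold inv F G; ext <;> simp <;> ring

lemma F_J (k : ℂ) (hk : k ≠ 0) (t : ℝ) (r : ℂ) (Y : ℂ × ℂ) : F k (J k t r Y) t = r * F k Y t :=
  F_inv k hk _ _ _
lemma G_J (k : ℂ) (hk : k ≠ 0) (t : ℝ) (r : ℂ) (Y : ℂ × ℂ) : G k (J k t r Y) t = G k Y t / r :=
  G_inv k hk _ _ _

/-- the Wronskian in coefficients -/
noncomputable def W (Y Z : ℂ × ℂ) : ℂ := Y.2 * Z.1 - Y.1 * Z.2

lemma W_FG (k : ℂ) (hk : k ≠ 0) (Y Z : ℂ × ℂ) (x : ℝ) :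
    G k Y x * F k Z x - F k Y x * G k Z x = W Y Z := by
  unfold F G W
  linear_combination (Y.2 * Z.1 - Y.1 * Z.2) * cs k hk x

lemma W_J (k : ℂ) (hk : k ≠ 0) (t : ℝ) (r : ℂ) (hr : r ≠ 0) (Y Z : ℂ × ℂ) :
    W (J k t r Y) (J k t r Z) = W Y Z := by
  rw [← W_FG k hk _ _ t, ← W_FG k hk Y Z t, F_J k hk, F_J k hk, G_J k hk, G_J k hk]
  field_simp

lemma H_J (k : ℂ) (hk : k ≠ 0) (t : ℝ) (r : ℝ) (hr : r ≠ 0) (Y : ℂ × ℂ) :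
    H k (J k t r Y) t = H k Y t := by
  unfold H
  rw [F_J k hk, G_J k hk]
  have : (r : ℂ) ≠ 0 := by exact_mod_cast hr
  rw [map_mul, Complex.conj_ofReal]
  congr 1
  field_simp

/-! atoms -/

variable (T : Set ℝ) (a : ℝ) (hT : ∀ x : ℝ, (T ∩ Ioo a x).Finite)

/-- atoms in `(a,x)` -/
noncomputable def A (x : ℝ) : Finset ℝ := (hT x).toFinset

lemma mem_A {x t : ℝ} : t ∈ A T a hT x ↔ t ∈ T ∧ a < t ∧ t < x := by
  simp [A]

/-- propagator -/
noncomputable def P (k : ℂ) (ρ : ℝ → ℝ) (x : ℝ) : Module.End ℂ (ℂ × ℂ) :=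
  (((A T a hT x).sort (· ≥ ·)).map fun t => (J k t (ρ t) : Module.End ℂ (ℂ × ℂ))).prod

lemma P_insert (k : ℂ) (ρ : ℝ → ℝ) {t y : ℝ} (h : A T a hT y = insert t (A T a hT t)) :
    P T a hT k ρ y = (J k t (ρ t) : Module.End ℂ (ℂ × ℂ)) * P T a hT k ρ t := by
  unfold P
  rw [h, Finset.sort_insert]
  · simp
  · intro b hb; exact ((mem_A T a hT).1 hb).2.2.le
  · intro hb; exact lt_irrefl _ ((mem_A T a hT).1 hb).2.2

lemma P_congr (k : ℂ) (ρ : ℝ → ℝ) {x y : ℝ} (h : A T a hT y = A T a hT x) :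
    P T a hT k ρ y = P T a hT k ρ x := by
  unfold P
  rw [h]

lemma P_empty (k : ℂ) (ρ : ℝ → ℝ) {x : ℝ} (h : A T a hT x = ∅) :
    P T a hT k ρ x = 1 := by
  unfold P
  simp [h]

lemma A_ind (p : ℝ → Prop) (h0 : ∀ y, a ≤ y → A T a hT y = ∅ → p y)
    (h1 : ∀ t y, t ∈ T → a < t → t < y → A T a hT y = insert t (A T a hT t) → p t → p y)
    (y : ℝ) (hy : a ≤ y) : p y := by
  induction hn : (A T a hT y).card using Nat.strong_induction_on generalizing y with
  | _ n ih =>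
    rcases (A T a hT y).eq_empty_or_nonempty with h | h
    · exact h0 y hy h
    · set t := (A T a hT y).max' h with ht
      have htm : t ∈ A T a hT y := Finset.max'_mem _ _
      obtain ⟨htT, hat, hty⟩ := (mem_A T a hT).1 htm
      have hins : A T a hT y = insert t (A T a hT t) := by
        ext s
        rw [Finset.mem_insert, mem_A, mem_A]
        constructor
        · rintro ⟨h1, h2, h3⟩
          have : s ≤ t := Finset.le_max' _ _ ((mem_A T a hT).2 ⟨h1, h2, h3⟩)
          rcases this.eq_or_lt with h | h
          · exact Or.inl h
          · exact Or.inr ⟨h1, h2, h⟩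
        · rintro (rfl | ⟨h1, h2, h3⟩)
          · exact ⟨htT, hat, hty⟩
          · exact ⟨h1, h2, h3.trans hty⟩
      have hnot : t ∉ A T a hT t := fun hb => lt_irrefl _ ((mem_A T a hT).1 hb).2.2
      refine h1 t y htT hat hty hins (ih _ ?_ t hat.le rfl)
      rw [← hn, hins, Finset.card_insert_of_notMem hnot]
      omega

lemma A_empty_a : A T a hT a = ∅ := by
  ext s; simp only [mem_A]; constructor
  · rintro ⟨_, h, h'⟩; exact absurd h h'.not_gt
  · simp

lemma A_left {t : ℝ} (h : IsClosed (T \ {t})) : ∀ᶠ y in 𝓝[≤] t, A T a hT y = A T a hT t := by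
  have : ∀ᶠ y in 𝓝 t, y ∉ T \ {t} := h.isOpen_compl.mem_nhds (by simp)
  obtain ⟨ε, hε, hb⟩ := Metric.eventually_nhds_iff.1 this
  have h2 : ∀ᶠ y in 𝓝[≤] t, t - ε < y := nhdsWithin_le_nhds (lt_mem_nhds (by linarith))
  filter_upwards [h2, self_mem_nhdsWithin] with y hy hy'
  ext s
  rw [mem_A, mem_A]
  simp only [mem_Iic] at hy'
  constructor
  · rintro ⟨h1, h2, h3⟩; exact ⟨h1, h2, by linarith⟩
  · rintro ⟨h1, h2, h3⟩
    refine ⟨h1, h2, ?_⟩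
    by_contra hc
    refine hb (y := s) ?_ ⟨h1, fun h => by simp at h; linarith⟩
    rw [Real.dist_eq, abs_lt]; constructor <;> linarith

lemma A_right {t : ℝ} (h : IsClosed (T \ {t})) (htT : t ∈ T) (hat : a < t) :
    ∀ᶠ y in 𝓝[>] t, A T a hT y = insert t (A T a hT t) := by
  have : ∀ᶠ y in 𝓝 t, y ∉ T \ {t} := h.isOpen_compl.mem_nhds (by simp)
  obtain ⟨ε, hε, hb⟩ := Metric.eventually_nhds_iff.1 this
  have h2 : ∀ᶠ y in 𝓝[>] t, y < t + ε := nhdsWithin_le_nhds (gt_mem_nhds (by linarith))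
  filter_upwards [h2, self_mem_nhdsWithin] with y hy hy'
  ext s
  rw [Finset.mem_insert, mem_A, mem_A]
  simp only [mem_Ioi] at hy'
  constructor
  · rintro ⟨h1, h2, h3⟩
    by_cases hs : s = t
    · exact Or.inl hs
    · refine Or.inr ⟨h1, h2, ?_⟩
      by_contra hc
      refine hb (y := s) ?_ ⟨h1, hs⟩
      rw [Real.dist_eq, abs_lt]; constructor <;> linarith
  · rintro (rfl | ⟨h1, h2, h3⟩)
    · exact ⟨htT, hat, hy'⟩
    · exact ⟨h1, h2, by linarith⟩

lemma A_nhds {t : ℝ} (h : IsClosed T) (htT : t ∉ T) :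
    ∀ᶠ y in 𝓝 t, A T a hT y = A T a hT t := by
  have : ∀ᶠ y in 𝓝 t, y ∉ T := h.isOpen_compl.mem_nhds htT
  obtain ⟨ε, hε, hb⟩ := Metric.eventually_nhds_iff.1 this
  filter_upwards [lt_mem_nhds (show t - ε < t by linarith), gt_mem_nhds (show t < t + ε by linarith)]
    with y hy hy'
  ext s
  rw [mem_A, mem_A]
  constructor
  · rintro ⟨h1, h2, h3⟩
    refine ⟨h1, h2, ?_⟩
    by_contra hc
    refine hb (y := s) ?_ h1
    rw [Real.dist_eq, abs_lt]; constructor <;> linarith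
  · rintro ⟨h1, h2, h3⟩
    refine ⟨h1, h2, ?_⟩
    by_contra hc
    refine hb (y := s) ?_ h1
    rw [Real.dist_eq, abs_lt]; constructor <;> linarith

lemma A_mono {x y : ℝ} (h : x ≤ y) : A T a hT x ⊆ A T a hT y := by
  intro s; rw [mem_A, mem_A]; rintro ⟨h1, h2, h3⟩; exact ⟨h1, h2, by linarith⟩

lemma A_Ioc {t y r : ℝ} (h : A T a hT y = insert t (A T a hT t)) (h1 : t < r) (h2 : r ≤ y) :
    A T a hT r = A T a hT y := by
  apply Finset.Subset.antisymm (A_mono T a hT h2)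
  have ht : t ∈ A T a hT y := by rw [h]; simp
  have := (mem_A T a hT).1 ht
  rw [h]
  intro s hs
  rw [Finset.mem_insert] at hs
  rcases hs with rfl | hs
  · exact (mem_A T a hT).2 ⟨this.1, this.2.1, h1⟩
  · exact A_mono T a hT h1.le hs

/-- canonical solution -/
noncomputable def U (k : ℂ) (ρ : ℝ → ℝ) (Y : ℂ × ℂ) (x : ℝ) : ℂ := F k (P T a hT k ρ x Y) x

lemma HU (k : ℂ) (hk : k ≠ 0) (ρ : ℝ → ℝ) (hρ : ∀ t, ρ t ≠ 0) (Y : ℂ × ℂ) (y : ℝ) (hy : a ≤ y) :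
    IntervalIntegrable (fun r => ‖U T a hT k ρ Y r‖ ^ 2) volume a y ∧
    H k (P T a hT k ρ y Y) y
      = H k Y a - (k ^ 2).im * ∫ r in a..y, ‖U T a hT k ρ Y r‖ ^ 2 := by
  have hcont : ∀ Z : ℂ × ℂ, Continuous fun r => ‖F k Z r‖ ^ 2 := fun Z => by
    have := F_cont k hk Z
    fun_prop
  refine A_ind T a hT (fun y => IntervalIntegrable (fun r => ‖U T a hT k ρ Y r‖ ^ 2) volume a y ∧
    H k (P T a hT k ρ y Y) y
      = H k Y a - (k ^ 2).im * ∫ r in a..y, ‖U T a hT k ρ Y r‖ ^ 2) ?_ ?_ y hy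
  · intro y hy h
    have hP : ∀ r ∈ Set.uIoc a y, ‖F k Y r‖ ^ 2 = ‖U T a hT k ρ Y r‖ ^ 2 := by
      intro r hr
      rw [uIoc_of_le hy] at hr
      have : A T a hT r = ∅ := Finset.subset_empty.1 (h ▸ A_mono T a hT hr.2)
      simp [U, P_empty T a hT k ρ this]
    refine ⟨((hcont Y).intervalIntegrable a y).congr hP, ?_⟩
    rw [P_empty T a hT k ρ h, Module.End.one_apply, H_int k hk Y a y]
    congr 2
    exact intervalIntegral.integral_congr_ae (Eventually.of_forall hP)
  · rintro t y htT hat hty hA ⟨h1, h2⟩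
    have hP : ∀ r ∈ Set.uIoc t y, ‖F k (P T a hT k ρ y Y) r‖ ^ 2 = ‖U T a hT k ρ Y r‖ ^ 2 := by
      intro r hr
      rw [uIoc_of_le hty.le] at hr
      rw [U, P_congr T a hT k ρ (A_Ioc T a hT hA hr.1 hr.2)]
    have hi := ((hcont (P T a hT k ρ y Y)).intervalIntegrable (μ := volume) t y).congr hP
    refine ⟨h1.trans hi, ?_⟩
    rw [H_int k hk _ t y, intervalIntegral.integral_congr_ae (Eventually.of_forall hP),
      ← intervalIntegral.integral_add_adjacent_intervals h1 hi, mul_add]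
    have : H k (P T a hT k ρ y Y) t = H k (P T a hT k ρ t Y) t := by
      rw [P_insert T a hT k ρ hA, Module.End.mul_apply, H_J k hk _ _ (hρ t)]
    rw [this, h2]
    ring

lemma WU (k : ℂ) (hk : k ≠ 0) (ρ : ℝ → ℝ) (hρ : ∀ t, ρ t ≠ 0) (Y Z : ℂ × ℂ) (y : ℝ) (hy : a ≤ y) :
    W (P T a hT k ρ y Y) (P T a hT k ρ y Z) = W Y Z := by
  refine A_ind T a hT (fun y => W (P T a hT k ρ y Y) (P T a hT k ρ y Z) = W Y Z) ?_ ?_ y hy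
  · intro y hy h
    simp [P_empty T a hT k ρ h]
  · intro t y _ _ _ hA h
    rw [P_insert T a hT k ρ hA, Module.End.mul_apply, Module.End.mul_apply, W_J k hk _ _ _, h]
    exact_mod_cast hρ t

/-- the window lemma -/
lemma window (γ : ℝ) (hγ : 0 < γ) (hsep : ∀ s ∈ T, ∀ t ∈ T, s ≠ t → γ ≤ |s - t|)
    (g : ℝ → ℝ) (hg0 : ∀ x, 0 ≤ g x) (hg : IntegrableOn g (Ioi a)) (η R₀ d : ℝ) (hd : 0 < d)
    (hdγ : d ≤ γ / 8)
    (h : ∀ x, R₀ ≤ x → (∀ t ∈ T, t < x ∨ x + d < t) → η ≤ g x + g (x + d)) : η ≤ 0 := by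
  have hlim := intervalIntegral_tendsto_integral_Ioi a hg tendsto_id
  have hlim2 := (hlim.comp (tendsto_atTop_add_const_right atTop γ tendsto_id)).sub hlim
  rw [sub_self] at hlim2
  have key : ∀ᶠ R in atTop, η * d ≤ 2 * ((∫ x in a..(R + γ), g x) - ∫ x in a..R, g x) := by
    filter_upwards [eventually_ge_atTop R₀, eventually_ge_atTop a] with R hR hRa
    have hii : ∀ x y : ℝ, a ≤ x → a ≤ y → IntervalIntegrable g volume x y := by
      intro x y hx hy
      rw [intervalIntegrable_iff]
      refine hg.mono_set ?_
      intro s hs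
      rw [mem_uIoc] at hs
      rcases hs with hs | hs
      · exact lt_of_le_of_lt hx hs.1
      · exact lt_of_le_of_lt hy hs.1
    -- window
    obtain ⟨x0, hx0R, hx0, hfree⟩ : ∃ x0, R ≤ x0 ∧ x0 ≤ R + γ / 2 ∧
        ∀ t ∈ T, t < x0 ∨ x0 + 2 * d < t := by
      by_cases hc : ∀ t ∈ T, t < R ∨ R + 2 * d < t
      · exact ⟨R, le_rfl, by linarith, hc⟩
      · push Not at hc
        obtain ⟨t, htT, h1, h2⟩ := hc
        refine ⟨R + γ / 2, by linarith, le_rfl, ?_⟩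
        intro s hs
        by_cases hst : s = t
        · left; subst hst; linarith
        · have := hsep s hs t htT hst
          rcases le_abs.1 this with h | h
          · right; linarith
          · left; linarith
    have e1 : η * d ≤ ∫ x in x0..(x0 + d), (g x + g (x + d)) := by
      have : ∫ x in x0..(x0 + d), η = η * d := by simp [mul_comm]
      rw [← this]
      refine intervalIntegral.integral_mono_on (by linarith) (by simp) ?_ ?_
      · refine (hii _ _ (by linarith) (by linarith)).add ?_
        have := (hii (x0 + d) (x0 + d + d) (by linarith) (by linarith)).comp_add_right d
        simpa using this
      · intro x hx
        refine h x (by linarith [hx.1]) ?_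
        intro t ht
        rcases hfree t ht with h | h
        · left; linarith [hx.1]
        · right; linarith [hx.2]
    have e2 : ∫ x in x0..(x0 + d), (g x + g (x + d)) =
        (∫ x in x0..(x0 + d), g x) + ∫ x in (x0 + d)..(x0 + d + d), g x := by
      rw [intervalIntegral.integral_add (hii _ _ (by linarith) (by linarith))]
      · rw [intervalIntegral.integral_comp_add_right]
      · have := (hii (x0 + d) (x0 + d + d) (by linarith) (by linarith)).comp_add_right d
        simpa using this
    have e3 : ∀ p q : ℝ, R ≤ p → p ≤ q → q ≤ R + γ →
        ∫ x in p..q, g x ≤ ∫ x in R..(R + γ), g x := by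
      intro p q h1 h2 h3
      exact intervalIntegral.integral_mono_interval h1 h2 h3 (Eventually.of_forall hg0)
        (hii _ _ hRa (by linarith))
    have e4 := e3 x0 (x0 + d) hx0R (by linarith) (by linarith)
    have e5 := e3 (x0 + d) (x0 + d + d) (by linarith) (by linarith) (by linarith)
    have e6 := intervalIntegral.integral_add_adjacent_intervals (hii a R le_rfl hRa)
      (hii R (R + γ) hRa (by linarith))
    linarith
  have hle : η * d ≤ 2 * 0 := ge_of_tendsto (hlim2.const_mul 2) key
  nlinarith

lemma P_window (k : ℂ) (ρ : ℝ → ℝ) {x d : ℝ} (hd : 0 < d) (h : ∀ t ∈ T, t < x ∨ x + d < t) :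
    P T a hT k ρ (x + d) = P T a hT k ρ x := by
  apply P_congr
  ext s
  rw [mem_A, mem_A]
  constructor
  · rintro ⟨h1, h2, h3⟩
    rcases h s h1 with h | h
    · exact ⟨h1, h2, h⟩
    · linarith
  · rintro ⟨h1, h2, h3⟩
    exact ⟨h1, h2, by linarith⟩

lemma U_W_zero (k : ℂ) (hk : k ≠ 0) (hi : k.im ≠ 0) (ρ : ℝ → ℝ) (hρ : ∀ t, ρ t ≠ 0)
    (γ : ℝ) (hγ : 0 < γ) (hsep : ∀ s ∈ T, ∀ t ∈ T, s ≠ t → γ ≤ |s - t|) (Y Z : ℂ × ℂ)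
    (hY : IntegrableOn (fun r => ‖U T a hT k ρ Y r‖ ^ 2) (Ioi a))
    (hZ : IntegrableOn (fun r => ‖U T a hT k ρ Z r‖ ^ 2) (Ioi a)) : W Y Z = 0 := by
  have hs := sn_ne k hk hi (γ / 8) (by positivity)
  have := window T a γ hγ hsep
    (fun r => ‖U T a hT k ρ Y r‖ ^ 2 + ‖U T a hT k ρ Z r‖ ^ 2) (fun x => by positivity) (hY.add hZ)
    (‖sn k (γ / 8)‖ * ‖W Y Z‖) a (γ / 8) (by positivity) le_rfl (by
      intro x hx hfree
      have hP := P_window T a hT k ρ (by positivity) hfree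
      have e1 : sn k (γ / 8) * W Y Z = U T a hT k ρ Y (x + γ / 8) * U T a hT k ρ Z x
          - U T a hT k ρ Y x * U T a hT k ρ Z (x + γ / 8) := by
        rw [← WU T a hT k hk ρ hρ Y Z x hx, ← W_FG k hk _ _ x]
        unfold U
        rw [hP, F_add k hk, F_add k hk]
        ring
      rw [← norm_mul, e1]
      refine (norm_sub_le _ _).trans ?_
      rw [norm_mul, norm_mul]
      nlinarith [sq_nonneg (‖U T a hT k ρ Y (x + γ / 8)‖ - ‖U T a hT k ρ Z x‖),
        sq_nonneg (‖U T a hT k ρ Y x‖ - ‖U T a hT k ρ Z (x + γ / 8)‖),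
        sq_nonneg ‖U T a hT k ρ Y (x + γ / 8)‖, sq_nonneg ‖U T a hT k ρ Z x‖,
        sq_nonneg ‖U T a hT k ρ Y x‖, sq_nonneg ‖U T a hT k ρ Z (x + γ / 8)‖])
  have h2 : ‖W Y Z‖ ≤ 0 := by
    have h3 := norm_pos_iff.2 hs
    by_contra hc
    push Not at hc
    nlinarith [mul_pos h3 hc]
  simpa using h2

lemma F_ne_of (k : ℂ) (hk : k ≠ 0) (hi : k.im ≠ 0) (Y : ℂ × ℂ) (hY : Y ≠ 0) (x y : ℝ)
    (hx : F k Y x = 0) (hxy : x ≠ y) : F k Y y ≠ 0 := by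
  intro h
  have h1 := F_add k hk Y x (y - x)
  rw [add_sub_cancel, h, hx, zero_mul, zero_add] at h1
  have h2 := sn_ne k hk hi (y - x) (sub_ne_zero.2 hxy.symm)
  have h3 : G k Y x = 0 := by
    rcases mul_eq_zero.1 h1.symm with h | h
    · exact h
    · exact absurd h h2
  apply hY
  rw [← inv_FG k hk x Y, hx, h3]
  simp [inv]

lemma U_a_ne (k : ℂ) (hk : k ≠ 0) (hi : k.im ≠ 0) (hz : 0 < (k ^ 2).im)
    (ρ : ℝ → ℝ) (hρ : ∀ t, ρ t ≠ 0)
    (hTc : IsClosed T) (haT : a ∉ T)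
    (γ : ℝ) (hγ : 0 < γ) (hsep : ∀ s ∈ T, ∀ t ∈ T, s ≠ t → γ ≤ |s - t|) (Y : ℂ × ℂ) (hY0 : Y ≠ 0)
    (hY : IntegrableOn (fun r => ‖U T a hT k ρ Y r‖ ^ 2) (Ioi a)) : F k Y a ≠ 0 := by
  intro ha0
  have hHa : H k Y a = 0 := by simp [H, ha0]
  -- a point `b > a` with positive integral
  obtain ⟨b, hab, hb⟩ : ∃ b, a < b ∧ A T a hT b = ∅ := by
    have h1 : ∀ᶠ y in 𝓝[>] a, A T a hT y = A T a hT a := nhdsWithin_le_nhds (A_nhds T a hT hTc haT)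
    obtain ⟨b, hb, hb'⟩ := (h1.and self_mem_nhdsWithin).exists
    exact ⟨b, hb', hb.trans (A_empty_a T a hT)⟩
  have hpos : 0 < ∫ r in a..b, ‖U T a hT k ρ Y r‖ ^ 2 := by
    refine intervalIntegral.intervalIntegral_pos_of_pos_on (HU T a hT k hk ρ hρ Y b hab.le).1 ?_ hab
    intro x hx
    have : A T a hT x = ∅ := Finset.subset_empty.1 (hb ▸ A_mono T a hT hx.2.le)
    have h1 : U T a hT k ρ Y x = F k Y x := by simp [U, P_empty T a hT k ρ this]
    rw [h1]
    have := F_ne_of k hk hi Y hY0 a x ha0 hx.1.ne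
    positivity
  set I := ∫ r in a..b, ‖U T a hT k ρ Y r‖ ^ 2 with hI
  have hs := sn_ne k hk hi (γ / 8) (by positivity)
  set K := 1 + ‖cc k (γ / 8)‖ with hK
  have hKpos : 0 < K := by positivity
  have := window T a γ hγ hsep
    (fun r => K * ‖U T a hT k ρ Y r‖ ^ 2) (fun x => by positivity) (hY.const_mul K)
    (‖sn k (γ / 8)‖ * ((k ^ 2).im * I)) b (γ / 8) (by positivity) le_rfl (by
      intro x hx hfree
      have hP := P_window T a hT k ρ (by positivity) hfree
      have hxa : a ≤ x := by linarith
      have hH := (HU T a hT k hk ρ hρ Y x hxa).2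
      have hmono : I ≤ ∫ r in a..x, ‖U T a hT k ρ Y r‖ ^ 2 :=
        intervalIntegral.integral_mono_interval le_rfl hab.le hx
          (Eventually.of_forall fun r => by positivity) (HU T a hT k hk ρ hρ Y x hxa).1
      have h1 : (k ^ 2).im * I ≤ ‖G k (P T a hT k ρ x Y) x‖ * ‖F k (P T a hT k ρ x Y) x‖ := by
        have h2 : |H k (P T a hT k ρ x Y) x| ≤
            ‖G k (P T a hT k ρ x Y) x * (starRingEnd ℂ) (F k (P T a hT k ρ x Y) x)‖ :=
          Complex.abs_im_le_norm _
        rw [norm_mul, RCLike.norm_conj] at h2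
        have h3 := neg_le_abs (H k (P T a hT k ρ x Y) x)
        have h4 := mul_le_mul_of_nonneg_left hmono hz.le
        linarith
      have e1 : G k (P T a hT k ρ x Y) x * sn k (γ / 8) =
          U T a hT k ρ Y (x + γ / 8) - U T a hT k ρ Y x * cc k (γ / 8) := by
        unfold U
        rw [hP, F_add k hk]
        ring
      have e2 : ‖G k (P T a hT k ρ x Y) x‖ * ‖sn k (γ / 8)‖ ≤
          ‖U T a hT k ρ Y (x + γ / 8)‖ + ‖U T a hT k ρ Y x‖ * ‖cc k (γ / 8)‖ := by
        rw [← norm_mul, e1, ← norm_mul]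
        exact norm_sub_le _ _
      change (k ^ 2).im * I ≤ ‖G k (P T a hT k ρ x Y) x‖ * ‖U T a hT k ρ Y x‖ at h1
      have e3 := mul_le_mul_of_nonneg_left h1 (norm_nonneg (sn k (γ / 8)))
      have e4 := mul_le_mul_of_nonneg_right e2 (norm_nonneg (U T a hT k ρ Y x))
      set p := ‖U T a hT k ρ Y (x + γ / 8)‖
      set q := ‖U T a hT k ρ Y x‖
      set c := ‖cc k (γ / 8)‖
      have hc : 0 ≤ c := norm_nonneg _
      have : (p + q * c) * q ≤ K * q ^ 2 + K * p ^ 2 := by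
        rw [hK]
        nlinarith [sq_nonneg (p - q), mul_nonneg hc (sq_nonneg p), sq_nonneg p, sq_nonneg q]
      change ‖sn k (γ / 8)‖ * ((k ^ 2).im * I) ≤ K * q ^ 2 + K * p ^ 2
      linarith)
  have : 0 < ‖sn k (γ / 8)‖ * ((k ^ 2).im * I) :=
    mul_pos (norm_pos_iff.2 hs) (mul_pos hz hpos)
  linarith

lemma exists_U (k : ℂ) (hk : k ≠ 0) (hz : 0 < (k ^ 2).im)
    (ρ : ℝ → ℝ) (hρ : ∀ t, ρ t ≠ 0) :
    ∃ Y : ℂ × ℂ, Y ≠ 0 ∧ IntegrableOn (fun r => ‖U T a hT k ρ Y r‖ ^ 2) (Ioi a) := by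
  let K : ℕ → Set (ℂ × ℂ) := fun n =>
    {Y | ‖Y‖ = 1 ∧ 0 ≤ H k (P T a hT k ρ (a + n) Y) (a + n)}
  have hPc : ∀ x, Continuous fun Y => P T a hT k ρ x Y := fun x =>
    LinearMap.continuous_of_finiteDimensional _
  have hKcl : ∀ n, IsClosed (K n) := by
    intro n
    have hKn : K n = {Y | ‖Y‖ = 1} ∩ {Y | 0 ≤ H k (P T a hT k ρ (a + n) Y) (a + n)} := rfl
    rw [hKn]
    refine (isClosed_eq continuous_norm continuous_const).inter (isClosed_le continuous_const ?_)
    have := hPc (a + n)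
    unfold H F G
    refine Complex.continuous_im.comp (Continuous.mul (by fun_prop) ?_)
    exact Complex.continuous_conj.comp (by fun_prop)
  have hne : (⋂ n, K n).Nonempty := by
    refine IsCompact.nonempty_iInter_of_sequence_nonempty_isCompact_isClosed K ?_ ?_ ?_ hKcl
    · rintro n Y ⟨h1, h2⟩
      refine ⟨h1, ?_⟩
      have e0 := HU T a hT k hk ρ hρ Y (a + n) (by simp)
      have e1 := HU T a hT k hk ρ hρ Y (a + (n + 1 : ℕ)) (by simp; positivity)
      have hmono := intervalIntegral.integral_mono_interval (le_refl a)
        (show a ≤ a + n by simp) (show a + (n : ℝ) ≤ a + (n + 1 : ℕ) by simp)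
        (Eventually.of_forall fun r => by positivity) e1.1
      rw [e1.2] at h2
      rw [e0.2]
      have := mul_le_mul_of_nonneg_left hmono hz.le
      linarith
    · intro n
      let L : (ℂ × ℂ) →ₗ[ℂ] ℂ :=
        { toFun := fun Y => F k (P T a hT k ρ (a + n) Y) (a + n)
          map_add' := fun Y Z => by simp [F]; ring
          map_smul' := fun m Y => by simp [F]; ring }
      have hker : LinearMap.ker L ≠ ⊥ := by
        apply LinearMap.ker_ne_bot_of_finrank_lt
        simp
      obtain ⟨Y, hY, hY0⟩ := (Submodule.ne_bot_iff _).1 hker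
      have hn : (‖Y‖ : ℂ) ≠ 0 := by simpa using hY0
      refine ⟨((‖Y‖ : ℂ)⁻¹) • Y, ?_, ?_⟩
      · rw [norm_smul, norm_inv]
        simp [hY0]
      · have h1 : L ((‖Y‖ : ℂ)⁻¹ • Y) = 0 := by
          rw [map_smul, LinearMap.mem_ker.1 hY, smul_zero]
        have h2 : F k (P T a hT k ρ (a + n) ((‖Y‖ : ℂ)⁻¹ • Y)) (a + n) = 0 := h1
        simp only [H, h2]
        simp
    · refine (isCompact_sphere (0 : ℂ × ℂ) 1).of_isClosed_subset (hKcl 0) ?_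
      rintro Y ⟨h1, _⟩
      simpa using h1
  obtain ⟨Y, hY⟩ := hne
  rw [mem_iInter] at hY
  refine ⟨Y, ?_, ?_⟩
  · intro h
    have := (hY 0).1
    rw [h] at this
    simp at this
  · refine integrableOn_Ioi_of_intervalIntegral_norm_bounded (l := atTop)
      (b := fun n : ℕ => a + n) (H k Y a / (k ^ 2).im) a ?_ ?_ ?_
    · intro n
      have := (HU T a hT k hk ρ hρ Y (a + n) (by simp)).1
      rwa [intervalIntegrable_iff, uIoc_of_le (by simp)] at this
    · exact tendsto_atTop_add_const_left _ _ tendsto_natCast_atTop_atTop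
    · refine Eventually.of_forall fun n => ?_
      have h1 := (hY n).2
      rw [(HU T a hT k hk ρ hρ Y (a + n) (by simp)).2] at h1
      rw [le_div_iff₀ hz]
      simp only [norm_pow, norm_norm]
      linarith

end L2Sol

namespace L2Sol

variable (ts : ℕ → ℝ) (a : ℝ) (hT : ∀ x : ℝ, (Set.range ts ∩ Ioo a x).Finite)

lemma offAtoms_uniqueDiff (hTc : IsClosed (Set.range ts)) :
    UniqueDiffOn ℝ (offAtoms ts (Ici a)) := by
  unfold offAtoms
  rw [Set.sdiff_eq]
  exact (uniqueDiffOn_Ici a).inter hTc.isOpen_compl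

lemma U_eventually (k : ℂ) (ρ : ℝ → ℝ) (Y : ℂ × ℂ) (hTc : IsClosed (Set.range ts)) {x : ℝ}
    (hx : x ∉ Set.range ts) :
    U (Set.range ts) a hT k ρ Y =ᶠ[𝓝 x] F k (P (Set.range ts) a hT k ρ x Y) := by
  filter_upwards [A_nhds (Set.range ts) a hT hTc hx] with y hy
  rw [U, P_congr _ a hT k ρ hy]

lemma U_derivWithin (k : ℂ) (hk : k ≠ 0) (ρ : ℝ → ℝ) (Y : ℂ × ℂ) (hTc : IsClosed (Set.range ts))
    {x : ℝ} (hx : x ∈ offAtoms ts (Ici a)) :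
    derivWithin (U (Set.range ts) a hT k ρ Y) (offAtoms ts (Ici a)) x
      = G k (P (Set.range ts) a hT k ρ x Y) x := by
  have h := (F_deriv k hk (P (Set.range ts) a hT k ρ x Y) x).congr_of_eventuallyEq
    (U_eventually ts a hT k ρ Y hTc hx.2)
  exact h.hasDerivWithinAt.derivWithin (offAtoms_uniqueDiff ts a hTc x hx)

lemma U_isSol (bs : ℕ → ℝ) (k : ℂ) (hk : k ≠ 0) (ρ : ℝ → ℝ) (Y : ℂ × ℂ)
    (hTc : IsClosed (Set.range ts)) (hTc' : ∀ t, IsClosed (Set.range ts \ {t}))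
    (hρ : ∀ n, ρ (ts n) = Real.sqrt (bs n)) :
    IsInterfaceSolution ts bs (k ^ 2) (Ici a) (U (Set.range ts) a hT k ρ Y) := by
  refine ⟨?_, ?_, ?_⟩
  · intro x hx
    exact ((F_contDiff k hk _).contDiffAt.congr_of_eventuallyEq
      (U_eventually ts a hT k ρ Y hTc hx.2)).contDiffWithinAt
  · intro x hx
    have h := (G_deriv k hk (P (Set.range ts) a hT k ρ x Y) x).hasDerivWithinAt
      (s := offAtoms ts (Ici a))
    have h2 := h.congr_of_eventuallyEq
      (f₁ := derivWithin (U (Set.range ts) a hT k ρ Y) (offAtoms ts (Ici a))) (by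
        filter_upwards [self_mem_nhdsWithin,
          nhdsWithin_le_nhds (A_nhds (Set.range ts) a hT hTc hx.2)] with y hy hy'
        rw [U_derivWithin ts a hT k hk ρ Y hTc hy, P_congr _ a hT k ρ hy'])
      (U_derivWithin ts a hT k hk ρ Y hTc hx)
    rw [h2.derivWithin (offAtoms_uniqueDiff ts a hTc x hx), neg_neg]
    rfl
  · intro n hn
    rw [interior_Ici] at hn
    set t := ts n with ht
    have hl : ∀ᶠ y in 𝓝[offAtoms ts (Ici a) ∩ Iio t] t,
        A (Set.range ts) a hT y = A (Set.range ts) a hT t :=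
      nhdsWithin_mono _ (show _ ⊆ Iic t from fun y hy => mem_Iic.2 (le_of_lt (mem_Iio.1 hy.2))) (A_left (Set.range ts) a hT (hTc' t))
    have hr : ∀ᶠ y in 𝓝[offAtoms ts (Ici a) ∩ Ioi t] t,
        A (Set.range ts) a hT y = insert t (A (Set.range ts) a hT t) :=
      nhdsWithin_mono _ (fun y hy => hy.2)
        (A_right (Set.range ts) a hT (hTc' t) (mem_range_self n) hn)
    set Z := P (Set.range ts) a hT k ρ t Y with hZ
    refine ⟨F k Z t, F k (J k t (ρ t) Z) t, G k Z t, G k (J k t (ρ t) Z) t, ?_, ?_, ?_, ?_, ?_, ?_⟩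
    · refine (((F_cont k hk Z).tendsto t).mono_left nhdsWithin_le_nhds).congr' ?_
      filter_upwards [hl] with y hy
      rw [U, P_congr _ a hT k ρ hy]
    · refine (((F_cont k hk _).tendsto t).mono_left nhdsWithin_le_nhds).congr' ?_
      filter_upwards [hr, self_mem_nhdsWithin] with y hy hy'
      rw [U, P_insert _ a hT k ρ hy, Module.End.mul_apply]
    · refine (((G_cont k hk Z).tendsto t).mono_left nhdsWithin_le_nhds).congr' ?_
      filter_upwards [hl, self_mem_nhdsWithin] with y hy hy'
      rw [U_derivWithin ts a hT k hk ρ Y hTc hy'.1, P_congr _ a hT k ρ hy]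
    · refine (((G_cont k hk _).tendsto t).mono_left nhdsWithin_le_nhds).congr' ?_
      filter_upwards [hr, self_mem_nhdsWithin] with y hy hy'
      rw [U_derivWithin ts a hT k hk ρ Y hTc hy'.1, P_insert _ a hT k ρ hy, Module.End.mul_apply]
    · rw [F_J k hk, ht, hρ]
    · rw [G_J k hk, ht, hρ]

lemma const_seg {S : Set ℝ} (k : ℂ) (hk : k ≠ 0) (u D : ℝ → ℂ)
    (hu : ∀ x ∈ S, HasDerivWithinAt u (D x) S x)
    (hD : ∀ x ∈ S, HasDerivWithinAt D (-(k ^ 2 * u x)) S x) {x y : ℝ} (hxy : x ≤ y)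
    (hS : Icc x y ⊆ S) : inv k x (u x) (D x) = inv k y (u y) (D y) := by
  have key : ∀ r ∈ Icc x y, HasDerivWithinAt (fun r => inv k r (u r) (D r)) 0 (Icc x y) r := by
    intro r hr
    have h1 := (hu r (hS hr)).mono hS
    have h2 := (hD r (hS hr)).mono hS
    have hc := (cc_deriv k hk r).hasDerivWithinAt (s := Icc x y)
    have hs := (sn_deriv k hk r).hasDerivWithinAt (s := Icc x y)
    have h3 : HasDerivWithinAt (fun r => inv k r (u r) (D r)) _ (Icc x y) r :=
      ((h1.mul hc).sub (h2.mul hs)).prodMk (((h1.const_mul (k ^ 2)).mul hs).add (h2.mul hc))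
    refine h3.congr_deriv ?_
    ext
    · simp only [Prod.fst_zero]; ring
    · simp only [Prod.snd_zero]; ring
  have := (convex_Icc x y).norm_image_sub_le_of_norm_hasDerivWithin_le (C := 0) key (by simp)
    (left_mem_Icc.2 hxy) (right_mem_Icc.2 hxy)
  rw [zero_mul, norm_le_zero_iff, sub_eq_zero] at this
  exact this.symm

lemma sol_eq_U (bs : ℕ → ℝ) (k : ℂ) (hk : k ≠ 0) (ρ : ℝ → ℝ)
    (hTc : IsClosed (Set.range ts)) (hTc' : ∀ t, IsClosed (Set.range ts \ {t}))
    (hρ : ∀ n, ρ (ts n) = Real.sqrt (bs n)) (haT : a ∉ Set.range ts) (u : ℝ → ℂ)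
    (hu : IsInterfaceSolution ts bs (k ^ 2) (Ici a) u) :
    ∃ Y, ∀ x ∈ offAtoms ts (Ici a), u x = U (Set.range ts) a hT k ρ Y x := by
  set S := offAtoms ts (Ici a) with hSdef
  set D := derivWithin u S with hDdef
  obtain ⟨h1, h2, h3⟩ := hu
  have hud := offAtoms_uniqueDiff ts a hTc
  have hu : ∀ x ∈ S, HasDerivWithinAt u (D x) S x := fun x hx =>
    ((h1.differentiableOn (by norm_num)) x hx).hasDerivWithinAt
  have hD : ∀ x ∈ S, HasDerivWithinAt D (-(k ^ 2 * u x)) S x := by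
    intro x hx
    have h : ContDiffOn ℝ 1 D S := h1.derivWithin hud (by norm_num)
    have h4 := ((h.differentiableOn (by norm_num)) x hx).hasDerivWithinAt
    refine h4.congr_deriv ?_
    rw [← h2 x hx, neg_neg]
  have haS : a ∈ S := ⟨self_mem_Ici, haT⟩
  set Y := inv k a (u a) (D a) with hY
  refine ⟨Y, ?_⟩
  have main : ∀ y, a ≤ y → ∀ x ∈ S, x ≤ y → A (Set.range ts) a hT x = A (Set.range ts) a hT y →
      inv k x (u x) (D x) = P (Set.range ts) a hT k ρ y Y := by
    intro y hy
    refine A_ind (Set.range ts) a hT (fun y => ∀ x ∈ S, x ≤ y →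
      A (Set.range ts) a hT x = A (Set.range ts) a hT y →
      inv k x (u x) (D x) = P (Set.range ts) a hT k ρ y Y) ?_ ?_ y hy
    · intro y hy hA x hx hxy hxA
      rw [P_empty _ a hT k ρ hA, Module.End.one_apply, hY]
      refine (const_seg k hk u D hu hD hx.1 ?_).symm
      intro s hs
      refine ⟨hs.1, fun hsT => ?_⟩
      have hsa : s ≠ a := fun h => haT (h ▸ hsT)
      have hsx : s ≠ x := fun h => hx.2 (h ▸ hsT)
      have : s ∈ A (Set.range ts) a hT x :=
        (mem_A _ a hT).2 ⟨hsT, lt_of_le_of_ne hs.1 hsa.symm, lt_of_le_of_ne hs.2 hsx⟩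
      rw [hxA, hA] at this
      simp at this
    · rintro t y ⟨n, rfl⟩ hat hty hA ih x hx hxy hxA
      set t := ts n with ht
      have htx : t < x := by
        have : t ∈ A (Set.range ts) a hT x := by rw [hxA, hA]; simp
        exact ((mem_A _ a hT).1 this).2.2
      obtain ⟨uL, uR, dL, dR, l1, l2, l3, l4, l5, l6⟩ := h3 n (by rw [interior_Ici]; exact hat)
      rw [← ht] at l1 l2 l3 l4
      -- one-sided neighbourhoods inside `S`
      have hnear : ∀ᶠ s in 𝓝 t, s ∉ Set.range ts \ {t} :=
        (hTc' t).isOpen_compl.mem_nhds (by simp)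
      have hSl : ∀ᶠ s in 𝓝[<] t, s ∈ S ∩ Iio t := by
        filter_upwards [nhdsWithin_le_nhds hnear, nhdsWithin_le_nhds (lt_mem_nhds hat),
          self_mem_nhdsWithin] with s q1 q2 q3
        exact ⟨⟨le_of_lt q2, fun h => q1 ⟨h, ne_of_lt q3⟩⟩, q3⟩
      have hSr : ∀ᶠ s in 𝓝[>] t, s ∈ S ∩ Ioi t := by
        filter_upwards [nhdsWithin_le_nhds hnear,
          self_mem_nhdsWithin] with s q1 q3
        exact ⟨⟨le_of_lt (hat.trans q3), fun h => q1 ⟨h, ne_of_gt q3⟩⟩, q3⟩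
      have hle : 𝓝[<] t ≤ 𝓝[S ∩ Iio t] t := by
        rw [nhdsWithin]
        exact le_inf nhdsWithin_le_nhds (le_principal_iff.2 hSl)
      have hre : 𝓝[>] t ≤ 𝓝[S ∩ Ioi t] t := by
        rw [nhdsWithin]
        exact le_inf nhdsWithin_le_nhds (le_principal_iff.2 hSr)
      have cct : Tendsto (cc k) (𝓝 t) (𝓝 (cc k t)) := (cc_deriv k hk t).continuousAt
      have snt : Tendsto (sn k) (𝓝 t) (𝓝 (sn k t)) := (sn_deriv k hk t).continuousAt
      have hinv : ∀ (l : Filter ℝ) (p q : ℂ), l ≤ 𝓝 t → Tendsto u l (𝓝 p) → Tendsto D l (𝓝 q) →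
          Tendsto (fun s => inv k s (u s) (D s)) l (𝓝 (inv k t p q)) := by
        intro l p q hl hp hq
        have c1 := cct.mono_left hl
        have s1 := snt.mono_left hl
        exact ((hp.mul c1).sub (hq.mul s1)).prodMk_nhds
          (((hp.const_mul (k ^ 2)).mul s1).add (hq.mul c1))
      have eL : inv k t uL dL = P (Set.range ts) a hT k ρ t Y := by
        refine tendsto_nhds_unique (hinv (𝓝[<] t) uL dL nhdsWithin_le_nhds (l1.mono_left hle)
          (l3.mono_left hle)) ?_
        refine tendsto_const_nhds.congr' ?_
        have hAl : ∀ᶠ s in 𝓝[<] t, A (Set.range ts) a hT s = A (Set.range ts) a hT t :=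
          nhdsWithin_mono _ (show _ ⊆ Iic t from fun y hy => mem_Iic.2 (le_of_lt (mem_Iio.1 hy))) (A_left (Set.range ts) a hT (hTc' t))
        filter_upwards [hAl, hSl] with s q1 q2
        exact (ih s q2.1 (le_of_lt q2.2) q1).symm
      have eR : inv k t uR dR = inv k x (u x) (D x) := by
        refine tendsto_nhds_unique (hinv (𝓝[>] t) uR dR nhdsWithin_le_nhds (l2.mono_left hre)
          (l4.mono_left hre)) ?_
        refine tendsto_const_nhds.congr' ?_
        filter_upwards [self_mem_nhdsWithin, nhdsWithin_le_nhds (gt_mem_nhds htx)] with s q1 q2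
        refine (const_seg k hk u D hu hD (le_of_lt q2) ?_).symm
        intro r hr
        have htr : t < r := lt_of_lt_of_le q1 hr.1
        refine ⟨le_of_lt (hat.trans htr), fun hrT => ?_⟩
        have hrx : r ≠ x := fun h => hx.2 (h ▸ hrT)
        have : r ∈ A (Set.range ts) a hT x :=
          (mem_A _ a hT).2 ⟨hrT, hat.trans htr, lt_of_le_of_ne hr.2 hrx⟩
        rw [hxA, hA, Finset.mem_insert, mem_A] at this
        rcases this with h | h
        · linarith
        · linarith [h.2.2]
      rw [← eR, P_insert _ a hT k ρ hA, Module.End.mul_apply, ← eL]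
      change _ = inv k t (ρ t * F k (inv k t uL dL) t) (G k (inv k t uL dL) t / ρ t)
      rw [F_inv k hk, G_inv k hk, l5, l6, ht, hρ]
  intro x hx
  have := main x hx.1 x hx le_rfl rfl
  rw [U, ← this, F_inv k hk]

end L2Sol

/-- for `μ ∈ M_a^{C,γ}(ℝ)` and `Im z > 0` there exists a not identically
vanishing square-integrable solution `u₊` of the interface equation on `[a, ∞)`; any two
such solutions are complex scalar multiples of each other, and every such solution
satisfies `u₊(a) ≠ 0`. -/
theorem l2_solution_exists_unique
    (C γ : ℝ) (hC : 0 < C) (hγ : 0 < γ)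
    (ts bs : ℕ → ℝ)
    (hsep : ∀ n m, n ≠ m → γ ≤ |ts n - ts m|)
    (hbs : ∀ n, 1 < bs n)
    (hbound : ∀ x : ℝ, treeMeasure ts bs (Set.Icc x (x + 1)) ≤ ENNReal.ofReal C)
    (z : ℂ) (hz : 0 < z.im) (a : ℝ) (ha : a ∉ Set.range ts) :
    (∃ u : ℝ → ℂ, IsL2Solution ts bs z a u) ∧
    (∀ u v : ℝ → ℂ, IsL2Solution ts bs z a u → IsL2Solution ts bs z a v →
        ∃ c : ℂ, ∀ x ∈ offAtoms ts (Ici a), v x = c * u x) ∧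
    (∀ u : ℝ → ℂ, IsL2Solution ts bs z a u → u a ≠ 0) := by
  classical
  obtain ⟨k, hkz⟩ : ∃ k : ℂ, k ^ 2 = z := IsAlgClosed.exists_pow_nat_eq z (by norm_num)
  subst hkz
  have hi : k.im ≠ 0 := by
    intro h
    rw [pow_two, Complex.mul_im, h] at hz
    simp at hz
  have hk : k ≠ 0 := by
    rintro rfl
    simp at hi
  have hinj : Function.Injective ts := by
    intro n m hnm
    by_contra hne
    have := hsep n m hne
    rw [hnm, sub_self, abs_zero] at this
    linarith
  have hsep' : ∀ s ∈ Set.range ts, ∀ t ∈ Set.range ts, s ≠ t → γ ≤ |s - t| := by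
    rintro _ ⟨n, rfl⟩ _ ⟨m, rfl⟩ h
    exact hsep n m (fun e => h (by rw [e]))
  have hcl : ∀ Q : Set ℝ, Q ⊆ Set.range ts → IsClosed Q := by
    intro Q hQ
    refine Metric.isClosed_of_pairwise_le_dist hγ ?_
    intro s hs t ht hst
    rw [Real.dist_eq]
    exact hsep' s (hQ hs) t (hQ ht) hst
  have hTc := hcl _ (le_refl (Set.range ts))
  have hTc' : ∀ t, IsClosed (Set.range ts \ {t}) := fun t => hcl _ Set.sdiff_subset
  have hT : ∀ x : ℝ, (Set.range ts ∩ Ioo a x).Finite := by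
    intro x
    have he : IsClosedEmbedding ts := Metric.isClosedEmbedding_of_pairwise_le_dist hγ (by
      intro n m hnm
      simp only [Real.dist_eq]
      exact hsep n m hnm)
    have h1 := (he.isCompact_preimage (isCompact_Icc (a := a) (b := x))).finite_of_discrete
    refine (h1.image ts).subset ?_
    rintro _ ⟨⟨n, rfl⟩, h⟩
    exact ⟨n, ⟨h.1.le, h.2.le⟩, rfl⟩
  let ρ : ℝ → ℝ := fun t => Real.sqrt (bs (Function.invFun ts t))
  have hρ : ∀ n, ρ (ts n) = Real.sqrt (bs n) := fun n => by
    simp only [ρ, Function.leftInverse_invFun hinj n]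
  have hρ0 : ∀ t, ρ t ≠ 0 := fun t =>
    (Real.sqrt_pos.2 (by linarith [hbs (Function.invFun ts t)])).ne'
  have haS : a ∈ offAtoms ts (Ici a) := ⟨self_mem_Ici, ha⟩
  have hUa : ∀ Y, L2Sol.U (Set.range ts) a hT k ρ Y a = L2Sol.F k Y a := fun Y => by
    simp [L2Sol.U, L2Sol.P_empty _ a hT k ρ (L2Sol.A_empty_a (Set.range ts) a hT)]
  have hU0 : ∀ x, L2Sol.U (Set.range ts) a hT k ρ 0 x = 0 := fun x => by
    simp [L2Sol.U, L2Sol.F]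
  have hrep : ∀ u, IsL2Solution ts bs (k ^ 2) a u → ∃ Y, Y ≠ 0 ∧
      (∀ x ∈ offAtoms ts (Ici a), u x = L2Sol.U (Set.range ts) a hT k ρ Y x) ∧
      IntegrableOn (fun r => ‖L2Sol.U (Set.range ts) a hT k ρ Y r‖ ^ 2) (Ioi a) ∧
      L2Sol.F k Y a ≠ 0 := by
    rintro u ⟨h1, ⟨x, hx, hux⟩, h3⟩
    obtain ⟨Y, hY⟩ := L2Sol.sol_eq_U ts a hT bs k hk ρ hTc hTc' hρ ha u h1
    have hY0 : Y ≠ 0 := by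
      rintro rfl
      exact hux (by rw [hY x hx, hU0])
    have hint : IntegrableOn (fun r => ‖L2Sol.U (Set.range ts) a hT k ρ Y r‖ ^ 2) (Ioi a) := by
      refine h3.congr ?_
      have hae : ∀ᵐ r : ℝ, r ∉ Set.range ts := (Set.countable_range ts).ae_notMem volume
      filter_upwards [ae_restrict_of_ae hae, ae_restrict_mem measurableSet_Ioi] with r q1 q2
      rw [hY r ⟨mem_Ici.2 (le_of_lt (mem_Ioi.1 q2)), q1⟩]
    exact ⟨Y, hY0, hY, hint,
      L2Sol.U_a_ne (Set.range ts) a hT k hk hi hz ρ hρ0 hTc ha γ hγ hsep' Y hY0 hint⟩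
  refine ⟨?_, ?_, ?_⟩
  · obtain ⟨Y, hY0, hint⟩ := L2Sol.exists_U (Set.range ts) a hT k hk hz ρ hρ0
    refine ⟨L2Sol.U (Set.range ts) a hT k ρ Y,
      L2Sol.U_isSol ts a hT bs k hk ρ Y hTc hTc' hρ, ⟨a, haS, ?_⟩, hint⟩
    rw [hUa]
    exact L2Sol.U_a_ne (Set.range ts) a hT k hk hi hz ρ hρ0 hTc ha γ hγ hsep' Y hY0 hint
  · intro u v hu hv
    obtain ⟨Y, hY0, hYu, hYi, hYa⟩ := hrep u hu
    obtain ⟨Z, hZ0, hZv, hZi, hZa⟩ := hrep v hv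
    have hW := L2Sol.U_W_zero (Set.range ts) a hT k hk hi ρ hρ0 γ hγ hsep' Y Z hYi hZi
    rw [← L2Sol.W_FG k hk Y Z a] at hW
    set c := L2Sol.F k Z a / L2Sol.F k Y a with hc
    have e1 : L2Sol.F k Z a = c * L2Sol.F k Y a := by rw [hc]; field_simp
    have e2 : L2Sol.G k Z a = c * L2Sol.G k Y a := by
      rw [e1] at hW
      have : L2Sol.F k Y a * (c * L2Sol.G k Y a - L2Sol.G k Z a) = 0 := by
        linear_combination hW
      rcases mul_eq_zero.1 this with h | h
      · exact absurd h hYa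
      · linear_combination -h
    have hZY : Z = c • Y := by
      rw [← L2Sol.inv_FG k hk a Z, e1, e2]
      conv_rhs => rw [← L2Sol.inv_FG k hk a Y]
      simp only [L2Sol.inv, Prod.smul_mk, smul_eq_mul]
      ext
      · simp only; ring
      · simp only; ring
    refine ⟨c, fun x hx => ?_⟩
    rw [hZv x hx, hYu x hx, hZY]
    simp only [L2Sol.U, L2Sol.F, map_smul, Prod.smul_fst, Prod.smul_snd, smul_eq_mul]
    ring
  · intro u hu
    obtain ⟨Y, hY0, hYu, hYi, hYa⟩ := hrep u hu
    rw [hYu a haS, hUa]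
    exact hYa
end

section
/- The m-function is Herglotz: let C, γ > 0, μ ∈ M_a^{C,γ}(ℝ), and a ∈ ℝ ∖ {t_n : n}. For each z in the open upper half-plane ℂ⁺, let u₊(z, ·) be a nonzero solution of the interface equation −u'' = z u for μ on [a, ∞) that is square integrable on (a, ∞), and set m₊(z, a, μ) := u₊'(z, a)/u₊(z, a) (this is independent of the choice of u₊). Then the function z ↦ m₊(z, a, μ) is holomorphic on ℂ⁺ and satisfies Im m₊(z, a, μ) > 0 for all z ∈ ℂ⁺. -/
open Set Filter Topology MeasureTheory

theorem hilbert_herglotz {H : Type*} [NormedAddCommGroup H] [InnerProductSpace ℂ H]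
    (m : ℂ → ℂ) (e c : ℂ → H)
    (h1 : ∀ z w : ℂ, 0 < z.im → 0 < w.im →
      m z - (starRingEnd ℂ) (m w) = (z - (starRingEnd ℂ) w) * inner ℂ (e w) (e z))
    (h2 : ∀ z w : ℂ, 0 < z.im → 0 < w.im →
      m z - m w = (z - w) * inner ℂ (c w) (e z))
    (h3 : ∀ z : ℂ, 0 < z.im → ‖c z‖ = ‖e z‖) :
    DifferentiableOn ℂ m {z : ℂ | 0 < z.im} := by
  intro z hz
  have hz : 0 < z.im := hz
  have hev : ∀ᶠ w in 𝓝 z, 0 < w.im := by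
    have : IsOpen {z : ℂ | 0 < z.im} := isOpen_lt continuous_const Complex.continuous_im
    exact this.mem_nhds hz
  have hn : ∀ w : ℂ, 0 < w.im → (m w).im = w.im * ‖e w‖ ^ 2 := by
    intro w hw
    have := h1 w w hw hw
    rw [inner_self_eq_norm_sq_to_K] at this
    have h := congrArg Complex.im this
    have e1 : ((‖e w‖ : ℂ) ^ 2) = ((‖e w‖ ^ 2 : ℝ) : ℂ) := by push_cast; rfl
    simp only [Complex.coe_algebraMap, e1, Complex.sub_im, Complex.conj_im, Complex.mul_im,
      Complex.ofReal_im, Complex.ofReal_re] at h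
    linarith
  -- local bound
  have hbd : ∃ K : ℝ, ∀ᶠ w in 𝓝 z, ‖e w‖ ≤ K := by
    set A := ‖m z‖
    set B := ‖e z‖
    set q := z.im / 2 with hq
    have hqp : 0 < q := by positivity
    refine ⟨1 + (2 * A / q + B ^ 2 / q ^ 2), ?_⟩
    have hev2 : ∀ᶠ w in 𝓝 z, q < w.im := by
      have : IsOpen {w : ℂ | q < w.im} := isOpen_lt continuous_const Complex.continuous_im
      exact this.mem_nhds (by simp only [mem_ofPred_eq]; linarith)
    have hev3 : ∀ᶠ w in 𝓝 z, ‖w - z‖ < 1 := by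
      filter_upwards [Metric.ball_mem_nhds z one_pos] with w hw
      simpa [dist_eq_norm] using hw
    filter_upwards [hev, hev2, hev3] with w hw hw2 hw3
    have i1 : ‖m w - m z‖ ≤ B * ‖e w‖ := by
      rw [h2 w z hw hz, norm_mul]
      have := norm_inner_le_norm (𝕜 := ℂ) (c z) (e w)
      rw [h3 z hz] at this
      calc _ ≤ 1 * (‖e z‖ * ‖e w‖) := by gcongr
        _ = _ := one_mul _
    have i2 : (m w).im ≤ A + B * ‖e w‖ := by
      calc (m w).im ≤ ‖m w‖ := Complex.im_le_norm _
        _ = ‖m z + (m w - m z)‖ := by congr 1; ring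
        _ ≤ _ := (norm_add_le _ _).trans (by gcongr)
    rw [hn w hw] at i2
    have i3 : q * ‖e w‖ ^ 2 ≤ A + B * ‖e w‖ :=
      le_trans (by gcongr) i2
    set y := ‖e w‖
    have i4 : q ^ 2 * y ^ 2 ≤ 2 * A * q + B ^ 2 := by
      nlinarith [sq_nonneg (q * y - B)]
    have i5 : y ^ 2 ≤ 2 * A / q + B ^ 2 / q ^ 2 := by
      have : 2 * A / q + B ^ 2 / q ^ 2 = (2 * A * q + B ^ 2) / q ^ 2 := by field_simp
      rw [this, le_div_iff₀ (by positivity)]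
      linarith
    nlinarith [sq_nonneg (y - 1), sq_nonneg y]
  have hcont : Tendsto m (𝓝 z) (𝓝 (m z)) := by
    obtain ⟨K, hK⟩ := hbd
    rw [tendsto_iff_norm_sub_tendsto_zero]
    have hlim : Tendsto (fun w => ‖w - z‖ * (‖e z‖ * K)) (𝓝 z) (𝓝 0) := by
      have : Continuous (fun w : ℂ => ‖w - z‖ * (‖e z‖ * K)) := by fun_prop
      simpa using this.tendsto z
    refine squeeze_zero' (Eventually.of_forall fun _ => norm_nonneg _) ?_ hlim
    filter_upwards [hev, hK] with w hw hwK
    rw [h2 w z hw hz, norm_mul]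
    have := norm_inner_le_norm (𝕜 := ℂ) (c z) (e w)
    rw [h3 z hz] at this
    gcongr
    exact this.trans (by gcongr)
  have hnorm : Tendsto (fun w => ‖e w‖ ^ 2) (𝓝 z) (𝓝 (‖e z‖ ^ 2)) := by
    have : Tendsto (fun w => (m w).im / w.im) (𝓝 z) (𝓝 ((m z).im / z.im)) :=
      ((Complex.continuous_im.tendsto _).comp hcont).div (Complex.continuous_im.tendsto _) hz.ne'
    rw [hn z hz, mul_div_cancel_left₀ _ hz.ne'] at this
    refine this.congr' ?_
    filter_upwards [hev] with w hw
    rw [hn w hw, mul_div_cancel_left₀ _ hw.ne']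
  have hne : ∀ w : ℂ, 0 < w.im → z - (starRingEnd ℂ) w ≠ 0 := by
    intro w hw h
    have := congrArg Complex.im h
    simp at this
    linarith
  have hin : Tendsto (fun w => inner ℂ (e w) (e z)) (𝓝 z) (𝓝 (inner ℂ (e z) (e z))) := by
    have : Tendsto (fun w => (m z - (starRingEnd ℂ) (m w)) / (z - (starRingEnd ℂ) w)) (𝓝 z)
        (𝓝 ((m z - (starRingEnd ℂ) (m z)) / (z - (starRingEnd ℂ) z))) := by
      refine Tendsto.div ?_ ?_ (hne z hz)
      · exact tendsto_const_nhds.sub ((Complex.continuous_conj.tendsto _).comp hcont)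
      · exact tendsto_const_nhds.sub (Complex.continuous_conj.tendsto _)
    rw [h1 z z hz hz, mul_div_cancel_left₀ _ (hne z hz)] at this
    refine this.congr' ?_
    filter_upwards [hev] with w hw
    rw [h1 z w hz hw, mul_div_cancel_left₀ _ (hne w hw)]
  have hsub : Tendsto (fun w => ‖e w - e z‖ ^ 2) (𝓝 z) (𝓝 0) := by
    have h : Tendsto (fun w => ‖e w‖ ^ 2 - 2 * (inner ℂ (e w) (e z)).re + ‖e z‖ ^ 2) (𝓝 z)
        (𝓝 (‖e z‖ ^ 2 - 2 * (inner ℂ (e z) (e z)).re + ‖e z‖ ^ 2)) :=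
      (hnorm.sub (((Complex.continuous_re.tendsto _).comp hin).const_mul 2)).add_const _
    have e1 : (inner ℂ (e z) (e z)).re = ‖e z‖ ^ 2 := by
      have := inner_self_eq_norm_sq (𝕜 := ℂ) (e z)
      simpa using this
    rw [e1] at h
    have e2 : ‖e z‖ ^ 2 - 2 * ‖e z‖ ^ 2 + ‖e z‖ ^ 2 = 0 := by ring
    rw [e2] at h
    refine h.congr fun w => ?_
    have := norm_sub_sq (𝕜 := ℂ) (e w) (e z)
    simpa using this.symm
  have hec : Tendsto e (𝓝 z) (𝓝 (e z)) := by
    rw [tendsto_iff_norm_sub_tendsto_zero]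
    have := (Real.continuous_sqrt.tendsto _).comp hsub
    simp only [Real.sqrt_zero] at this
    refine this.congr fun w => ?_
    simp [Real.sqrt_sq (norm_nonneg _)]
  have hder : HasDerivAt m (inner ℂ (c z) (e z)) z := by
    rw [hasDerivAt_iff_tendsto_slope]
    have : Tendsto (fun w => inner ℂ (c z) (e w)) (𝓝[≠] z) (𝓝 (inner ℂ (c z) (e z))) :=
      (tendsto_const_nhds.inner hec).mono_left nhdsWithin_le_nhds
    refine this.congr' ?_
    filter_upwards [nhdsWithin_le_nhds hev, self_mem_nhdsWithin] with w hw hwz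
    have : w - z ≠ 0 := sub_ne_zero.2 hwz
    rw [slope_def_field, h2 w z hw hz, mul_div_cancel_left₀ _ this]
  exact hder.differentiableAt.differentiableWithinAt

/-- Left-continuous normalised solutions, together with the left-continuous derivative. -/
structure Sol (ts σ : ℕ → ℝ) (a : ℝ) (z : ℂ) (f f' : ℝ → ℂ) : Prop where
  ca : ContinuousWithinAt f (Ici a) a
  ca' : ContinuousWithinAt f' (Ici a) a
  hd : ∀ x, a < x → x ∉ range ts → HasDerivAt f (f' x) x
  hd' : ∀ x, a < x → x ∉ range ts → HasDerivAt f' (-z * f x) x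
  tl : ∀ n, a < ts n → Tendsto f (𝓝[<] (ts n)) (𝓝 (f (ts n)))
  tl' : ∀ n, a < ts n → Tendsto f' (𝓝[<] (ts n)) (𝓝 (f' (ts n)))
  tr : ∀ n, a < ts n → Tendsto f (𝓝[>] (ts n)) (𝓝 ((σ n : ℂ) * f (ts n)))
  tr' : ∀ n, a < ts n → Tendsto f' (𝓝[>] (ts n)) (𝓝 (f' (ts n) / (σ n : ℂ)))

namespace Sol

variable {ts σ : ℕ → ℝ} {a : ℝ} {z w : ℂ} {f f' g g' : ℝ → ℂ}

theorem conj (h : Sol ts σ a z f f') :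
    Sol ts σ a ((starRingEnd ℂ) z) (fun x => (starRingEnd ℂ) (f x))
      (fun x => (starRingEnd ℂ) (f' x)) where
  ca := Complex.continuous_conj.continuousAt.comp_continuousWithinAt h.ca
  ca' := Complex.continuous_conj.continuousAt.comp_continuousWithinAt h.ca'
  hd x hx hxt := (h.hd x hx hxt).star
  hd' x hx hxt := by
    have := (h.hd' x hx hxt).star
    simpa using this
  tl n hn := (Complex.continuous_conj.tendsto _).comp (h.tl n hn)
  tl' n hn := (Complex.continuous_conj.tendsto _).comp (h.tl' n hn)
  tr n hn := by
    have := (Complex.continuous_conj.tendsto _).comp (h.tr n hn)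
    simpa [Function.comp_def] using this
  tr' n hn := by
    have := (Complex.continuous_conj.tendsto _).comp (h.tr' n hn)
    simpa [Function.comp_def] using this

theorem smul (h : Sol ts σ a z f f') (c : ℂ) :
    Sol ts σ a z (fun x => c * f x) (fun x => c * f' x) where
  ca := h.ca.const_mul c
  ca' := h.ca'.const_mul c
  hd x hx hxt := (h.hd x hx hxt).const_mul c
  hd' x hx hxt := by
    have := (h.hd' x hx hxt).const_mul c
    refine HasDerivAt.congr_deriv this ?_
    ring
  tl n hn := (h.tl n hn).const_mul c
  tl' n hn := (h.tl' n hn).const_mul c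
  tr n hn := by
    have := (h.tr n hn).const_mul c
    convert this using 2
    ring
  tr' n hn := by
    have := (h.tr' n hn).const_mul c
    convert this using 2
    ring

theorem prod_cont (hσ : ∀ n, σ n ≠ 0) (hf : Sol ts σ a z f f') (hg : Sol ts σ a w g g') :
    ContinuousOn (fun x => f' x * g x) (Ici a) := by
  intro x hx
  rcases eq_or_lt_of_le (show a ≤ x from hx) with rfl | hlt
  · exact hf.ca'.mul hg.ca
  · by_cases hxt : x ∈ range ts
    · obtain ⟨n, rfl⟩ := hxt
      apply ContinuousAt.continuousWithinAt
      rw [continuousAt_iff_continuous_left'_right']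
      refine ⟨(hf.tl' n hlt).mul (hg.tl n hlt), ?_⟩
      have := (hf.tr' n hlt).mul (hg.tr n hlt)
      have hs : (σ n : ℂ) ≠ 0 := by exact_mod_cast hσ n
      have e : f' (ts n) / (σ n : ℂ) * ((σ n : ℂ) * g (ts n)) = f' (ts n) * g (ts n) := by
        field_simp
      rw [e] at this
      exact this
    · exact ((hf.hd' x hlt hxt).mul (hg.hd x hlt hxt)).continuousAt.continuousWithinAt

theorem prod_deriv (hf : Sol ts σ a z f f') (hg : Sol ts σ a w g g') (x : ℝ) (hx : a < x)
    (hxt : x ∉ range ts) :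
    HasDerivAt (fun x => f' x * g x) (-z * (f x * g x) + f' x * g' x) x := by
  have := (hf.hd' x hx hxt).mul (hg.hd x hx hxt)
  refine HasDerivAt.congr_deriv this ?_
  ring

theorem meas_aux (ts : ℕ → ℝ) (a : ℝ) {h : ℝ → ℂ}
    (hc : ∀ x, a < x → x ∉ range ts → ContinuousAt h x) :
    AEStronglyMeasurable h (volume.restrict (Ioi a)) := by
  have h1 : AEStronglyMeasurable h (volume.restrict (Ioi a \ range ts)) := by
    apply ContinuousOn.aestronglyMeasurable
    · exact fun x hx => (hc x hx.1 hx.2).continuousWithinAt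
    · exact measurableSet_Ioi.diff (countable_range ts).measurableSet
  have h2 : (Ioi a \ range ts : Set ℝ) =ᵐ[volume] Ioi a :=
    sdiff_null_ae_eq_self ((countable_range ts).measure_zero _)
  rwa [Measure.restrict_congr_set h2] at h1

theorem meas (hf : Sol ts σ a z f f') : AEStronglyMeasurable f (volume.restrict (Ioi a)) :=
  meas_aux ts a fun x hx hxt => (hf.hd x hx hxt).continuousAt

theorem meas' (hf : Sol ts σ a z f f') : AEStronglyMeasurable f' (volume.restrict (Ioi a)) :=
  meas_aux ts a fun x hx hxt => (hf.hd' x hx hxt).continuousAt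

theorem bdd' (hf : Sol ts σ a z f f') (x : ℝ) (hx : a ≤ x) :
    ∃ K : ℝ, ∀ᶠ y in 𝓝[Ici a] x, ‖f' y‖ ≤ K := by
  have key : ∀ {l : Filter ℝ} {c : ℂ}, Tendsto f' l (𝓝 c) → ∀ᶠ y in l, ‖f' y‖ ≤ ‖c‖ + 1 := by
    intro l c h
    exact h.norm.eventually_le_const (by linarith)
  rcases eq_or_lt_of_le hx with rfl | hlt
  · exact ⟨_, key hf.ca'⟩
  · by_cases hxt : x ∈ range ts
    · obtain ⟨n, rfl⟩ := hxt
      have h1 := key (hf.tl' n hlt)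
      have h2 := key (hf.tr' n hlt)
      set A := ‖f' (ts n)‖ + 1
      set B := ‖f' (ts n) / (σ n : ℂ)‖ + 1
      refine ⟨max A B, ?_⟩
      apply eventually_nhdsWithin_of_eventually_nhds
      rw [← nhdsLT_sup_nhdsGE, ← Ioi_insert, nhdsWithin_insert]
      simp only [eventually_sup, eventually_pure]
      refine ⟨h1.mono fun y hy => hy.trans (le_max_left _ _), ?_,
        h2.mono fun y hy => hy.trans (le_max_right _ _)⟩
      exact le_trans (by simp [A]) (le_max_left A B)
    · exact ⟨_, key ((hf.hd' x hlt hxt).continuousAt.continuousWithinAt)⟩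

theorem locInt (hf : Sol ts σ a z f f') (b : ℝ) :
    IntegrableOn (fun x => ‖f' x‖ ^ 2) (Icc a b) volume := by
  have hloc : LocallyIntegrableOn (fun x => ‖f' x‖ ^ 2) (Icc a b) volume := by
    intro x hx
    obtain ⟨K, hK⟩ := hf.bdd' x hx.1
    obtain ⟨s, hs, hsK⟩ := hK.exists_mem
    have hs' : s ∩ Icc a b ∈ 𝓝[Icc a b] x :=
      inter_mem (nhdsWithin_mono x (fun y hy => hy.1) hs) self_mem_nhdsWithin
    obtain ⟨o, ho, hxo, hos⟩ := mem_nhdsWithin.1 hs'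
    refine ⟨o ∩ Icc a b, mem_nhdsWithin.2 ⟨o, ho, hxo, subset_rfl⟩, ?_⟩
    have hm : MeasurableSet (o ∩ Icc a b) := ho.measurableSet.inter measurableSet_Icc
    have hmeas : AEStronglyMeasurable (fun x => ‖f' x‖ ^ 2)
        (volume.restrict (o ∩ Icc a b)) := by
      have h1 : AEStronglyMeasurable f' (volume.restrict (Ici a)) := by
        rw [← restrict_Ioi_eq_restrict_Ici]; exact hf.meas'
      exact (h1.mono_measure (Measure.restrict_mono (fun y hy => hy.2.1) le_rfl)).norm.pow 2
    have hfin : volume (o ∩ Icc a b) ≠ ⊤ :=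
      ne_top_of_le_ne_top (by simp) (measure_mono (inter_subset_right (s := o) (t := Icc a b)))
    have : IsFiniteMeasure (volume.restrict (o ∩ Icc a b)) := ⟨by simpa using hfin.lt_top⟩
    refine Integrable.of_bound (μ := volume.restrict (o ∩ Icc a b)) hmeas (K ^ 2) ?_
    · filter_upwards [ae_restrict_mem hm] with y hy
      have := hsK y (hos hy).1
      rw [norm_pow, norm_norm]
      gcongr
  exact hloc.integrableOn_isCompact isCompact_Icc

theorem deriv_L2 (hσ : ∀ n, σ n ≠ 0) (hz : 0 < z.im) (hf : Sol ts σ a z f f')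
    (h2 : MemLp f 2 (volume.restrict (Ioi a))) :
    MemLp f' 2 (volume.restrict (Ioi a)) := by
  rw [memLp_two_iff_integrable_sq_norm hf.meas']
  have hN : IntegrableOn (fun x => ‖f x‖ ^ 2) (Ioi a) volume :=
    (memLp_two_iff_integrable_sq_norm hf.meas).1 h2
  set B := ∫ x in Ioi a, ‖f x‖ ^ 2 with hB
  have hNi : ∀ x y, a ≤ x → x ≤ y → IntervalIntegrable (fun x => ‖f x‖ ^ 2) volume x y := by
    intro x y hx hxy
    rw [intervalIntegrable_iff_integrableOn_Ioc_of_le hxy]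
    exact hN.mono_set fun t ht => lt_of_le_of_lt hx ht.1
  have hNB : ∀ x y, a ≤ x → x ≤ y → ∫ t in x..y, ‖f t‖ ^ 2 ≤ B := by
    intro x y hx hxy
    rw [intervalIntegral.integral_of_le hxy]
    refine setIntegral_mono_set hN (Eventually.of_forall fun _ => by positivity) ?_
    exact Eventually.of_forall fun t ht => lt_of_le_of_lt hx ht.1
  have hNnn : ∀ x y, x ≤ y → 0 ≤ ∫ t in x..y, ‖f t‖ ^ 2 := fun x y hxy =>
    intervalIntegral.integral_nonneg hxy fun _ _ => by positivity
  have hDi : ∀ x y, a ≤ x → x ≤ y → IntervalIntegrable (fun x => ‖f' x‖ ^ 2) volume x y := by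
    intro x y hx hxy
    rw [intervalIntegrable_iff_integrableOn_Ioc_of_le hxy]
    exact (hf.locInt y).mono_set fun t ht => ⟨hx.trans ht.1.le, ht.2⟩
  set G : ℝ → ℂ := fun x => f' x * (starRingEnd ℂ) (f x) with hG
  have hGc : ContinuousOn G (Ici a) := prod_cont hσ hf hf.conj
  have hGd : ∀ x, a < x → x ∉ range ts →
      HasDerivAt G (-z * ((‖f x‖ ^ 2 : ℝ) : ℂ) + ((‖f' x‖ ^ 2 : ℝ) : ℂ)) x := by
    intro x hx hxt
    have := prod_deriv hf hf.conj x hx hxt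
    rw [Complex.mul_conj', Complex.mul_conj'] at this
    exact_mod_cast this
  set k := z.re / z.im with hk
  have hkz : k * z.im = z.re := by rw [hk]; field_simp
  set F : ℝ → ℝ := fun x => (G x).im with hF
  set H : ℝ → ℝ := fun x => (G x).re - k * (G x).im with hH
  have hFc : ContinuousOn F (Ici a) := Complex.continuous_im.comp_continuousOn hGc
  have hHc : ContinuousOn H (Ici a) :=
    (Complex.continuous_re.comp_continuousOn hGc).sub (hFc.const_mul k)
  have hFd : ∀ x, a < x → x ∉ range ts → HasDerivAt F (-z.im * ‖f x‖ ^ 2) x := by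
    intro x hx hxt
    have := (Complex.imCLM.hasFDerivAt.comp_hasDerivAt x (hGd x hx hxt))
    refine HasDerivAt.congr_deriv this ?_
    simp only [Complex.imCLM_apply, Complex.add_im, Complex.mul_im, Complex.neg_im,
      Complex.neg_re, Complex.ofReal_im, Complex.ofReal_re]
    ring
  have hRd : ∀ x, a < x → x ∉ range ts →
      HasDerivAt (fun x => (G x).re) (-z.re * ‖f x‖ ^ 2 + ‖f' x‖ ^ 2) x := by
    intro x hx hxt
    have := (Complex.reCLM.hasFDerivAt.comp_hasDerivAt x (hGd x hx hxt))
    refine HasDerivAt.congr_deriv this ?_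
    simp only [Complex.reCLM_apply, Complex.add_re, Complex.mul_re, Complex.neg_im,
      Complex.neg_re, Complex.ofReal_im, Complex.ofReal_re]
    ring
  have hHd : ∀ x, a < x → x ∉ range ts → HasDerivAt H (‖f' x‖ ^ 2) x := by
    intro x hx hxt
    have := (hRd x hx hxt).sub ((hFd x hx hxt).const_mul k)
    refine HasDerivAt.congr_deriv this ?_
    linear_combination (‖f x‖ ^ 2) * hkz
  have hFtc : ∀ y, a ≤ y → F y - F a = -z.im * ∫ t in a..y, ‖f t‖ ^ 2 := by
    intro y hy
    rw [← intervalIntegral.integral_const_mul]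
    symm
    refine integral_eq_of_hasDerivAt_off_countable_of_le F _ hy (countable_range ts)
      (hFc.mono Icc_subset_Ici_self) (fun x hx => hFd x hx.1.1 hx.2) ?_
    exact (hNi a y le_rfl hy).const_mul _
  have hHtc : ∀ x y, a ≤ x → x ≤ y → H y - H x = ∫ t in x..y, ‖f' t‖ ^ 2 := by
    intro x y hx hxy
    symm
    refine integral_eq_of_hasDerivAt_off_countable_of_le H _ hxy (countable_range ts)
      (hHc.mono fun t ht => hx.trans ht.1) (fun t ht => hHd t (hx.trans_lt ht.1.1) ht.2) ?_
    exact hDi x y hx hxy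
  have hHmono : ∀ x y, a ≤ x → x ≤ y → H x ≤ H y := by
    intro x y hx hxy
    have := hHtc x y hx hxy
    have h0 : 0 ≤ ∫ t in x..y, ‖f' t‖ ^ 2 :=
      intervalIntegral.integral_nonneg hxy fun _ _ => by positivity
    linarith
  have hFbd : ∀ y, a ≤ y → |F y| ≤ |F a| + z.im * B := by
    intro y hy
    have h1 := hFtc y hy
    have h3 := hNB a y le_rfl hy
    have h4 := hNnn a y hy
    have e : F y = F a + (-z.im * ∫ t in a..y, ‖f t‖ ^ 2) := by linarith
    rw [e]
    refine (abs_add_le _ _).trans ?_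
    gcongr
    rw [abs_mul, abs_neg, abs_of_pos hz, abs_of_nonneg h4]
    gcongr
  set Q := |k| * (|F a| + z.im * B) with hQ
  by_cases hbdd : ∃ M, ∀ y, a ≤ y → H y ≤ M
  · obtain ⟨M, hM⟩ := hbdd
    refine integrableOn_Ioi_of_intervalIntegral_norm_bounded (l := atTop) (b := fun y : ℝ => y)
      (M - H a) a (fun y => (hf.locInt y).mono_set Ioc_subset_Icc_self) tendsto_id ?_
    filter_upwards [eventually_ge_atTop a] with y hy
    have h1 := hHtc a y le_rfl hy
    have h3 := hM y hy
    have : ∀ x, ‖‖f' x‖ ^ 2‖ = ‖f' x‖ ^ 2 := fun x => by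
      rw [norm_pow, norm_norm]
    simp only [this]
    linarith
  · exfalso
    push Not at hbdd
    obtain ⟨x0, hx0, hM⟩ := hbdd (1 + 2 * Q)
    have hQ0 : 0 ≤ Q := by
      have : 0 ≤ B := (hNnn a a le_rfl).trans (hNB a a le_rfl le_rfl)
      positivity
    have hR : ∀ y, x0 ≤ y → 0 < H y ∧ H y / 2 ≤ ‖f' y‖ * ‖f y‖ := by
      intro y hy
      have hay : a ≤ y := hx0.trans hy
      have h1 := hHmono x0 y hx0 hy
      have h3 : |k * F y| ≤ Q := by
        rw [abs_mul]
        exact mul_le_mul_of_nonneg_left (hFbd y hay) (abs_nonneg k)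
      have h4 : (G y).re ≤ ‖f' y‖ * ‖f y‖ := by
        have := Complex.re_le_norm (G y)
        simpa [hG] using this
      have h5 : H y = (G y).re - k * F y := rfl
      have h6 := neg_abs_le (k * F y)
      constructor <;> linarith
    have hpos0 := (hR x0 le_rfl).1
    set y := x0 + (B + (H x0)⁻¹ + 1) with hy
    have hB0 : 0 ≤ B := (hNnn a a le_rfl).trans (hNB a a le_rfl le_rfl)
    have hxy : x0 ≤ y := by
      have : 0 < (H x0)⁻¹ := by positivity
      linarith
    have hHc' : ContinuousOn H (Icc x0 y) := hHc.mono fun t ht => hx0.trans ht.1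
    have hcI : ContinuousOn (fun t => (H t ^ 2)⁻¹) (Icc x0 y) :=
      (hHc'.pow 2).inv₀ fun t ht => (pow_pos (hR t ht.1).1 2).ne'
    have hII : IntervalIntegrable (fun t => ‖f' t‖ ^ 2 * (H t ^ 2)⁻¹) volume x0 y :=
      (hDi x0 y hx0 hxy).mul_continuousOn (by rwa [uIcc_of_le hxy])
    have hftc : ∫ t in x0..y, ‖f' t‖ ^ 2 * (H t ^ 2)⁻¹ = -(H y)⁻¹ - -(H x0)⁻¹ := by
      refine integral_eq_of_hasDerivAt_off_countable_of_le (fun t => -(H t)⁻¹) _ hxy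
        (countable_range ts) ?_ ?_ hII
      · exact (hHc'.inv₀ fun t ht => (hR t ht.1).1.ne').neg
      · intro t ht
        have := ((hHd t (hx0.trans_lt ht.1.1) ht.2).inv (hR t ht.1.1.le).1.ne').neg
        refine HasDerivAt.congr_deriv this ?_
        rw [div_eq_mul_inv]; ring
    have hlow : ∫ t in x0..y, (1 - ‖f t‖ ^ 2) ≤ ∫ t in x0..y, ‖f' t‖ ^ 2 * (H t ^ 2)⁻¹ := by
      refine intervalIntegral.integral_mono_on hxy
        ((intervalIntegrable_const).sub (hNi x0 y hx0 hxy)) hII ?_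
      intro t ht
      obtain ⟨hp, hq⟩ := hR t ht.1
      have e : ‖f' t‖ ^ 2 * (H t ^ 2)⁻¹ = (‖f' t‖ / H t) ^ 2 := by
        rw [div_pow, div_eq_mul_inv]
      rw [e]
      have : 1 / 2 ≤ ‖f' t‖ / H t * ‖f t‖ := by
        rw [div_mul_eq_mul_div, le_div_iff₀ hp]; linarith
      nlinarith [sq_nonneg (‖f' t‖ / H t - ‖f t‖)]
    rw [intervalIntegral.integral_sub intervalIntegrable_const (hNi x0 y hx0 hxy)] at hlow
    simp only [intervalIntegral.integral_const, smul_eq_mul, mul_one] at hlow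
    have h1 := hNB x0 y hx0 hxy
    have h3 : 0 < (H y)⁻¹ := inv_pos.2 (hR y hxy).1
    linarith

/-- The Wronskian identity. -/
theorem green (hσ : ∀ n, σ n ≠ 0) (hf : Sol ts σ a z f f') (hg : Sol ts σ a w g g')
    (f2 : MemLp f 2 (volume.restrict (Ioi a))) (f2' : MemLp f' 2 (volume.restrict (Ioi a)))
    (g2 : MemLp g 2 (volume.restrict (Ioi a))) (g2' : MemLp g' 2 (volume.restrict (Ioi a))) :
    f' a * g a - g' a * f a = (z - w) * ∫ x in Ioi a, f x * g x := by
  set W : ℝ → ℂ := fun x => f' x * g x - g' x * f x with hW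
  have hWc : ContinuousOn W (Ici a) := (prod_cont hσ hf hg).sub (prod_cont hσ hg hf)
  have hWd : ∀ x, a < x → x ∉ range ts → HasDerivAt W ((w - z) * (f x * g x)) x := by
    intro x hx hxt
    have := (prod_deriv hf hg x hx hxt).sub (prod_deriv hg hf x hx hxt)
    refine HasDerivAt.congr_deriv this ?_
    ring
  have hi : IntegrableOn (fun x => f x * g x) (Ioi a) volume := f2.integrable_mul g2
  have hWi : IntegrableOn W (Ioi a) volume :=
    (f2'.integrable_mul g2).sub (g2'.integrable_mul f2)
  have hftc : ∀ y, a ≤ y → W y = W a + (w - z) * ∫ t in a..y, f t * g t := by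
    intro y hy
    have : ∫ t in a..y, (w - z) * (f t * g t) = W y - W a := by
      refine integral_eq_of_hasDerivAt_off_countable_of_le W _ hy (countable_range ts)
        (hWc.mono Icc_subset_Ici_self) (fun x hx => hWd x hx.1.1 hx.2) ?_
      rw [intervalIntegrable_iff_integrableOn_Ioc_of_le hy]
      exact (hi.mono_set Ioc_subset_Ioi_self).const_mul _
    rw [intervalIntegral.integral_const_mul] at this
    rw [this]; ring
  have hlim : Tendsto W atTop (𝓝 (W a + (w - z) * ∫ x in Ioi a, f x * g x)) := by
    have := ((intervalIntegral_tendsto_integral_Ioi a hi tendsto_id).const_mul (w - z)).const_add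
      (W a)
    refine this.congr' ?_
    filter_upwards [eventually_ge_atTop a] with y hy
    exact (hftc y hy).symm
  have h0 := IntegrableAtFilter.eq_zero_of_tendsto (μ := volume)
    (⟨Ioi a, Ioi_mem_atTop a, hWi⟩ : IntegrableAtFilter W atTop volume) (by
      intro s hs
      obtain ⟨b, hb⟩ := mem_atTop_sets.1 hs
      have : Ici b ⊆ s := hb
      have h := measure_mono (μ := volume) this
      rw [Real.volume_Ici] at h
      exact top_le_iff.1 h) hlim
  have : W a = f' a * g a - g' a * f a := rfl
  rw [← this]
  linear_combination h0

end Sol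

theorem sol_of_interface {γ : ℝ} (hγ : 0 < γ) {ts bs : ℕ → ℝ}
    (hsep : ∀ n m, n ≠ m → γ ≤ |ts n - ts m|) {a : ℝ} (ha : a ∉ range ts) {z : ℂ}
    {u : ℝ → ℂ} (hu : IsInterfaceSolution ts bs z (Ici a) u) :
    ∃ f f' : ℝ → ℂ, Sol ts (fun n => Real.sqrt (bs n)) a z f f' ∧
      (∀ x, x ∉ range ts → f x = u x) ∧ f' a = derivWithin u (offAtoms ts (Ici a)) a := by
  obtain ⟨hC, hE, hI⟩ := hu
  set S := offAtoms ts (Ici a) with hS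
  set du := derivWithin u S with hdu
  have hpw : (range ts).Pairwise fun x y => γ ≤ dist x y := by
    rintro _ ⟨n, rfl⟩ _ ⟨m, rfl⟩ hne
    exact hsep n m fun h => hne (by rw [h])
  have hcl : IsClosed (range ts) := Metric.isClosed_of_pairwise_le_dist hγ hpw
  have hpunct : ∀ t, ∀ᶠ x in 𝓝[≠] t, x ∉ range ts := by
    intro t
    have hc : IsClosed (range ts \ {t}) :=
      Metric.isClosed_of_pairwise_le_dist hγ (hpw.mono sdiff_subset)
    have : (range ts \ {t})ᶜ ∈ 𝓝 t := hc.isOpen_compl.mem_nhds (by simp)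
    filter_upwards [nhdsWithin_le_nhds this, self_mem_nhdsWithin] with x hx hxt hxr
    exact hx ⟨hxr, hxt⟩
  have hSeq : S = Ici a ∩ (range ts)ᶜ := rfl
  have hUD : UniqueDiffOn ℝ S := (uniqueDiffOn_Ici a).inter hcl.isOpen_compl
  have hSn : ∀ x, a < x → x ∉ range ts → S ∈ 𝓝 x := fun x hx hxt =>
    inter_mem (Ici_mem_nhds hx) (hcl.isOpen_compl.mem_nhds hxt)
  have hud : DifferentiableOn ℝ u S := hC.differentiableOn (by norm_num)
  have hdud : DifferentiableOn ℝ du S :=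
    (hC.derivWithin hUD (m := 1) (by norm_num)).differentiableOn (by norm_num)
  have haS : a ∈ S := ⟨self_mem_Ici, ha⟩
  have hnS : 𝓝[S] a = 𝓝[Ici a] a := by
    rw [hSeq]
    exact nhdsWithin_inter_of_mem' (nhdsWithin_le_nhds (hcl.isOpen_compl.mem_nhds ha))
  have hnl : ∀ t, a < t → 𝓝[S ∩ Iio t] t = 𝓝[<] t := by
    intro t ht
    rw [inter_comm]
    refine nhdsWithin_inter_of_mem' ?_
    have h1 : ∀ᶠ x in 𝓝[<] t, x ∉ range ts :=
      (hpunct t).filter_mono (nhdsWithin_mono _ fun x hx => ne_of_lt hx)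
    filter_upwards [h1, nhdsWithin_le_nhds (Ici_mem_nhds ht)] with x hx hxa
    exact ⟨hxa, hx⟩
  have hnr : ∀ t, a < t → 𝓝[S ∩ Ioi t] t = 𝓝[>] t := by
    intro t ht
    rw [inter_comm]
    refine nhdsWithin_inter_of_mem' ?_
    have h1 : ∀ᶠ x in 𝓝[>] t, x ∉ range ts :=
      (hpunct t).filter_mono (nhdsWithin_mono _ fun x hx => ne_of_gt hx)
    filter_upwards [h1, nhdsWithin_le_nhds (Ici_mem_nhds ht)] with x hx hxa
    exact ⟨hxa, hx⟩
  classical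
  let mk : (ℝ → ℂ) → ℝ → ℂ := fun g x => if x ∈ range ts then limUnder (𝓝[<] x) g else g x
  have mk_off : ∀ g x, x ∉ range ts → mk g x = g x := fun g x hx => if_neg hx
  have mk_ne : ∀ g t, g =ᶠ[𝓝[≠] t] mk g := fun g t =>
    (hpunct t).mono fun x hx => (mk_off g x hx).symm
  have mk_l : ∀ g t, g =ᶠ[𝓝[<] t] mk g := fun g t =>
    (mk_ne g t).filter_mono (nhdsWithin_mono _ fun x hx => ne_of_lt hx)
  have mk_r : ∀ g t, g =ᶠ[𝓝[>] t] mk g := fun g t =>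
    (mk_ne g t).filter_mono (nhdsWithin_mono _ fun x hx => ne_of_gt hx)
  have mk_off_ev : ∀ g x, x ∉ range ts → mk g =ᶠ[𝓝 x] g := fun g x hx => by
    filter_upwards [hcl.isOpen_compl.mem_nhds hx] with y hy
    exact mk_off g y hy
  have mk_val : ∀ g n c, Tendsto g (𝓝[<] (ts n)) (𝓝 c) → mk g (ts n) = c := by
    intro g n c h
    have : mk g (ts n) = limUnder (𝓝[<] (ts n)) g := by simp [mk]
    rw [this]
    exact h.limUnder_eq
  have hI' : ∀ n, a < ts n → ∃ uL duL : ℂ,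
      Tendsto u (𝓝[<] (ts n)) (𝓝 uL) ∧
      Tendsto u (𝓝[>] (ts n)) (𝓝 ((Real.sqrt (bs n) : ℂ) * uL)) ∧
      Tendsto du (𝓝[<] (ts n)) (𝓝 duL) ∧
      Tendsto du (𝓝[>] (ts n)) (𝓝 (duL / (Real.sqrt (bs n) : ℂ))) := by
    intro n hn
    obtain ⟨uL, uR, duL, duR, h1, h2, h3, h4, rfl, rfl⟩ := hI n (by simpa using hn)
    rw [hnl _ hn] at h1 h3
    rw [hnr _ hn] at h2 h4
    exact ⟨uL, duL, h1, h2, h3, h4⟩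
  refine ⟨mk u, mk du, ⟨?_, ?_, ?_, ?_, ?_, ?_, ?_, ?_⟩, mk_off u, mk_off du a ha⟩
  · have h : ContinuousWithinAt u (Ici a) a := by
      have := (hud a haS).continuousWithinAt
      unfold ContinuousWithinAt at this ⊢
      rwa [hnS] at this
    exact h.congr_of_eventuallyEq (nhdsWithin_le_nhds (mk_off_ev u a ha)) (mk_off u a ha)
  · have h : ContinuousWithinAt du (Ici a) a := by
      have := (hdud a haS).continuousWithinAt
      unfold ContinuousWithinAt at this ⊢
      rwa [hnS] at this
    exact h.congr_of_eventuallyEq (nhdsWithin_le_nhds (mk_off_ev du a ha)) (mk_off du a ha)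
  · intro x hx hxt
    have h := ((hud x ⟨hx.le, hxt⟩).hasDerivWithinAt).hasDerivAt (hSn x hx hxt)
    rw [mk_off du x hxt]
    exact h.congr_of_eventuallyEq (mk_off_ev u x hxt)
  · intro x hx hxt
    have h := ((hdud x ⟨hx.le, hxt⟩).hasDerivWithinAt).hasDerivAt (hSn x hx hxt)
    have e := hE x ⟨hx.le, hxt⟩
    rw [mk_off u x hxt, neg_mul, ← e, neg_neg]
    exact h.congr_of_eventuallyEq (mk_off_ev du x hxt)
  · intro n hn
    obtain ⟨uL, duL, h1, h2, h3, h4⟩ := hI' n hn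
    rw [mk_val u n uL h1]
    exact h1.congr' (mk_l u _)
  · intro n hn
    obtain ⟨uL, duL, h1, h2, h3, h4⟩ := hI' n hn
    rw [mk_val du n duL h3]
    exact h3.congr' (mk_l du _)
  · intro n hn
    obtain ⟨uL, duL, h1, h2, h3, h4⟩ := hI' n hn
    rw [mk_val u n uL h1]
    exact h2.congr' (mk_r u _)
  · intro n hn
    obtain ⟨uL, duL, h1, h2, h3, h4⟩ := hI' n hn
    rw [mk_val du n duL h3]
    exact h4.congr' (mk_r du _)

theorem memLp_conj_aux {μ : Measure ℝ} {f : ℝ → ℂ} (h : MemLp f 2 μ) :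
    MemLp (fun x => (starRingEnd ℂ) (f x)) 2 μ := h.star

theorem inner_toLp_aux {μ : Measure ℝ} {f g : ℝ → ℂ} (hf : MemLp f 2 μ) (hg : MemLp g 2 μ) :
    inner ℂ (hf.toLp f) (hg.toLp g) = ∫ x, g x * (starRingEnd ℂ) (f x) ∂μ := by
  rw [L2.inner_def]
  refine integral_congr_ae ?_
  filter_upwards [hf.coeFn_toLp, hg.coeFn_toLp] with x h1 h2
  rw [h1, h2]
  rfl

/-- Normalised square-integrable solution. -/
theorem normalized_sol {γ : ℝ} (hγ : 0 < γ) {ts bs : ℕ → ℝ}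
    (hsep : ∀ n m, n ≠ m → γ ≤ |ts n - ts m|) (hσ : ∀ n, Real.sqrt (bs n) ≠ 0)
    {a : ℝ} (ha : a ∉ range ts) {z : ℂ} (hz : 0 < z.im)
    {u : ℝ → ℂ} (hu : IsL2Solution ts bs z a u) :
    0 < (derivWithin u (offAtoms ts (Ici a)) a / u a).im ∧
    ∃ f f' : ℝ → ℂ, Sol ts (fun n => Real.sqrt (bs n)) a z f f' ∧
      MemLp f 2 (volume.restrict (Ioi a)) ∧ MemLp f' 2 (volume.restrict (Ioi a)) ∧
      f a = 1 ∧ f' a = derivWithin u (offAtoms ts (Ici a)) a / u a := by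
  obtain ⟨hsol, ⟨x0, hx0, hux0⟩, hint⟩ := hu
  obtain ⟨f, f', hf, hfu, hfa'⟩ := sol_of_interface hγ hsep ha hsol
  have hfa : f a = u a := hfu a ha
  have hN : IntegrableOn (fun x => ‖f x‖ ^ 2) (Ioi a) volume := by
    refine Integrable.congr hint ?_
    have : ∀ᵐ x ∂(volume.restrict (Ioi a)), x ∉ range ts :=
      ae_restrict_of_ae ((countable_range ts).ae_notMem _)
    filter_upwards [this] with x hx
    rw [hfu x hx]
  have f2 : MemLp f 2 (volume.restrict (Ioi a)) :=
    (memLp_two_iff_integrable_sq_norm hf.meas).2 hN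
  have f2' := Sol.deriv_L2 hσ hz hf f2
  have hpos : 0 < ∫ x in Ioi a, ‖f x‖ ^ 2 := by
    rw [setIntegral_pos_iff_support_of_nonneg_ae
      (Eventually.of_forall fun _ => by positivity) hN]
    have hax : a ≤ x0 := hx0.1
    have hc : ContinuousWithinAt f (Ioi x0) x0 := by
      rcases eq_or_lt_of_le hax with rfl | hlt
      · exact hf.ca.mono Ioi_subset_Ici_self
      · exact (hf.hd x0 hlt hx0.2).continuousAt.continuousWithinAt
    have hne : ∀ᶠ x in 𝓝[>] x0, f x ≠ 0 :=
      hc.eventually_ne (by rw [hfu x0 hx0.2]; exact hux0)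
    obtain ⟨y, hy, hsub⟩ := mem_nhdsGT_iff_exists_Ioo_subset.1 hne
    have hsub2 : Ioo x0 y ⊆ Function.support (fun x => ‖f x‖ ^ 2) ∩ Ioi a := by
      intro x hx
      have : f x ≠ 0 := hsub hx
      exact ⟨by simpa using this, lt_of_le_of_lt hax hx.1⟩
    refine lt_of_lt_of_le ?_ (measure_mono hsub2)
    rw [Real.volume_Ioo]
    simpa using hy
  have hg := Sol.green hσ hf hf.conj f2 f2' (memLp_conj_aux f2) (memLp_conj_aux f2')
  have hIc : ∫ x in Ioi a, f x * (starRingEnd ℂ) (f x)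
      = ((∫ x in Ioi a, ‖f x‖ ^ 2 : ℝ) : ℂ) := by
    rw [← integral_complex_ofReal]
    refine integral_congr_ae (Eventually.of_forall fun x => ?_)
    simp only [Complex.mul_conj']
    push_cast
    rfl
  rw [hIc] at hg
  have him : (f' a * (starRingEnd ℂ) (f a)).im = z.im * ∫ x in Ioi a, ‖f x‖ ^ 2 := by
    have h := congrArg Complex.im hg
    simp only [Complex.sub_im, Complex.mul_im, Complex.conj_re, Complex.conj_im,
      Complex.ofReal_re, Complex.ofReal_im] at h
    simp only [Complex.mul_im, Complex.conj_re, Complex.conj_im]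
    linarith
  have hmp : 0 < (f' a * (starRingEnd ℂ) (f a)).im := by rw [him]; positivity
  have hfa0 : f a ≠ 0 := by
    intro h
    rw [h] at hmp
    simp at hmp
  rw [← hfa', ← hfa]
  refine ⟨?_, fun x => (f a)⁻¹ * f x, fun x => (f a)⁻¹ * f' x, hf.smul _, f2.const_mul _,
    f2'.const_mul _, inv_mul_cancel₀ hfa0, by rw [div_eq_mul_inv, mul_comm]⟩
  have e : f' a / f a = (f' a * (starRingEnd ℂ) (f a)) * (((‖f a‖ ^ 2)⁻¹ : ℝ) : ℂ) := by
    have h := Complex.mul_conj' (f a)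
    have hc : (starRingEnd ℂ) (f a) ≠ 0 := by simpa using hfa0
    push_cast
    rw [← h]
    field_simp
  rw [e, Complex.im_mul_ofReal]
  have : 0 < ‖f a‖ := norm_pos_iff.2 hfa0
  positivity

/-- the m-function is Herglotz: for any choice, for each `z` in the open
upper half-plane, of a nonzero square-integrable solution `u₊(z, ·)` on `[a, ∞)`, the
function `z ↦ m₊(z, a, μ) = u₊'(z, a)/u₊(z, a)` is holomorphic on the upper half-plane
and has positive imaginary part there. -/
theorem m_function_herglotz
    (C γ : ℝ) (hC : 0 < C) (hγ : 0 < γ)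
    (ts bs : ℕ → ℝ)
    (hsep : ∀ n m, n ≠ m → γ ≤ |ts n - ts m|)
    (hbs : ∀ n, 1 < bs n)
    (hbound : ∀ x : ℝ, treeMeasure ts bs (Set.Icc x (x + 1)) ≤ ENNReal.ofReal C)
    (a : ℝ) (ha : a ∉ Set.range ts)
    (u : ℂ → ℝ → ℂ)
    (hu : ∀ z : ℂ, 0 < z.im → IsL2Solution ts bs z a (u z)) :
    DifferentiableOn ℂ
      (fun z : ℂ => derivWithin (u z) (offAtoms ts (Ici a)) a / u z a)
      {z : ℂ | 0 < z.im} ∧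
    ∀ z : ℂ, 0 < z.im →
      0 < (derivWithin (u z) (offAtoms ts (Ici a)) a / u z a).im := by
  have hσ : ∀ n, Real.sqrt (bs n) ≠ 0 := fun n =>
    (Real.sqrt_pos.2 (lt_trans one_pos (hbs n))).ne'
  have key := fun (z : ℂ) (hz : 0 < z.im) => normalized_sol hγ hsep hσ ha hz (hu z hz)
  refine ⟨?_, fun z hz => (key z hz).1⟩
  set m : ℂ → ℂ := fun z : ℂ => derivWithin (u z) (offAtoms ts (Ici a)) a / u z a with hm
  have key2 : ∀ z : ℂ, ∃ f f' : ℝ → ℂ, MemLp f 2 (volume.restrict (Ioi a)) ∧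
      (0 < z.im → Sol ts (fun n => Real.sqrt (bs n)) a z f f' ∧
        MemLp f' 2 (volume.restrict (Ioi a)) ∧ f a = 1 ∧ f' a = m z) := by
    intro z
    by_cases hz : 0 < z.im
    · obtain ⟨-, f, f', h1, h2, h3, h4, h5⟩ := key z hz
      exact ⟨f, f', h2, fun _ => ⟨h1, h3, h4, h5⟩⟩
    · exact ⟨0, 0, MemLp.zero, fun h => absurd h hz⟩
  choose f f' f2 hf using key2
  refine hilbert_herglotz (H := Lp ℂ 2 (volume.restrict (Ioi a))) m
    (fun z => (f2 z).toLp (f z)) (fun z => (memLp_conj_aux (f2 z)).toLp _) ?_ ?_ ?_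
  · intro z w hz hw
    obtain ⟨a1, a2, a3, a4⟩ := hf z hz
    obtain ⟨b1, b2, b3, b4⟩ := hf w hw
    have := Sol.green hσ a1 b1.conj (f2 z) a2 (memLp_conj_aux (f2 w)) (memLp_conj_aux b2)
    rw [a3, a4, b3, b4, map_one, mul_one, mul_one] at this
    rw [this, inner_toLp_aux]
  · intro z w hz hw
    obtain ⟨a1, a2, a3, a4⟩ := hf z hz
    obtain ⟨b1, b2, b3, b4⟩ := hf w hw
    have := Sol.green hσ a1 b1 (f2 z) a2 (f2 w) b2
    rw [a3, a4, b3, b4, mul_one, mul_one] at this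
    rw [this, inner_toLp_aux]
    simp
  · intro z hz
    rw [Lp.norm_toLp, Lp.norm_toLp]
    congr 1
    refine eLpNorm_congr_norm_ae (Eventually.of_forall fun x => ?_)
    simp
end

section
/- Continuity of the m-function under vague convergence: let C, γ > 0, let (μ_k) be a sequence of measures in M_a^{C,γ}(ℝ) whose atoms all lie in [γ, ∞), and let μ ∈ M_a^{C,γ}(ℝ) with atoms in [γ, ∞), such that μ_k → μ vaguely, i.e., ∫ f dμ_k → ∫ f dμ for every continuous compactly supported f : ℝ → ℝ. For a measure ν in this class and z ∈ ℂ⁺, let m₊(z, 0, ν) := u₊'(0)/u₊(0), where u₊ is any nonzero square-integrable solution on [0, ∞) of the interface equation −u'' = z u for ν. Then m₊(·, 0, μ_k) → m₊(·, 0, μ) uniformly on every compact subset of ℂ⁺. -/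
open Set Filter Topology MeasureTheory

lemma mono_finset (s : Finset ℝ) : ∀ (f f' : ℝ → ℝ) (a b : ℝ), a ≤ b → ContinuousOn f (Icc a b) →
    (∀ x, a < x → x < b → x ∉ s → HasDerivAt f (f' x) x ∧ 0 ≤ f' x) → f a ≤ f b := by
  induction s using Finset.induction_on with
  | empty =>
    intro f f' a b hab hc hd
    have hm : MonotoneOn f (Icc a b) := by
      apply monotoneOn_of_deriv_nonneg (convex_Icc a b) hc
      · intro x hx
        rw [interior_Icc] at hx
        exact (hd x hx.1 hx.2 (by simp)).1.differentiableAt.differentiableWithinAt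
      · intro x hx
        rw [interior_Icc] at hx
        rw [(hd x hx.1 hx.2 (by simp)).1.deriv]
        exact (hd x hx.1 hx.2 (by simp)).2
    exact hm (left_mem_Icc.2 hab) (right_mem_Icc.2 hab) hab
  | insert c s hcs ih =>
    intro f f' a b hab hc hd
    by_cases h : a < c ∧ c < b
    · have h1 := ih f f' a c h.1.le (hc.mono (Icc_subset_Icc le_rfl h.2.le))
        (fun x hx1 hx2 hx => hd x hx1 (hx2.trans h.2) (by
          simp only [Finset.mem_insert, not_or]; exact ⟨hx2.ne, hx⟩))
      have h2 := ih f f' c b h.2.le (hc.mono (Icc_subset_Icc h.1.le le_rfl))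
        (fun x hx1 hx2 hx => hd x (h.1.trans hx1) hx2 (by
          simp only [Finset.mem_insert, not_or]; exact ⟨hx1.ne', hx⟩))
      exact h1.trans h2
    · refine ih f f' a b hab hc (fun x hx1 hx2 hx => hd x hx1 hx2 ?_)
      simp only [Finset.mem_insert, not_or]
      refine ⟨?_, hx⟩
      rintro rfl
      exact h ⟨hx1, hx2⟩

/-- Locally finite set. -/
def LF (D : Set ℝ) : Prop := ∀ b, (D ∩ Iic b).Finite

lemma mono_off {D : Set ℝ} (hD : LF D) (f f' : ℝ → ℝ) {a b : ℝ} (hab : a ≤ b)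
    (hc : ContinuousOn f (Icc a b))
    (hd : ∀ x, a < x → x < b → x ∉ D → HasDerivAt f (f' x) x ∧ 0 ≤ f' x) : f a ≤ f b := by
  refine mono_finset (hD b).toFinset f f' a b hab hc (fun x h1 h2 hx => hd x h1 h2 ?_)
  intro h
  apply hx
  simp [h, h2.le]

lemma norm_off {D : Set ℝ} (hD : LF D) (f f' : ℝ → ℂ) (B B' : ℝ → ℝ) {a b : ℝ} (hab : a ≤ b)
    (hc : ContinuousOn f (Icc a b)) (hcB : ContinuousOn B (Icc a b))
    (hd : ∀ x, a < x → x < b → x ∉ D → HasDerivAt f (f' x) x ∧ HasDerivAt B (B' x) x ∧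
      ‖f' x‖ ≤ B' x) : ‖f b - f a‖ ≤ B b - B a := by
  obtain ⟨w, hw1, hw2⟩ : ∃ w : ℂ, ‖w‖ ≤ 1 ∧ (w * (f b - f a)).re = ‖f b - f a‖ := by
    by_cases h : f b - f a = 0
    · exact ⟨0, by simp, by simp [h]⟩
    · have hn : ‖f b - f a‖ ≠ 0 := norm_ne_zero_iff.2 h
      refine ⟨(starRingEnd ℂ) (f b - f a) / ‖f b - f a‖, ?_, ?_⟩
      · rw [norm_div, RCLike.norm_conj]; simp [hn]
      · rw [div_mul_eq_mul_div, mul_comm, Complex.mul_conj, Complex.normSq_eq_norm_sq]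
        rw [← Complex.ofReal_div, Complex.ofReal_re]
        field_simp
  have key := mono_off hD (fun x => B x - (w * f x).re) (fun x => B' x - (w * f' x).re) hab
    (hcB.sub (Complex.continuous_re.comp_continuousOn (continuousOn_const.mul hc)))
    (fun x h1 h2 hx => by
      obtain ⟨e1, e2, e3⟩ := hd x h1 h2 hx
      refine ⟨?_, ?_⟩
      · refine e2.sub ?_
        exact (Complex.reCLM.hasFDerivAt.comp_hasDerivAt x (e1.const_mul w))
      · have : (w * f' x).re ≤ ‖f' x‖ := by
          refine (Complex.re_le_norm _).trans ?_
          rw [norm_mul]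
          nlinarith [norm_nonneg (f' x)]
        linarith)
  rw [mul_sub, Complex.sub_re] at hw2
  linarith

/-- Weight function. -/
structure Wt (S : ℝ → ℝ) (D : Set ℝ) (γ : ℝ) : Prop where
  lf : LF D
  mono : Monotone S
  one_le : ∀ x, 1 ≤ S x
  eq_one : ∀ x, x < γ → S x = 1
  cont : ∀ x, x ∉ D → ContinuousAt S x
  free : ∀ x ∈ D, γ ≤ x

/-- Regularised solution. -/
structure Sol_s12 (S : ℝ → ℝ) (D : Set ℝ) (z : ℂ) (V P : ℝ → ℂ) : Prop where
  cV : ContinuousOn V (Ici 0)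
  cP : ContinuousOn P (Ici 0)
  dV : ∀ x, 0 < x → x ∉ D → HasDerivAt V (((1 / (S x) ^ 2 : ℝ) : ℂ) * P x) x
  dP : ∀ x, 0 < x → x ∉ D → HasDerivAt P (-z * (((S x) ^ 2 : ℝ) : ℂ) * V x) x

noncomputable def qq (V P : ℝ → ℂ) (x : ℝ) : ℂ := P x * (starRingEnd ℂ) (V x)
noncomputable def ee (S : ℝ → ℝ) (V P : ℝ → ℂ) (x : ℝ) : ℝ :=
  (S x) ^ 2 * ‖V x‖ ^ 2 + 1 / (S x) ^ 2 * ‖P x‖ ^ 2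
noncomputable def hh (z : ℂ) (V P : ℝ → ℂ) (x : ℝ) : ℝ :=
  (qq V P x).re - (z.re + 1) / z.im * (qq V P x).im

section sol
variable {S : ℝ → ℝ} {D : Set ℝ} {γ : ℝ} {z : ℂ} {V P : ℝ → ℂ}

lemma Sol_s12.dq (h : Sol_s12 S D z V P) {x : ℝ} (hx : 0 < x) (hxD : x ∉ D) :
    HasDerivAt (qq V P) (-z * (((S x) ^ 2 * ‖V x‖ ^ 2 : ℝ) : ℂ)
      + ((1 / (S x) ^ 2 * ‖P x‖ ^ 2 : ℝ) : ℂ)) x := by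
  have h1 := h.dP x hx hxD
  have h2 : HasDerivAt (fun y => (starRingEnd ℂ) (V y)) _ x := (h.dV x hx hxD).star
  have := h1.mul h2
  refine this.congr_deriv ?_
  have e1 : (star (((1 / (S x) ^ 2 : ℝ) : ℂ) * P x)) = ((1 / (S x) ^ 2 : ℝ) : ℂ) * (starRingEnd ℂ) (P x) := by
    rw [← starRingEnd_apply, map_mul, Complex.conj_ofReal]
  rw [e1]
  have e2 : ∀ w : ℂ, ((‖w‖ ^ 2 : ℝ) : ℂ) = w * (starRingEnd ℂ) w := by
    intro w; rw [Complex.mul_conj, Complex.normSq_eq_norm_sq]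
  rw [Complex.ofReal_mul, Complex.ofReal_mul (1 / S x ^ 2), e2, e2]
  ring

lemma Sol_s12.cq (h : Sol_s12 S D z V P) : ContinuousOn (qq V P) (Ici 0) :=
  h.cP.mul (Complex.continuous_conj.comp_continuousOn h.cV)

lemma Sol_s12.dg (h : Sol_s12 S D z V P) {x : ℝ} (hx : 0 < x) (hxD : x ∉ D) :
    HasDerivAt (fun x => (qq V P x).im) (-z.im * ((S x) ^ 2 * ‖V x‖ ^ 2)) x := by
  have := Complex.imCLM.hasFDerivAt.comp_hasDerivAt x (h.dq hx hxD)
  refine this.congr_deriv ?_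
  rw [Complex.imCLM_apply, Complex.add_im, Complex.im_mul_ofReal, Complex.ofReal_im, Complex.neg_im]
  ring

lemma Sol_s12.dr (h : Sol_s12 S D z V P) {x : ℝ} (hx : 0 < x) (hxD : x ∉ D) :
    HasDerivAt (fun x => (qq V P x).re)
      (-z.re * ((S x) ^ 2 * ‖V x‖ ^ 2) + 1 / (S x) ^ 2 * ‖P x‖ ^ 2) x := by
  have := Complex.reCLM.hasFDerivAt.comp_hasDerivAt x (h.dq hx hxD)
  refine this.congr_deriv ?_
  rw [Complex.reCLM_apply, Complex.add_re, Complex.re_mul_ofReal, Complex.ofReal_re, Complex.neg_re]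

lemma Sol_s12.dh (h : Sol_s12 S D z V P) (hz : 0 < z.im) {x : ℝ} (hx : 0 < x) (hxD : x ∉ D) :
    HasDerivAt (hh z V P) (ee S V P x) x := by
  have := (h.dr hx hxD).sub ((h.dg hx hxD).const_mul ((z.re + 1) / z.im))
  refine this.congr_deriv ?_
  unfold ee
  field_simp
  ring

lemma Sol_s12.cg (h : Sol_s12 S D z V P) : ContinuousOn (fun x => (qq V P x).im) (Ici 0) :=
  Complex.continuous_im.comp_continuousOn h.cq
lemma Sol_s12.ch (h : Sol_s12 S D z V P) : ContinuousOn (hh z V P) (Ici 0) :=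
  (Complex.continuous_re.comp_continuousOn h.cq).sub (continuousOn_const.mul h.cg)

lemma ee_nonneg (x : ℝ) : 0 ≤ ee S V P x := by unfold ee; positivity

lemma norm_qq_le (hS : Wt S D γ) (x : ℝ) : ‖qq V P x‖ ≤ ee S V P x := by
  have h1 := hS.one_le x
  unfold qq ee
  rw [norm_mul, RCLike.norm_conj]
  have : ‖P x‖ * ‖V x‖ = (S x * ‖V x‖) * (1 / S x * ‖P x‖) := by field_simp
  rw [this]
  have e : (S x) ^ 2 * ‖V x‖ ^ 2 + 1 / (S x) ^ 2 * ‖P x‖ ^ 2 =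
    (S x * ‖V x‖) ^ 2 + (1 / S x * ‖P x‖) ^ 2 := by ring
  rw [e]
  nlinarith [sq_nonneg (S x * ‖V x‖ - 1 / S x * ‖P x‖), sq_nonneg (S x * ‖V x‖),
    sq_nonneg (1 / S x * ‖P x‖)]

lemma unbdd_aux (f : ℝ → ℝ) (r0 κ L : ℝ) (hκ : 0 < κ) (hL : ∀ r, r0 ≤ r → f r ≤ L)
    (hf : ∀ r, r0 ≤ r → f r0 - κ * r0 ≤ f r - κ * r) : False := by
  have h0 := hL r0 le_rfl
  have hr : r0 ≤ r0 + (L - f r0 + 1) / κ := by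
    have : 0 ≤ (L - f r0 + 1) / κ := by apply div_nonneg <;> linarith
    linarith
  have h1 := hL _ hr
  have h2 := hf _ hr
  have : κ * (r0 + (L - f r0 + 1) / κ) = κ * r0 + (L - f r0 + 1) := by field_simp
  linarith

lemma primitive_aux (f : ℝ → ℝ) (D : Set ℝ) (hf : IntegrableOn f (Ioi 0)) (h0 : ∀ x, 0 ≤ f x)
    (hc : ∀ x, 0 < x → x ∉ D → ContinuousAt f x) :
    ∃ (Φ : ℝ → ℝ) (N : ℝ), Continuous Φ ∧ (∀ r, Φ r ≤ N) ∧ (∀ r, 0 ≤ r → 0 ≤ Φ r) ∧ Φ 0 = 0 ∧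
      ∀ x, 0 < x → x ∉ D → HasDerivAt Φ (f x) x := by
  have hi : Integrable ((Ioi 0).indicator f) := (integrable_indicator_iff measurableSet_Ioi).2 hf
  have hn : ∀ x, 0 ≤ (Ioi 0).indicator f x := fun x => indicator_nonneg (fun x _ => h0 x) x
  refine ⟨fun r => ∫ x in (0:ℝ)..r, (Ioi 0).indicator f x, ∫ x, (Ioi 0).indicator f x, ?_, ?_, ?_, ?_, ?_⟩
  · exact intervalIntegral.continuous_primitive (fun a b => hi.intervalIntegrable) 0
  · intro r
    beta_reduce
    by_cases hr : 0 ≤ r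
    · rw [intervalIntegral.integral_of_le hr]
      exact setIntegral_le_integral hi (Eventually.of_forall hn)
    · rw [intervalIntegral.integral_of_ge (le_of_not_ge hr)]
      have h1 : 0 ≤ ∫ x in Ioc r 0, (Ioi 0).indicator f x := integral_nonneg hn
      have h2 : 0 ≤ ∫ x, (Ioi 0).indicator f x := integral_nonneg hn
      linarith
  · intro r hr
    exact intervalIntegral.integral_nonneg hr (fun x _ => hn x)
  · simp
  · intro x hx hxD
    have he : (Ioi 0).indicator f =ᶠ[𝓝 x] f := by
      filter_upwards [Ioi_mem_nhds hx] with y hy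
      exact indicator_of_mem hy f
    have := intervalIntegral.integral_hasDerivAt_right (f := (Ioi 0).indicator f) (a := 0) (b := x)
      hi.intervalIntegrable (hi.aestronglyMeasurable.stronglyMeasurableAtFilter)
      ((hc x hx hxD).congr he.symm)
    rwa [indicator_of_mem (show x ∈ Ioi (0:ℝ) from hx) f] at this

lemma Sol_s12.h_mono (hS : Wt S D γ) (h : Sol_s12 S D z V P) (hz : 0 < z.im) {a b : ℝ} (ha : 0 ≤ a) (hab : a ≤ b) :
    hh z V P a ≤ hh z V P b :=
  mono_off hS.lf _ (ee S V P) hab (h.ch.mono (fun _ hx => ha.trans hx.1))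
    (fun x hx _ hD => ⟨h.dh hz (ha.trans_lt hx) hD, ee_nonneg x⟩)

lemma Sol_s12.g_anti (hS : Wt S D γ) (h : Sol_s12 S D z V P) (hz : 0 < z.im) {a b : ℝ} (ha : 0 ≤ a) (hab : a ≤ b) :
    (qq V P b).im ≤ (qq V P a).im := by
  have := mono_off hS.lf (fun x => -(qq V P x).im) (fun x => -(-z.im * ((S x) ^ 2 * ‖V x‖ ^ 2))) hab
    ((h.cg.mono (fun _ hx => ha.trans hx.1)).neg)
    (fun x hx _ hD => ⟨(h.dg (ha.trans_lt hx) hD).neg, by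
      have : 0 ≤ z.im * ((S x) ^ 2 * ‖V x‖ ^ 2) := by positivity
      linarith⟩)
  linarith

lemma abs_hh_le (x : ℝ) : |hh z V P x| ≤ (1 + |(z.re + 1) / z.im|) * ‖qq V P x‖ := by
  unfold hh
  calc _ ≤ |(qq V P x).re| + |(z.re + 1) / z.im * (qq V P x).im| := abs_sub _ _
    _ ≤ ‖qq V P x‖ + |(z.re + 1) / z.im| * ‖qq V P x‖ := by
      rw [abs_mul]
      gcongr
      · exact Complex.abs_re_le_norm _
      · exact Complex.abs_im_le_norm _
    _ = _ := by ring

lemma Sol_s12.tail (hS : Wt S D γ) (h : Sol_s12 S D z V P) (hz : 0 < z.im)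
    (hL2 : IntegrableOn (fun x => (S x) ^ 2 * ‖V x‖ ^ 2) (Ioi 0)) :
    (∀ r, 0 ≤ r → hh z V P r ≤ 0) ∧ (∀ r, 0 ≤ r → 0 ≤ (qq V P r).im) := by
  obtain ⟨Φ, N, hΦc, hΦN, hΦ0, hΦ00, hΦd⟩ := primitive_aux _ D hL2 (fun x => by positivity)
    (fun x hx hD => ((hS.cont x hD).pow 2).mul (((h.dV x hx hD).continuousAt.norm).pow 2))
  have hsub : ∀ {a b : ℝ}, 0 ≤ a → Icc a b ⊆ Ici 0 := fun ha _ hx => ha.trans hx.1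
  have hg : ∀ r, 0 ≤ r → (qq V P 0).im - z.im * N ≤ (qq V P r).im := by
    intro r hr
    have := mono_off hS.lf (fun x => (qq V P x).im + z.im * Φ x) (fun _ => 0) hr
      ((h.cg.mono (hsub le_rfl)).add (continuousOn_const.mul hΦc.continuousOn))
      (fun x hx _ hD => ⟨((h.dg hx hD).add ((hΦd x hx hD).const_mul z.im)).congr_deriv (by ring), le_rfl⟩)
    simp only [hΦ00] at this
    have := mul_le_mul_of_nonneg_left (hΦN r) hz.le
    linarith
  set c := (z.re + 1) / z.im with hc
  have hbd : ∃ L, ∀ r, 0 ≤ r → hh z V P r ≤ L := by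
    by_contra hcon
    push Not at hcon
    obtain ⟨r0, hr0, hr0'⟩ := hcon (|c| * (|(qq V P 0).im| + |z.im * N|))
    have hre : ∀ r, r0 ≤ r → 0 < (qq V P r).re := by
      intro r hr
      have h1 := h.h_mono hS hz hr0 hr
      have h2 := hg r (hr0.trans hr)
      have h3 := h.g_anti hS hz le_rfl (hr0.trans hr)
      have h4 : |(qq V P r).im| ≤ |(qq V P 0).im| + |z.im * N| := by
        rw [abs_le]
        constructor
        · linarith [neg_abs_le ((qq V P 0).im), le_abs_self (z.im * N)]
        · linarith [le_abs_self ((qq V P 0).im), abs_nonneg (z.im * N)]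
      have h5 : |c * (qq V P r).im| ≤ |c| * (|(qq V P 0).im| + |z.im * N|) := by
        rw [abs_mul]; gcongr
      have h6 : hh z V P r = (qq V P r).re - c * (qq V P r).im := rfl
      linarith [neg_abs_le (c * (qq V P r).im)]
    have hV0 : V r0 ≠ 0 := by
      intro h0
      have := hre r0 le_rfl
      simp [qq, h0] at this
    have hVm : ∀ r, r0 ≤ r → ‖V r0‖ ^ 2 ≤ ‖V r‖ ^ 2 := by
      intro r hr
      refine mono_off hS.lf (fun x => ‖V x‖ ^ 2) (fun x => 2 * (1 / (S x) ^ 2 * (qq V P x).re)) hr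
        ((h.cV.mono (hsub hr0)).norm.pow 2) (fun x hx _ hD => ⟨?_, ?_⟩)
      · refine (h.dV x (hr0.trans_lt hx) hD).norm_sq.congr_deriv ?_
        rw [Complex.inner, qq, mul_assoc, Complex.re_ofReal_mul]
      · have := hre x hx.le
        positivity
    refine unbdd_aux Φ r0 (‖V r0‖ ^ 2) N (by positivity) (fun r _ => hΦN r) (fun r hr => ?_)
    refine mono_off hS.lf (fun x => Φ x - ‖V r0‖ ^ 2 * x) (fun x => (S x) ^ 2 * ‖V x‖ ^ 2 - ‖V r0‖ ^ 2) hr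
      (by fun_prop) (fun x hx _ hD => ⟨?_, ?_⟩)
    · exact ((hΦd x (hr0.trans_lt hx) hD).sub ((hasDerivAt_id x).const_mul _)).congr_deriv (by ring)
    · have h1 := hVm x hx.le
      have h2 := hS.one_le x
      have h3 : 1 ≤ (S x) ^ 2 := by nlinarith
      nlinarith [sq_nonneg ‖V x‖]
  obtain ⟨L, hL⟩ := hbd
  have hlow : ∀ r0 κ, 0 ≤ r0 → 0 < κ → (∀ r, r0 ≤ r → κ ≤ ‖qq V P r‖) → False := by
    intro r0 κ hr0 hκ hq
    refine unbdd_aux (hh z V P) r0 κ L hκ (fun r hr => hL r (hr0.trans hr)) (fun r hr => ?_)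
    refine mono_off hS.lf (fun x => hh z V P x - κ * x) (fun x => ee S V P x - κ) hr
      ((h.ch.mono (hsub hr0)).sub (by fun_prop)) (fun x hx _ hD => ⟨?_, ?_⟩)
    · exact ((h.dh hz (hr0.trans_lt hx) hD).sub ((hasDerivAt_id x).const_mul _)).congr_deriv (by ring)
    · have := hq x hx.le
      linarith [norm_qq_le (V := V) (P := P) hS x]
  constructor
  · intro r hr
    by_contra hcon
    push Not at hcon
    have hk : 0 < 1 + |c| := by positivity
    refine hlow r (hh z V P r / (1 + |c|)) hr (by positivity) (fun s hs => ?_)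
    rw [div_le_iff₀ hk]
    have := abs_hh_le (z := z) (V := V) (P := P) s
    have h2 := h.h_mono hS hz hr hs
    rw [← hc] at this
    linarith [le_abs_self (hh z V P s)]
  · intro r hr
    by_contra hcon
    push Not at hcon
    refine hlow r (-(qq V P r).im) hr (by linarith) (fun s hs => ?_)
    have h1 := h.g_anti hS hz hr hs
    have h2 := Complex.abs_im_le_norm (qq V P s)
    linarith [neg_abs_le (qq V P s).im]

lemma Sol_s12.V0_ne (hS : Wt S D γ) (h : Sol_s12 S D z V P) (hz : 0 < z.im)
    (hg : ∀ r, 0 ≤ r → 0 ≤ (qq V P r).im) (hne : ∃ x, 0 ≤ x ∧ x ∉ D ∧ V x ≠ 0) : V 0 ≠ 0 := by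
  intro h0
  obtain ⟨x, hx, hxD, hVx⟩ := hne
  have hx' : 0 < x := by
    rcases hx.eq_or_lt with rfl | h'
    · exact absurd h0 hVx
    · exact h'
  have hz0 : ∀ y, 0 ≤ y → (qq V P y).im = 0 := by
    intro y hy
    have h1 := h.g_anti hS hz le_rfl hy
    have h2 : (qq V P 0).im = 0 := by simp [qq, h0]
    linarith [hg y hy]
  have h1 : HasDerivAt (fun x => (qq V P x).im) 0 x := by
    refine (hasDerivAt_const x (0:ℝ)).congr_of_eventuallyEq ?_
    filter_upwards [Ioi_mem_nhds hx'] with y hy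
    exact hz0 y (le_of_lt hy)
  have h2 := h1.unique (h.dg hx' hxD)
  have h3 := hS.one_le x
  have : 0 < z.im * ((S x) ^ 2 * ‖V x‖ ^ 2) := by
    have : 0 < ‖V x‖ := norm_pos_iff.2 hVx
    positivity
  linarith

lemma Sol_s12.m_bound (hS : Wt S D γ) (hγ : 0 < γ) (h : Sol_s12 S D z V P) {y0 Z : ℝ} (hy0 : 0 < y0)
    (hz : y0 ≤ z.im) (hZ : ‖z‖ ≤ Z) (hg : ∀ r, 0 ≤ r → 0 ≤ (qq V P r).im) (hV0 : V 0 = 1) :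
    ‖P 0‖ ≤ 2 / (γ / 2) ^ 2 * (2 * (γ / 2) +
      (Z * (γ / 2) ^ 2 + 2) * (γ / 2) / (4 * ((γ / 2) ^ 2 * y0 / (2 * (Z * (γ / 2) ^ 2 + 2))))) := by
  set a := γ / 2 with ha
  have ha0 : 0 < a := by positivity
  have hZ0 : 0 ≤ Z := (norm_nonneg _).trans hZ
  have hzp : 0 < z.im := hy0.trans_le hz
  set d := Z * a ^ 2 + 2 with hd
  have hd0 : 0 < d := by positivity
  set l := a ^ 2 * y0 / (2 * d) with hl
  have hl0 : 0 < l := by positivity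
  have key := norm_off hS.lf
    (fun x => (((a - x) ^ 2 : ℝ) : ℂ) * P x + ((2 * (a - x) : ℝ) : ℂ) * V x)
    (fun x => -(z * (((a - x) ^ 2 : ℝ) : ℂ) + 2) * V x)
    (fun x => -(d * l / z.im) * (qq V P x).im + d / (4 * l) * x)
    (fun x => d * (l * ‖V x‖ ^ 2 + 1 / (4 * l))) ha0.le
    (by
      refine ContinuousOn.add (ContinuousOn.mul ?_ (h.cP.mono fun _ hx => hx.1))
        (ContinuousOn.mul ?_ (h.cV.mono fun _ hx => hx.1)) <;> fun_prop)
    (by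
      refine ContinuousOn.add (ContinuousOn.mul ?_ (h.cg.mono fun _ hx => hx.1)) ?_ <;> fun_prop)
    (fun x hx hxa hD => by
      have hSx : S x = 1 := hS.eq_one x (by linarith)
      have d0 : HasDerivAt (fun x : ℝ => a - x) (-1) x := by
        simpa using (hasDerivAt_id x).const_sub a
      have d1 : HasDerivAt (fun x : ℝ => (((a - x) ^ 2 : ℝ) : ℂ)) ((2 * (a - x) * (-1) : ℝ) : ℂ) x := by
        refine HasDerivAt.ofReal_comp ?_
        exact (d0.pow 2).congr_deriv (by simp)
      have d2 : HasDerivAt (fun x : ℝ => ((2 * (a - x) : ℝ) : ℂ)) ((2 * (-1) : ℝ) : ℂ) x :=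
        HasDerivAt.ofReal_comp (d0.const_mul 2)
      refine ⟨?_, ?_, ?_⟩
      · refine ((d1.mul (h.dP x hx hD)).add (d2.mul (h.dV x hx hD))).congr_deriv ?_
        rw [hSx]
        push_cast
        ring
      · refine (((h.dg hx hD).const_mul _).add ((hasDerivAt_id x).const_mul _)).congr_deriv ?_
        rw [hSx]
        field_simp
      · rw [norm_mul, norm_neg]
        have e1 : ‖z * (((a - x) ^ 2 : ℝ) : ℂ) + 2‖ ≤ d := by
          refine (norm_add_le _ _).trans ?_
          rw [norm_mul, Complex.norm_real, Real.norm_of_nonneg (sq_nonneg _), hd]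
          have : (a - x) ^ 2 ≤ a ^ 2 := by nlinarith
          have : ‖z‖ * (a - x) ^ 2 ≤ Z * a ^ 2 := by gcongr
          simpa using this
        have e2 : ‖V x‖ ≤ l * ‖V x‖ ^ 2 + 1 / (4 * l) := by
          have : l * ‖V x‖ ^ 2 + 1 / (4 * l) - ‖V x‖ = (2 * l * ‖V x‖ - 1) ^ 2 / (4 * l) := by
            field_simp; ring
          have h2 : 0 ≤ (2 * l * ‖V x‖ - 1) ^ 2 / (4 * l) := by positivity
          linarith
        gcongr)
  have hg0 : (qq V P 0).im ≤ ‖P 0‖ := by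
    refine (Complex.im_le_norm _).trans ?_
    simp [qq, hV0]
  simp only [sub_self, sub_zero, hV0, mul_one, mul_zero, add_zero] at key
  simp only [ne_eq, OfNat.ofNat_ne_zero, not_false_eq_true, zero_pow, Complex.ofReal_zero, zero_mul,
    add_zero, zero_sub, norm_neg] at key
  have hga := hg a ha0.le
  have k1 : a ^ 2 * ‖P 0‖ - 2 * a ≤ ‖((a ^ 2 : ℝ) : ℂ) * P 0 + ((2 * a : ℝ) : ℂ)‖ := by
    have := norm_sub_le (((a ^ 2 : ℝ) : ℂ) * P 0 + ((2 * a : ℝ) : ℂ)) (((2 * a : ℝ) : ℂ))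
    rw [add_sub_cancel_right, norm_mul, Complex.norm_real, Complex.norm_real, Real.norm_of_nonneg (sq_nonneg _),
      Real.norm_of_nonneg (by positivity)] at this
    linarith
  have k2 : d * l / z.im * (qq V P 0).im ≤ a ^ 2 / 2 * ‖P 0‖ := by
    have : d * l / z.im ≤ d * l / y0 := by gcongr
    have e : d * l / y0 = a ^ 2 / 2 := by rw [hl]; field_simp
    rw [e] at this
    calc _ ≤ d * l / z.im * ‖P 0‖ := by gcongr
      _ ≤ _ := by gcongr
  have k3 : 0 ≤ d * l / z.im * (qq V P a).im := by positivity
  have k4 : d / (4 * l) * a = d * a / (4 * l) := by ring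
  have k5 : a ^ 2 / 2 * ‖P 0‖ ≤ 2 * a + d * a / (4 * l) := by linarith
  calc ‖P 0‖ = 2 / a ^ 2 * (a ^ 2 / 2 * ‖P 0‖) := by field_simp
    _ ≤ _ := by gcongr

lemma Sol_s12.growth (hS : Wt S D γ) (h : Sol_s12 S D z V P) {Z Q R : ℝ} (hZ : ‖z‖ ≤ Z) (hR : S R ≤ Q)
    {r : ℝ} (hr : 0 ≤ r) (hrR : r ≤ R) :
    ‖V r‖ ^ 2 + ‖P r‖ ^ 2 ≤ (‖V 0‖ ^ 2 + ‖P 0‖ ^ 2) * Real.exp ((1 + Z * Q ^ 2) * R) := by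
  set k := 1 + Z * Q ^ 2 with hk
  have hZ0 : 0 ≤ Z := (norm_nonneg _).trans hZ
  have key := mono_off hS.lf (fun x => -((‖V x‖ ^ 2 + ‖P x‖ ^ 2) * Real.exp (-k * x)))
    (fun x => -((2 * inner ℝ (V x) (((1 / (S x) ^ 2 : ℝ) : ℂ) * P x)
      + 2 * inner ℝ (P x) (-z * (((S x) ^ 2 : ℝ) : ℂ) * V x)) * Real.exp (-k * x)
      + (‖V x‖ ^ 2 + ‖P x‖ ^ 2) * (Real.exp (-k * x) * (-k)))) hr
    (by
      have h1 : ContinuousOn V (Icc 0 r) := h.cV.mono fun _ hx => hx.1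
      have h2 : ContinuousOn P (Icc 0 r) := h.cP.mono fun _ hx => hx.1
      fun_prop)
    (fun x hx hxr hD => by
      refine ⟨?_, ?_⟩
      · have e : HasDerivAt (fun x : ℝ => Real.exp (-k * x)) (Real.exp (-k * x) * (-k)) x := by
          have := ((hasDerivAt_id x).const_mul (-k)).exp
          simpa using this
        exact ((((h.dV x hx hD).norm_sq).add ((h.dP x hx hD).norm_sq)).mul e).neg
      · have hS1 := hS.one_le x
        have hSS : S x ≤ Q := (hS.mono (hxr.le.trans hrR)).trans hR
        have i1 : inner ℝ (V x) (((1 / (S x) ^ 2 : ℝ) : ℂ) * P x) ≤ ‖V x‖ * ‖P x‖ := by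
          refine (real_inner_le_norm _ _).trans ?_
          rw [norm_mul, Complex.norm_real, Real.norm_of_nonneg (by positivity)]
          have : 1 / S x ^ 2 ≤ 1 := by
            rw [div_le_one (by positivity)]; nlinarith
          gcongr
          exact mul_le_of_le_one_left (norm_nonneg _) this
        have i2 : inner ℝ (P x) (-z * (((S x) ^ 2 : ℝ) : ℂ) * V x) ≤ ‖P x‖ * (Z * Q ^ 2 * ‖V x‖) := by
          refine (real_inner_le_norm _ _).trans ?_
          rw [norm_mul, norm_mul, norm_neg, Complex.norm_real, Real.norm_of_nonneg (by positivity)]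
          gcongr
        have i3 : 2 * (‖V x‖ * ‖P x‖) ≤ ‖V x‖ ^ 2 + ‖P x‖ ^ 2 := by
          nlinarith [sq_nonneg (‖V x‖ - ‖P x‖)]
        have i4 : 2 * inner ℝ (V x) (((1 / (S x) ^ 2 : ℝ) : ℂ) * P x)
            + 2 * inner ℝ (P x) (-z * (((S x) ^ 2 : ℝ) : ℂ) * V x)
            ≤ k * (‖V x‖ ^ 2 + ‖P x‖ ^ 2) := by
          have : k * (2 * (‖V x‖ * ‖P x‖)) ≤ k * (‖V x‖ ^ 2 + ‖P x‖ ^ 2) := by gcongr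
          rw [hk] at this ⊢
          linarith
        have := mul_le_mul_of_nonneg_right i4 (Real.exp_pos (-k * x)).le
        linarith)
  simp only [mul_zero, Real.exp_zero, mul_one] at key
  have hk0 : 0 ≤ k := by positivity
  have e1 : Real.exp (-k * r) * Real.exp (k * r) = 1 := by
    rw [← Real.exp_add]; simp
  calc ‖V r‖ ^ 2 + ‖P r‖ ^ 2 = (‖V r‖ ^ 2 + ‖P r‖ ^ 2) * (Real.exp (-k * r) * Real.exp (k * r)) := by
        rw [e1, mul_one]
    _ = ((‖V r‖ ^ 2 + ‖P r‖ ^ 2) * Real.exp (-k * r)) * Real.exp (k * r) := by ring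
    _ ≤ (‖V 0‖ ^ 2 + ‖P 0‖ ^ 2) * Real.exp (k * r) := by gcongr; linarith
    _ ≤ _ := by gcongr

end sol


lemma aux_wle {s1 s2 a b A : ℝ} (h1 : 1 ≤ s1) (h2 : 1 ≤ s2) (ha : 0 ≤ a) (hb : 0 ≤ b) (hA : a * b ≤ A) :
    a * b ≤ (s2 ^ 2 * b ^ 2 + 1 / s1 ^ 2 * a ^ 2) / 2 + A * |s1 ^ 2 - s2 ^ 2| := by
  have e1 : a * b = (s2 * b) * (1 / s1 * a) + (a * b) * ((s1 - s2) / s1) := by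
    field_simp; ring
  have e2 : (s2 * b) * (1 / s1 * a) ≤ (s2 ^ 2 * b ^ 2 + 1 / s1 ^ 2 * a ^ 2) / 2 := by
    have : s2 ^ 2 * b ^ 2 + 1 / s1 ^ 2 * a ^ 2 = (s2 * b) ^ 2 + (1 / s1 * a) ^ 2 := by ring
    rw [this]
    nlinarith [sq_nonneg (s2 * b - 1 / s1 * a)]
  have e3 : (s1 - s2) / s1 ≤ |s1 ^ 2 - s2 ^ 2| := by
    rw [div_le_iff₀ (by positivity)]
    have : s1 ^ 2 - s2 ^ 2 = (s1 - s2) * (s1 + s2) := by ring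
    rw [this, abs_mul, abs_of_nonneg (show 0 ≤ s1 + s2 by linarith)]
    have h3 := le_abs_self (s1 - s2)
    have h4 := abs_nonneg (s1 - s2)
    have h5 : |s1 - s2| * 1 ≤ |s1 - s2| * ((s1 + s2) * s1) := by
      gcongr; nlinarith
    nlinarith
  have hab : 0 ≤ a * b := by positivity
  have e4 : (a * b) * ((s1 - s2) / s1) ≤ A * |s1 ^ 2 - s2 ^ 2| :=
    (mul_le_mul_of_nonneg_left e3 hab).trans (mul_le_mul_of_nonneg_right hA (abs_nonneg _))
  linarith

lemma LF.union {D1 D2 : Set ℝ} (h1 : LF D1) (h2 : LF D2) : LF (D1 ∪ D2) := by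
  intro b
  rw [union_inter_distrib_right]
  exact (h1 b).union (h2 b)

lemma Wt.sq_int {S : ℝ → ℝ} {D : Set ℝ} {γ : ℝ} (h : Wt S D γ) (a b : ℝ) :
    IntervalIntegrable (fun x => (S x) ^ 2) volume a b := by
  apply Monotone.intervalIntegrable
  intro x y hxy
  have h1 := h.one_le x
  have h2 := h.mono hxy
  simp only
  gcongr

lemma compare {S1 S2 : ℝ → ℝ} {D1 D2 : Set ℝ} {γ : ℝ} {z : ℂ} {V1 P1 V2 P2 : ℝ → ℂ}
    (hS1 : Wt S1 D1 γ) (hS2 : Wt S2 D2 γ) (h1 : Sol_s12 S1 D1 z V1 P1) (h2 : Sol_s12 S2 D2 z V2 P2)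
    (hz : 0 < z.im) {R Z A M : ℝ} (hR : 0 < R) (hZ : ‖z‖ ≤ Z)
    (hA1 : ∀ r, 0 ≤ r → r ≤ R → ‖V1 r‖ ^ 2 + ‖P1 r‖ ^ 2 ≤ A)
    (hA2 : ∀ r, 0 ≤ r → r ≤ R → ‖V2 r‖ ^ 2 + ‖P2 r‖ ^ 2 ≤ A)
    (hR1 : hh z V1 P1 R ≤ 0) (hR2 : hh z V2 P2 R ≤ 0)
    (hM1 : -M ≤ hh z V1 P1 0) (hM2 : -M ≤ hh z V2 P2 0)
    (hV1 : V1 0 = 1) (hV2 : V2 0 = 1) :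
    ‖P1 0 - P2 0‖ * R ≤ 2 * M + (2 * A + (Z + 1) * A * R) *
      ∫ x in (0:ℝ)..R, |(S1 x) ^ 2 - (S2 x) ^ 2| := by
  set f : ℝ → ℝ := fun x => |(S1 x) ^ 2 - (S2 x) ^ 2| with hf
  have hfi : ∀ a b, IntervalIntegrable f volume a b := fun a b =>
    ((hS1.sq_int a b).sub (hS2.sq_int a b)).abs
  set J : ℝ → ℝ := fun r => ∫ x in (0:ℝ)..r, f x with hJ
  have hJ0 : J 0 = 0 := by simp [hJ]
  have hJc : Continuous J := intervalIntegral.continuous_primitive hfi 0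
  have hmeas : Measurable f := by
    have m1 := hS1.mono.measurable
    have m2 := hS2.mono.measurable
    have : Measurable fun x => |(S1 x) ^ 2 - (S2 x) ^ 2| := by fun_prop
    exact this
  have hJd : ∀ x, x ∉ D1 ∪ D2 → HasDerivAt J (f x) x := by
    intro x hx
    simp only [mem_union, not_or] at hx
    exact intervalIntegral.integral_hasDerivAt_right (hfi 0 x)
      (hmeas.stronglyMeasurable.stronglyMeasurableAtFilter)
      (((hS1.cont x hx.1).pow 2).sub ((hS2.cont x hx.2).pow 2)).abs
  have hJm : ∀ {a b}, a ≤ b → J a ≤ J b := by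
    intro a b hab
    have : J b - J a = ∫ x in a..b, f x := intervalIntegral.integral_interval_sub_left (hfi _ _) (hfi _ _)
    have h0 : 0 ≤ ∫ x in a..b, f x := intervalIntegral.integral_nonneg hab (fun x _ => abs_nonneg _)
    linarith
  have hA0 : 0 ≤ A := le_trans (by positivity) (hA1 0 le_rfl hR.le)
  have hZ0 : 0 ≤ Z := (norm_nonneg _).trans hZ
  have hLF := hS1.lf.union hS2.lf
  set w : ℝ → ℂ := fun x => P1 x * V2 x - V1 x * P2 x with hw
  have cw : ContinuousOn w (Ici 0) := (h1.cP.mul h2.cV).sub (h1.cV.mul h2.cP)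
  have amul : ∀ {a b c d : ℝ}, a ^ 2 + b ^ 2 ≤ A → c ^ 2 + d ^ 2 ≤ A → a * c ≤ A ∧ a * d ≤ A ∧ b * c ≤ A ∧ b * d ≤ A := by
    intro a b c d h h'
    refine ⟨?_, ?_, ?_, ?_⟩
    · nlinarith [sq_nonneg (a - c), sq_nonneg b, sq_nonneg d]
    · nlinarith [sq_nonneg (a - d), sq_nonneg b, sq_nonneg c]
    · nlinarith [sq_nonneg (b - c), sq_nonneg a, sq_nonneg d]
    · nlinarith [sq_nonneg (b - d), sq_nonneg a, sq_nonneg c]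
  have hwb : ∀ r, 0 ≤ r → r ≤ R → ‖w r - w 0‖ ≤ (Z + 1) * A * J R := by
    intro r hr hrR
    have key := norm_off hLF w
      (fun x => z * (((S2 x) ^ 2 - (S1 x) ^ 2 : ℝ) : ℂ) * (V1 x * V2 x)
        + ((1 / (S2 x) ^ 2 - 1 / (S1 x) ^ 2 : ℝ) : ℂ) * (P1 x * P2 x))
      (fun x => (Z + 1) * A * J x) (fun x => (Z + 1) * A * f x) hr
      (cw.mono fun _ hx => hx.1) (by fun_prop)
      (fun x hx hxr hD => by
        have hD' := hD
        simp only [mem_union, not_or] at hD'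
        refine ⟨?_, (hJd x hD).const_mul _, ?_⟩
        · refine (((h1.dP x hx hD'.1).mul (h2.dV x hx hD'.2)).sub
            ((h1.dV x hx hD'.1).mul (h2.dP x hx hD'.2))).congr_deriv ?_
          push_cast
          ring
        · obtain ⟨b1, b2, b3, b4⟩ := amul (hA1 x hx.le (hxr.le.trans hrR)) (hA2 x hx.le (hxr.le.trans hrR))
          have s1 := hS1.one_le x
          have s2 := hS2.one_le x
          refine (norm_add_le _ _).trans ?_
          rw [norm_mul, norm_mul, norm_mul, norm_mul, norm_mul, Complex.norm_real, Complex.norm_real,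
            Real.norm_eq_abs, Real.norm_eq_abs, abs_sub_comm]
          have e : |1 / (S2 x) ^ 2 - 1 / (S1 x) ^ 2| ≤ f x := by
            have : 1 / (S2 x) ^ 2 - 1 / (S1 x) ^ 2 = ((S1 x) ^ 2 - (S2 x) ^ 2) / ((S1 x) ^ 2 * (S2 x) ^ 2) := by
              field_simp
            rw [this, abs_div, abs_of_pos (show 0 < (S1 x) ^ 2 * (S2 x) ^ 2 by positivity)]
            apply div_le_self (abs_nonneg _)
            have t1 : 1 ≤ (S1 x) ^ 2 := by nlinarith
            have t2 : 1 ≤ (S2 x) ^ 2 := by nlinarith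
            nlinarith
          have f0 : 0 ≤ f x := abs_nonneg _
          calc _ ≤ Z * f x * A + f x * A := by gcongr
            _ = _ := by ring)
    have hJr := hJm hrR
    have : (Z + 1) * A * J r ≤ (Z + 1) * A * J R := by gcongr
    simp only [hJ0, mul_zero, sub_zero] at key
    linarith
  set η := ‖P1 0 - P2 0‖ with hη
  have hw0 : ‖w 0‖ = η := by simp [hw, hV1, hV2, hη]
  set ε := (Z + 1) * A * J R with hε
  have fin := mono_off hLF
    (fun x => hh z V1 P1 x + hh z V2 P2 x + 2 * A * J x - (η - ε) * x)
    (fun x => ee S1 V1 P1 x + ee S2 V2 P2 x + 2 * A * f x - (η - ε)) hR.le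
    (by
      have c1 := h1.ch.mono (show Icc 0 R ⊆ Ici 0 from fun _ hx => hx.1)
      have c2 := h2.ch.mono (show Icc 0 R ⊆ Ici 0 from fun _ hx => hx.1)
      fun_prop)
    (fun x hx hxR hD => by
      have hD' := hD
      simp only [mem_union, not_or] at hD'
      refine ⟨?_, ?_⟩
      · exact ((((h1.dh hz hx hD'.1).add (h2.dh hz hx hD'.2)).add ((hJd x hD).const_mul (2 * A))).sub
          ((hasDerivAt_id x).const_mul _)).congr_deriv (by ring)
      · obtain ⟨b1, b2, b3, b4⟩ := amul (hA1 x hx.le hxR.le) (hA2 x hx.le hxR.le)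
        have s1 := hS1.one_le x
        have s2 := hS2.one_le x
        have t1 := aux_wle s1 s2 (norm_nonneg (P1 x)) (norm_nonneg (V2 x)) b3
        have t2 := aux_wle s2 s1 (norm_nonneg (P2 x)) (norm_nonneg (V1 x)) (A := A) ((mul_comm _ _).trans_le b2)
        have t3 : ‖w x‖ ≤ ‖P1 x‖ * ‖V2 x‖ + ‖P2 x‖ * ‖V1 x‖ := by
          refine (norm_sub_le _ _).trans ?_
          rw [norm_mul, norm_mul, mul_comm ‖V1 x‖]
        have t4 := hwb x hx.le hxR.le
        have t5 : ‖w 0‖ ≤ ‖w x‖ + ‖w x - w 0‖ := by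
          have := norm_sub_le (w x) (w x - w 0)
          rwa [sub_sub_cancel] at this
        have n1 := ee_nonneg (S := S1) (V := V1) (P := P1) x
        have n2 := ee_nonneg (S := S2) (V := V2) (P := P2) x
        rw [abs_sub_comm] at t2
        simp only [ee] at n1 n2 ⊢
        simp only [hf]
        linarith)
  simp only [hJ0, mul_zero, sub_zero, add_zero] at fin
  have : (η - ε) * R = η * R - (Z + 1) * A * R * J R := by rw [hε]; ring
  have e : (2 * A + (Z + 1) * A * R) * J R = 2 * A * J R + (Z + 1) * A * R * J R := by ring
  rw [show (∫ x in (0:ℝ)..R, f x) = J R from rfl, e]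
  linarith


/-- Admissible atoms and branching numbers. -/
structure Cfg (γ : ℝ) (ts bs : ℕ → ℝ) : Prop where
  pos : 0 < γ
  sep : ∀ n m, n ≠ m → γ ≤ |ts n - ts m|
  ge : ∀ n, γ ≤ ts n
  b : ∀ n, 1 < bs n

noncomputable def SS (ts bs : ℕ → ℝ) (x : ℝ) : ℝ := ∏ᶠ (n) (_ : n ∈ {n | ts n ≤ x}), Real.sqrt (bs n)

lemma LF.isClosed {D : Set ℝ} (h : LF D) : IsClosed D := by
  rw [← isOpen_compl_iff, isOpen_iff_mem_nhds]
  intro x hx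
  filter_upwards [Iio_mem_nhds (show x < x + 1 by linarith),
    (h (x + 1)).isClosed.isOpen_compl.mem_nhds (show x ∈ (D ∩ Iic (x + 1))ᶜ from fun h' => hx h'.1)] with y h1 h2 h3
  exact h2 ⟨h3, mem_Iic.2 (le_of_lt (mem_Iio.1 h1))⟩

section cfg
variable {γ : ℝ} {ts bs : ℕ → ℝ}

lemma Cfg.fin (h : Cfg γ ts bs) (x : ℝ) : {n | ts n ≤ x}.Finite := by
  have hγ := h.pos
  refine Set.Finite.of_injOn (f := fun n => ⌊ts n / γ⌋₊) (t := Set.Iic ⌊x / γ⌋₊) ?_ ?_ (finite_Iic _)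
  · intro n hn
    simp only [mem_Iic]
    apply Nat.floor_le_floor
    have : ts n ≤ x := hn
    gcongr
  · intro n _ m _ hnm
    by_contra hne
    have h1 := h.sep n m hne
    have h2 : (0:ℝ) ≤ ts n / γ := div_nonneg (hγ.le.trans (h.ge n)) hγ.le
    have h3 : (0:ℝ) ≤ ts m / γ := div_nonneg (hγ.le.trans (h.ge m)) hγ.le
    have a1 := Nat.floor_le h2
    have a2 := Nat.lt_floor_add_one (ts n / γ)
    have a3 := Nat.floor_le h3
    have a4 := Nat.lt_floor_add_one (ts m / γ)
    simp only at hnm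
    rw [hnm] at a1 a2
    have h4 : |ts n / γ - ts m / γ| < 1 := by rw [abs_lt]; constructor <;> linarith
    rw [← sub_div, abs_div, abs_of_pos hγ, div_lt_one hγ] at h4
    linarith

lemma Cfg.lf (h : Cfg γ ts bs) : LF (range ts) := by
  intro b
  refine ((h.fin b).image ts).subset ?_
  rintro _ ⟨⟨n, rfl⟩, hn⟩
  exact ⟨n, hn, rfl⟩

lemma Cfg.one_lt_sqrt (h : Cfg γ ts bs) (n : ℕ) : 1 < Real.sqrt (bs n) := by
  rw [Real.lt_sqrt zero_le_one]; simpa using h.b n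

lemma Cfg.SS_eq (h : Cfg γ ts bs) (x : ℝ) : SS ts bs x = ∏ n ∈ (h.fin x).toFinset, Real.sqrt (bs n) :=
  finprod_mem_eq_finite_toFinset_prod _ _

lemma Cfg.SS_right (h : Cfg γ ts bs) (n : ℕ) {x : ℝ} (h1 : ts n ≤ x) (h2 : x < ts n + γ) :
    SS ts bs x = SS ts bs (ts n) := by
  unfold SS
  have : {m | ts m ≤ x} = {m | ts m ≤ ts n} := by
    ext m
    simp only [mem_ofPred_eq]
    refine ⟨fun hm => ?_, fun hm => hm.trans h1⟩
    by_contra hlt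
    push Not at hlt
    have := h.sep m n (by rintro rfl; exact lt_irrefl _ hlt)
    rw [abs_of_pos (by linarith)] at this
    linarith
  rw [this]

lemma Cfg.SS_left (h : Cfg γ ts bs) (n : ℕ) {x : ℝ} (h1 : x < ts n) (h2 : ts n - γ < x) :
    SS ts bs (ts n) = Real.sqrt (bs n) * SS ts bs x := by
  unfold SS
  have : {m | ts m ≤ ts n} = insert n {m | ts m ≤ x} := by
    ext m
    simp only [mem_ofPred_eq, mem_insert_iff]
    refine ⟨fun hm => ?_, ?_⟩
    · by_contra hlt
      push Not at hlt
      have := h.sep m n hlt.1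
      rw [abs_of_nonpos (by linarith)] at this
      linarith [hlt.2]
    · rintro (rfl | hm)
      · exact le_rfl
      · exact hm.trans h1.le
  rw [this, finprod_mem_insert _ (by simpa using h1) (h.fin x)]

lemma Cfg.SS_const (h : Cfg γ ts bs) {x : ℝ} (hx : x ∉ range ts) :
    SS ts bs =ᶠ[𝓝 x] fun _ => SS ts bs x := by
  obtain ⟨d, hd, hb⟩ := Metric.isOpen_iff.1 h.lf.isClosed.isOpen_compl x hx
  filter_upwards [Metric.ball_mem_nhds x hd] with y hy
  unfold SS
  have e : {n | ts n ≤ y} = {n | ts n ≤ x} := by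
    ext n
    simp only [mem_ofPred_eq]
    have hn : ts n ∉ Metric.ball x d := fun hh => hb hh ⟨n, rfl⟩
    rw [Metric.mem_ball, Real.dist_eq, not_lt] at hn
    rw [Metric.mem_ball, Real.dist_eq, abs_lt] at hy
    constructor
    · intro hle
      by_contra hlt
      push Not at hlt
      rw [abs_of_pos (by linarith)] at hn
      linarith
    · intro hle
      by_contra hlt
      push Not at hlt
      rw [abs_of_nonpos (by linarith)] at hn
      linarith
  rw [e]

lemma Cfg.wt (h : Cfg γ ts bs) : Wt (SS ts bs) (range ts) γ where
  lf := h.lf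
  mono := by
    intro x y hxy
    rw [h.SS_eq, h.SS_eq]
    apply Finset.prod_le_prod_of_subset_of_one_le
    · intro n hn
      simp only [Finite.mem_toFinset, mem_ofPred_eq] at hn ⊢
      exact hn.trans hxy
    · intro i _; positivity
    · intro i _ _; exact (h.one_lt_sqrt i).le
  one_le := by
    intro x
    rw [h.SS_eq]
    have := Finset.prod_le_prod_of_subset_of_one_le (f := fun n => Real.sqrt (bs n))
      (Finset.empty_subset (h.fin x).toFinset) (by simp) (fun i _ _ => (h.one_lt_sqrt i).le)
    simpa using this
  eq_one := by
    intro x hx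
    rw [h.SS_eq]
    apply Finset.prod_eq_one
    intro n hn
    simp only [Finite.mem_toFinset, mem_ofPred_eq] at hn
    linarith [h.ge n]
  cont := by
    intro x hx
    exact continuousAt_const.congr (h.SS_const hx).symm
  free := by
    rintro _ ⟨n, rfl⟩
    exact h.ge n

lemma conv_sol (h : Cfg γ ts bs) {z : ℂ} {u : ℝ → ℂ} (hu : IsL2Solution ts bs z 0 u) :
    ∃ V P : ℝ → ℂ, Sol_s12 (SS ts bs) (range ts) z V P ∧
      IntegrableOn (fun x => (SS ts bs x) ^ 2 * ‖V x‖ ^ 2) (Ioi 0) ∧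
      (∃ x, 0 ≤ x ∧ x ∉ range ts ∧ V x ≠ 0) ∧ V 0 = u 0 ∧
      P 0 = derivWithin u (offAtoms ts (Ici 0)) 0 := by
  have hW := h.wt
  have hγ := h.pos
  obtain ⟨⟨hC, hE, hI⟩, ⟨x0, hx0, hux0⟩, hint⟩ := hu
  set A := offAtoms ts (Ici 0) with hA
  have hAeq : A = Ici 0 ∩ (range ts)ᶜ := rfl
  have hopen : IsOpen (range ts)ᶜ := hW.lf.isClosed.isOpen_compl
  have hUD : UniqueDiffOn ℝ A := (uniqueDiffOn_Ici 0).inter hopen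
  have hAn : ∀ x, 0 < x → x ∉ range ts → A ∈ 𝓝 x := fun x hx hD =>
    inter_mem (Ici_mem_nhds hx) (hopen.mem_nhds hD)
  have hcu : ContinuousOn u A := hC.continuousOn
  have hCd : ContDiffOn ℝ 1 (derivWithin u A) A := hC.derivWithin hUD (by norm_num)
  have hcd : ContinuousOn (derivWithin u A) A := hCd.continuousOn
  have hcS : ContinuousOn (fun x => (SS ts bs x : ℂ)) A := fun x hx =>
    (Complex.continuous_ofReal.continuousAt.comp (hW.cont x hx.2)).continuousWithinAt
  have hSne : ∀ x, (SS ts bs x : ℂ) ≠ 0 := by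
    intro x
    have := hW.one_le x
    exact_mod_cast (by linarith : (0:ℝ) < SS ts bs x).ne'
  set fV : ℝ → ℂ := fun x => u x / (SS ts bs x : ℂ) with hfV
  set fP : ℝ → ℂ := fun x => (SS ts bs x : ℂ) * derivWithin u A x with hfP
  have cV : ContinuousOn fV A := hcu.div hcS (fun x _ => hSne x)
  have cP : ContinuousOn fP A := hcS.mul hcd
  have hcl : Ici (0:ℝ) ⊆ closure A := by
    have hd : Dense (range ts)ᶜ := (countable_range ts).dense_compl ℝ
    have h1 : Ioi (0:ℝ) ⊆ closure (Ioi 0 ∩ (range ts)ᶜ) := hd.open_subset_closure_inter isOpen_Ioi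
    have h2 : closure (Ioi (0:ℝ)) ⊆ closure A := by
      refine closure_minimal (h1.trans (closure_mono ?_)) isClosed_closure
      exact inter_subset_inter_left _ Ioi_subset_Ici_self
    rwa [closure_Ioi] at h2
  have hlim : ∀ n, (∃ y, Tendsto fV (𝓝[A] (ts n)) (𝓝 y)) ∧ (∃ y, Tendsto fP (𝓝[A] (ts n)) (𝓝 y)) := by
    intro n
    obtain ⟨uL, uR, dL, dR, l1, l2, l3, l4, e1, e2⟩ := hI n (by
      rw [interior_Ici]; exact hγ.trans_le (h.ge n))
    have hsplit : 𝓝[A] (ts n) = 𝓝[A ∩ Iio (ts n)] (ts n) ⊔ 𝓝[A ∩ Ioi (ts n)] (ts n) := by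
      rw [← nhdsWithin_union]
      congr 1
      ext y
      constructor
      · intro hy
        rcases lt_trichotomy y (ts n) with h' | h' | h'
        · exact Or.inl ⟨hy, h'⟩
        · exact absurd ⟨n, h'.symm⟩ hy.2
        · exact Or.inr ⟨hy, h'⟩
      · rintro (hy | hy) <;> exact hy.1
    have hs1 := h.one_lt_sqrt n
    have hs : (Real.sqrt (bs n) : ℂ) ≠ 0 := by
      exact_mod_cast (by linarith : (0:ℝ) < Real.sqrt (bs n)).ne'
    have hl : ∀ᶠ x in 𝓝[A ∩ Iio (ts n)] (ts n), (SS ts bs x : ℂ) = SS ts bs (ts n) / (Real.sqrt (bs n) : ℂ) := by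
      have : ∀ᶠ x in 𝓝[A ∩ Iio (ts n)] (ts n), ts n - γ < x :=
        mem_nhdsWithin_of_mem_nhds (Ioi_mem_nhds (by linarith))
      filter_upwards [this, self_mem_nhdsWithin] with x hx hx2
      rw [h.SS_left n hx2.2 hx, Complex.ofReal_mul]
      field_simp
    have hr : ∀ᶠ x in 𝓝[A ∩ Ioi (ts n)] (ts n), (SS ts bs x : ℂ) = SS ts bs (ts n) := by
      have : ∀ᶠ x in 𝓝[A ∩ Ioi (ts n)] (ts n), x < ts n + γ :=
        mem_nhdsWithin_of_mem_nhds (Iio_mem_nhds (by linarith))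
      filter_upwards [this, self_mem_nhdsWithin] with x hx hx2
      rw [h.SS_right n (le_of_lt hx2.2) hx]
    have hn := hSne (ts n)
    constructor
    · refine ⟨uR / SS ts bs (ts n), ?_⟩
      rw [hsplit, tendsto_sup]
      constructor
      · have := l1.div_const ((SS ts bs (ts n) : ℂ) / (Real.sqrt (bs n) : ℂ))
        have e : uL / ((SS ts bs (ts n) : ℂ) / (Real.sqrt (bs n) : ℂ)) = uR / SS ts bs (ts n) := by
          rw [e1]; field_simp
        rw [e] at this
        refine this.congr' ?_
        filter_upwards [hl] with x hx
        simp only [hfV, hx]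
      · refine (l2.div_const (SS ts bs (ts n) : ℂ)).congr' ?_
        filter_upwards [hr] with x hx
        simp only [hfV, hx]
    · refine ⟨SS ts bs (ts n) * dR, ?_⟩
      rw [hsplit, tendsto_sup]
      constructor
      · have := l3.const_mul ((SS ts bs (ts n) : ℂ) / (Real.sqrt (bs n) : ℂ))
        have e : ((SS ts bs (ts n) : ℂ) / (Real.sqrt (bs n) : ℂ)) * dL = SS ts bs (ts n) * dR := by
          rw [e2]; field_simp
        rw [e] at this
        refine this.congr' ?_
        filter_upwards [hl] with x hx
        simp only [hfP, hx]
      · refine (l4.const_mul (SS ts bs (ts n) : ℂ)).congr' ?_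
        filter_upwards [hr] with x hx
        simp only [hfP, hx]
  have eV : ∀ x ∈ A, extendFrom A fV x = fV x := extendFrom_extends cV
  have eP : ∀ x ∈ A, extendFrom A fP x = fP x := extendFrom_extends cP
  have h0A : (0:ℝ) ∈ A := by
    refine ⟨self_mem_Ici, ?_⟩
    rintro ⟨n, hn⟩
    linarith [h.ge n]
  have hS0 : SS ts bs 0 = 1 := hW.eq_one 0 hγ
  refine ⟨extendFrom A fV, extendFrom A fP, ⟨?_, ?_, ?_, ?_⟩, ?_, ⟨x0, hx0.1, hx0.2, ?_⟩, ?_, ?_⟩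
  · apply continuousOn_extendFrom hcl
    intro x hx
    by_cases hD : x ∈ range ts
    · obtain ⟨n, rfl⟩ := hD
      exact (hlim n).1
    · exact ⟨_, cV x ⟨hx, hD⟩⟩
  · apply continuousOn_extendFrom hcl
    intro x hx
    by_cases hD : x ∈ range ts
    · obtain ⟨n, rfl⟩ := hD
      exact (hlim n).2
    · exact ⟨_, cP x ⟨hx, hD⟩⟩
  · intro x hx hD
    have hxA : x ∈ A := ⟨hx.le, hD⟩
    have hn := hAn x hx hD
    rw [eP x hxA]
    have hd : HasDerivAt u (derivWithin u A x) x :=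
      ((hC.differentiableOn (by norm_num)) x hxA).hasDerivWithinAt.hasDerivAt hn
    have h1 := hd.div_const (SS ts bs x : ℂ)
    have h2 : extendFrom A fV =ᶠ[𝓝 x] fun y => u y / (SS ts bs x : ℂ) := by
      filter_upwards [hn, h.SS_const hD] with y hy hy2
      rw [eV y hy]
      simp only [hfV, hy2]
    refine (h1.congr_of_eventuallyEq h2).congr_deriv ?_
    have := hSne x
    simp only [hfP]
    push_cast
    field_simp
  · intro x hx hD
    have hxA : x ∈ A := ⟨hx.le, hD⟩
    have hn := hAn x hx hD
    rw [eV x hxA]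
    have hd : HasDerivAt (derivWithin u A) (derivWithin (derivWithin u A) A x) x :=
      ((hCd.differentiableOn (by norm_num)) x hxA).hasDerivWithinAt.hasDerivAt hn
    have h1 := hd.const_mul (SS ts bs x : ℂ)
    have h2 : extendFrom A fP =ᶠ[𝓝 x] fun y => (SS ts bs x : ℂ) * derivWithin u A y := by
      filter_upwards [hn, h.SS_const hD] with y hy hy2
      rw [eP y hy]
      simp only [hfP, hy2]
    refine (h1.congr_of_eventuallyEq h2).congr_deriv ?_
    have h3 := hE x hxA
    have h4 : derivWithin (derivWithin u A) A x = -(z * u x) := by rw [← h3, neg_neg]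
    have := hSne x
    rw [h4]
    simp only [hfV]
    push_cast
    field_simp
  · refine hint.congr_fun_ae ?_
    rw [Filter.EventuallyEq, ae_restrict_iff' measurableSet_Ioi]
    have hnull : volume (range ts) = 0 := (countable_range ts).measure_zero _
    filter_upwards [compl_mem_ae_iff.2 hnull] with x hx hx0
    rw [eV x ⟨mem_Ici.2 (le_of_lt (mem_Ioi.1 hx0)), hx⟩]
    simp only [hfV]
    have := hW.one_le x
    rw [norm_div, Complex.norm_real, Real.norm_of_nonneg (by linarith)]
    field_simp
  · rw [eV x0 hx0]
    exact div_ne_zero hux0 (hSne x0)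
  · rw [eV 0 h0A]
    simp [hfV, hS0]
  · rw [eP 0 h0A]
    simp [hfP, hS0]

lemma norm_sol (h : Cfg γ ts bs) {z : ℂ} (hz : 0 < z.im) {u : ℝ → ℂ} (hu : IsL2Solution ts bs z 0 u) :
    ∃ V P : ℝ → ℂ, Sol_s12 (SS ts bs) (range ts) z V P ∧ V 0 = 1 ∧
      P 0 = derivWithin u (offAtoms ts (Ici 0)) 0 / u 0 ∧
      (∀ r, 0 ≤ r → hh z V P r ≤ 0) ∧ (∀ r, 0 ≤ r → 0 ≤ (qq V P r).im) := by
  obtain ⟨V, P, hs, hi, hne, hV0, hP0⟩ := conv_sol h hu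
  have hV := hs.V0_ne h.wt hz (hs.tail h.wt hz hi).2 hne
  have hs' : Sol_s12 (SS ts bs) (range ts) z (fun x => V x / V 0) (fun x => P x / V 0) := by
    refine ⟨hs.cV.div_const _, hs.cP.div_const _, fun x hx hD => ?_, fun x hx hD => ?_⟩
    · exact ((hs.dV x hx hD).div_const _).congr_deriv (by ring)
    · exact ((hs.dP x hx hD).div_const _).congr_deriv (by ring)
  have hi' : IntegrableOn (fun x => (SS ts bs x) ^ 2 * ‖V x / V 0‖ ^ 2) (Ioi 0) := by
    refine (hi.div_const (‖V 0‖ ^ 2)).congr ?_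
    refine Eventually.of_forall fun x => ?_
    simp only [norm_div]
    ring
  obtain ⟨t1, t2⟩ := hs'.tail h.wt hz hi'
  refine ⟨_, _, hs', div_self hV, ?_, t1, t2⟩
  simp only [hP0, hV0]

end cfg


noncomputable def trap (c w d x : ℝ) : ℝ := max 0 (min 1 (1 + (w - |x - c|) / d))

lemma trap_cont (c w d : ℝ) : Continuous (trap c w d) := by unfold trap; fun_prop
lemma trap_nonneg (c w d x : ℝ) : 0 ≤ trap c w d x := le_max_left _ _
lemma trap_one {c w d x : ℝ} (hd : 0 < d) (h : |x - c| ≤ w) : trap c w d x = 1 := by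
  unfold trap
  have : 0 ≤ (w - |x - c|) / d := div_nonneg (by linarith) hd.le
  rw [min_eq_left (by linarith)]
  simp
lemma trap_zero {c w d x : ℝ} (hd : 0 < d) (h : w + d ≤ |x - c|) : trap c w d x = 0 := by
  unfold trap
  have : (w - |x - c|) / d ≤ -1 := by rw [div_le_iff₀ hd]; linarith
  apply max_eq_left
  exact (min_le_right _ _).trans (by linarith)
lemma trap_supp (c w d : ℝ) (hd : 0 < d) : HasCompactSupport (trap c w d) := by
  apply HasCompactSupport.of_support_subset_isCompact (isCompact_closedBall c (w + d))
  intro x hx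
  rw [Metric.mem_closedBall, Real.dist_eq]
  by_contra h
  push Not at h
  exact hx (trap_zero hd h.le)

noncomputable def beta (b : ℝ) : ℝ := (Real.sqrt b + 1) / (Real.sqrt b - 1)

lemma beta_gt {b : ℝ} (hb : 1 < b) : 1 < beta b := by
  have : 1 < Real.sqrt b := by rw [Real.lt_sqrt zero_le_one]; simpa using hb
  unfold beta
  rw [lt_div_iff₀ (by linarith)]
  linarith

lemma beta_inv {b : ℝ} (hb : 1 < b) : (beta b + 1) / (beta b - 1) = Real.sqrt b := by
  have : 1 < Real.sqrt b := by rw [Real.lt_sqrt zero_le_one]; simpa using hb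
  have h1 := beta_gt hb
  rw [div_eq_iff (by linarith)]
  have h2 : Real.sqrt b - 1 ≠ 0 := by linarith
  unfold beta
  field_simp
  ring

lemma tree_hasSum {γ C : ℝ} {ts bs : ℕ → ℝ} (h : Cfg γ ts bs)
    (hb : ∀ x : ℝ, treeMeasure ts bs (Set.Icc x (x + 1)) ≤ ENNReal.ofReal C)
    {f : ℝ → ℝ} (hf : Continuous f) (hs : HasCompactSupport f) :
    HasSum (fun n => beta (bs n) * f (ts n)) (∫ x, f x ∂(treeMeasure ts bs)) := by
  have : IsLocallyFiniteMeasure (treeMeasure ts bs) := by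
    refine ⟨fun x => ⟨Icc (x - 1 / 2) (x - 1 / 2 + 1), Icc_mem_nhds (by linarith) (by linarith), ?_⟩⟩
    exact (hb _).trans_lt ENNReal.ofReal_lt_top
  have hi : Integrable f (treeMeasure ts bs) := hf.integrable_of_hasCompactSupport hs
  have key := hasSum_integral_measure hi
  have e : (fun n => ∫ x, f x ∂(ENNReal.ofReal ((Real.sqrt (bs n) + 1) / (Real.sqrt (bs n) - 1)) •
      Measure.dirac (ts n))) = fun n => beta (bs n) * f (ts n) := by
    ext n
    rw [integral_smul_measure, integral_dirac, ENNReal.toReal_ofReal, smul_eq_mul]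
    · rfl
    · exact (zero_lt_one.trans (beta_gt (h.b n))).le
  rw [e] at key
  exact key

lemma SS_conv {γ C : ℝ} {T B : ℕ → ℕ → ℝ} {ts bs : ℕ → ℝ}
    (hk : ∀ k, Cfg γ (T k) (B k)) (h : Cfg γ ts bs)
    (hTbound : ∀ k (x : ℝ), treeMeasure (T k) (B k) (Set.Icc x (x + 1)) ≤ ENNReal.ofReal C)
    (hbound : ∀ x : ℝ, treeMeasure ts bs (Set.Icc x (x + 1)) ≤ ENNReal.ofReal C)
    (hvague : ∀ f : ℝ → ℝ, Continuous f → HasCompactSupport f →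
        Tendsto (fun k => ∫ x, f x ∂(treeMeasure (T k) (B k))) atTop
          (nhds (∫ x, f x ∂(treeMeasure ts bs))))
    {r : ℝ} (hr : 0 ≤ r) (hrD : r ∉ range ts) :
    Tendsto (fun k => SS (T k) (B k) r) atTop (𝓝 (SS ts bs r)) := by
  classical
  have hγ := h.pos
  obtain ⟨d, hd, hb⟩ := Metric.isOpen_iff.1 h.lf.isClosed.isOpen_compl r hrD
  have hd' : ∀ n, d ≤ |ts n - r| := by
    intro n
    by_contra hlt
    push Not at hlt
    exact hb (Metric.mem_ball.2 (by rwa [Real.dist_eq])) ⟨n, rfl⟩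
  set δ := min d (γ / 2) / 2 with hδ
  have hδ0 : 0 < δ := by positivity
  have hδd : δ < d := by
    have := min_le_left d (γ / 2)
    rw [hδ]; linarith
  have hδγ : 2 * δ < γ := by
    have := min_le_right d (γ / 2)
    rw [hδ]; linarith
  set F := (h.fin r).toFinset with hF
  have memF : ∀ n, n ∈ F ↔ ts n ≤ r := by intro n; simp [hF]
  set f : ℕ → ℝ → ℝ := fun n => trap (ts n) (δ / 2) (δ / 2) with hf
  set g : ℕ → ℝ → ℝ := fun n => trap (ts n) (δ / 4) (δ / 4) with hg
  set f0 : ℝ → ℝ := trap (r / 2) (r / 2) δ with hf0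
  set I : ℕ → ℕ → ℝ := fun n k => ∫ x, f n x ∂(treeMeasure (T k) (B k)) with hI
  -- integrals against the limit measure
  have far : ∀ n m, m ≠ n → ∀ e, 0 < e → 2 * e ≤ γ → trap (ts n) e e (ts m) = 0 := by
    intro n m hnm e he he2
    apply trap_zero he
    have := h.sep m n hnm
    linarith
  have lim1 : ∀ n e, 0 < e → 2 * e ≤ γ → ∫ x, trap (ts n) e e x ∂(treeMeasure ts bs) = beta (bs n) := by
    intro n e he he2
    have h1 := tree_hasSum h hbound (trap_cont (ts n) e e) (trap_supp (ts n) e e he)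
    have h2 := hasSum_single (f := fun m => beta (bs m) * trap (ts n) e e (ts m)) n (fun m hm => by
      rw [far n m hm e he he2, mul_zero])
    rw [trap_one he (by simpa using he.le), mul_one] at h2
    exact h1.unique h2
  have lim0 : ∫ x, f0 x ∂(treeMeasure ts bs) = ∑ n ∈ F, beta (bs n) := by
    have h1 := tree_hasSum h hbound (trap_cont (r / 2) (r / 2) δ) (trap_supp (r / 2) (r / 2) δ hδ0)
    have h2 : HasSum (fun m => beta (bs m) * f0 (ts m)) (∑ m ∈ F, beta (bs m) * f0 (ts m)) :=
        hasSum_sum_of_ne_finset_zero (fun m hm => by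
      rw [memF, not_le] at hm
      rw [hf0, trap_zero hδ0, mul_zero]
      have := hd' m
      rw [abs_of_pos (by linarith)] at this
      rw [abs_of_pos (by linarith)]
      linarith)
    rw [h1.unique h2]
    refine Finset.sum_congr rfl fun n hn => ?_
    rw [memF] at hn
    rw [hf0, trap_one hδ0, mul_one]
    have := h.ge n
    rw [abs_le]; constructor <;> linarith
  have tI : ∀ n, Tendsto (I n) atTop (𝓝 (beta (bs n))) := by
    intro n
    have := hvague (f n) (trap_cont _ _ _) (trap_supp _ _ _ (by positivity))
    rwa [lim1 n _ (by positivity) (by linarith)] at this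
  have tG : ∀ n, Tendsto (fun k => ∫ x, g n x ∂(treeMeasure (T k) (B k))) atTop (𝓝 (beta (bs n))) := by
    intro n
    have := hvague (g n) (trap_cont _ _ _) (trap_supp _ _ _ (by positivity))
    rwa [lim1 n _ (by positivity) (by linarith)] at this
  have t0 : Tendsto (fun k => ∫ x, f0 x ∂(treeMeasure (T k) (B k))) atTop (𝓝 (∑ n ∈ F, beta (bs n))) := by
    have := hvague f0 (trap_cont _ _ _) (trap_supp _ _ _ hδ0)
    rwa [lim0] at this
  have tS : Tendsto (fun k => ∑ n ∈ F, I n k) atTop (𝓝 (∑ n ∈ F, beta (bs n))) :=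
    tendsto_finsetSum _ fun n _ => tI n
  -- existence of nearby atoms
  have ev1 : ∀ᶠ k in atTop, ∀ n ∈ F, ∃ j, |T k j - ts n| ≤ δ / 2 := by
    rw [Finset.eventually_all]
    intro n _
    have : ∀ᶠ k in atTop, 0 < ∫ x, g n x ∂(treeMeasure (T k) (B k)) :=
      (tG n).eventually (lt_mem_nhds (zero_lt_one.trans (beta_gt (h.b n))))
    filter_upwards [this] with k hk0
    by_contra hcon
    push Not at hcon
    have h1 := tree_hasSum (hk k) (hTbound k) (trap_cont (ts n) (δ / 4) (δ / 4))
      (trap_supp (ts n) (δ / 4) (δ / 4) (by positivity))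
    have h2 : (fun j => beta (B k j) * trap (ts n) (δ / 4) (δ / 4) (T k j)) = fun _ => 0 := by
      ext j
      rw [trap_zero (by positivity) (by linarith [hcon j]), mul_zero]
    rw [h2] at h1
    have := h1.unique hasSum_zero
    rw [this] at hk0
    exact lt_irrefl _ hk0
  have ev2 : ∀ᶠ k in atTop, ∫ x, f0 x ∂(treeMeasure (T k) (B k)) < ∑ n ∈ F, I n k + 1 := by
    have := (t0.sub tS).eventually (gt_mem_nhds (show ∑ n ∈ F, beta (bs n) - ∑ n ∈ F, beta (bs n) < 1 by simp))
    filter_upwards [this] with k hk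
    linarith
  have key : ∀ᶠ k in atTop, ∏ n ∈ F, ((I n k + 1) / (I n k - 1)) = SS (T k) (B k) r := by
    filter_upwards [ev1, ev2] with k e1 e2
    have e1' : ∀ n, ∃ j, n ∈ F → |T k j - ts n| ≤ δ / 2 := by
      intro n
      by_cases hn : n ∈ F
      · obtain ⟨j, hj⟩ := e1 n hn
        exact ⟨j, fun _ => hj⟩
      · exact ⟨0, fun h' => absurd h' hn⟩
    choose τ hτ using e1'
    have hIτ : ∀ n ∈ F, I n k = beta (B k (τ n)) := by
      intro n hn
      have h1 := tree_hasSum (hk k) (hTbound k) (trap_cont (ts n) (δ / 2) (δ / 2))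
        (trap_supp (ts n) (δ / 2) (δ / 2) (by positivity))
      have h2 := hasSum_single (f := fun m => beta (B k m) * trap (ts n) (δ / 2) (δ / 2) (T k m)) (τ n)
        (fun m hm => by
          rw [trap_zero (by positivity), mul_zero]
          have a1 := (hk k).sep m (τ n) hm
          have a2 := hτ n hn
          have a3 := abs_sub_le (T k m) (ts n) (T k (τ n))
          rw [abs_sub_comm (ts n)] at a3
          linarith)
      rw [trap_one (by positivity) (hτ n hn), mul_one] at h2
      exact h1.unique h2
    have hinj : Set.InjOn τ F := by
      intro n hn m hm hnm
      by_contra hne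
      have a1 := h.sep n m hne
      have a2 := hτ n hn
      have a3 := hτ m hm
      rw [← hnm] at a3
      have a4 := abs_sub_le (ts n) (T k (τ n)) (ts m)
      rw [abs_sub_comm (ts n) (T k (τ n))] at a4
      linarith
    have hle : ∀ n ∈ F, T k (τ n) ≤ r := by
      intro n hn
      have a1 := hτ n hn
      have a2 := hd' n
      have a3 := (memF n).1 hn
      rw [abs_of_nonpos (by linarith)] at a2
      rw [abs_le] at a1
      linarith
    have hf1 : ∀ j, T k j ≤ r → trap (r / 2) (r / 2) δ (T k j) = 1 := by
      intro j hj
      apply trap_one hδ0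
      have := (hk k).ge j
      rw [abs_le]; constructor <;> linarith
    have himg : ((hk k).fin r).toFinset = F.image τ := by
      ext j
      simp only [Finite.mem_toFinset, mem_ofPred_eq, Finset.mem_image]
      constructor
      · intro hj
        by_contra hcon
        have hj' : j ∉ F.image τ := by simpa using hcon
        have h1 := tree_hasSum (hk k) (hTbound k) (trap_cont (r / 2) (r / 2) δ)
          (trap_supp (r / 2) (r / 2) δ hδ0)
        have h2 := sum_le_hasSum (insert j (F.image τ)) (fun i _ =>
          mul_nonneg (zero_lt_one.trans (beta_gt ((hk k).b i))).le (trap_nonneg _ _ _ _)) h1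
        rw [Finset.sum_insert hj', Finset.sum_image hinj] at h2
        have h3 : ∑ n ∈ F, beta (B k (τ n)) * trap (r / 2) (r / 2) δ (T k (τ n)) = ∑ n ∈ F, I n k := by
          refine Finset.sum_congr rfl fun n hn => ?_
          rw [hIτ n hn, hf1 _ (hle n hn), mul_one]
        rw [h3, hf1 j hj, mul_one] at h2
        have hb1 := beta_gt ((hk k).b j)
        have h4 := h2.trans_lt e2
        linarith
      · rintro ⟨n, hn, rfl⟩
        exact hle n hn
    rw [(hk k).SS_eq, himg, Finset.prod_image hinj]
    refine Finset.prod_congr rfl fun n hn => ?_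
    rw [hIτ n hn, beta_inv ((hk k).b _)]
  have tP : Tendsto (fun k => ∏ n ∈ F, ((I n k + 1) / (I n k - 1))) atTop (𝓝 (SS ts bs r)) := by
    rw [h.SS_eq]
    apply tendsto_finsetProd
    intro n _
    rw [← beta_inv (h.b n)]
    refine ((tI n).add_const 1).div ((tI n).sub_const 1) ?_
    have := beta_gt (h.b n)
    linarith
  exact tP.congr' key


lemma J_conv {γ C : ℝ} {T B : ℕ → ℕ → ℝ} {ts bs : ℕ → ℝ}
    (hk : ∀ k, Cfg γ (T k) (B k)) (h : Cfg γ ts bs)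
    (hTbound : ∀ k (x : ℝ), treeMeasure (T k) (B k) (Set.Icc x (x + 1)) ≤ ENNReal.ofReal C)
    (hbound : ∀ x : ℝ, treeMeasure ts bs (Set.Icc x (x + 1)) ≤ ENNReal.ofReal C)
    (hvague : ∀ f : ℝ → ℝ, Continuous f → HasCompactSupport f →
        Tendsto (fun k => ∫ x, f x ∂(treeMeasure (T k) (B k))) atTop
          (nhds (∫ x, f x ∂(treeMeasure ts bs))))
    {R : ℝ} (hR : 0 ≤ R) (hRD : R ∉ range ts) :
    Tendsto (fun k => ∫ x in (0:ℝ)..R, |SS (T k) (B k) x ^ 2 - SS ts bs x ^ 2|) atTop (𝓝 0) := by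
  have hQ : ∀ᶠ k in atTop, SS (T k) (B k) R ≤ SS ts bs R + 1 :=
    ((SS_conv hk h hTbound hbound hvague hR hRD).eventually
      (gt_mem_nhds (lt_add_one _))).mono fun k hk => hk.le
  have hm : ∀ k, Measurable fun x => |SS (T k) (B k) x ^ 2 - SS ts bs x ^ 2| := by
    intro k
    have m1 : Measurable (SS (T k) (B k)) := (hk k).wt.mono.measurable
    have m2 : Measurable (SS ts bs) := h.wt.mono.measurable
    exact ((m1.pow_const 2).sub (m2.pow_const 2)).norm
  have key := intervalIntegral.tendsto_integral_filter_of_dominated_convergence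
    (μ := volume) (a := 0) (b := R) (l := atTop)
    (F := fun k x => |SS (T k) (B k) x ^ 2 - SS ts bs x ^ 2|) (f := fun _ => (0:ℝ))
    (fun _ => (SS ts bs R + 1) ^ 2) (Eventually.of_forall fun k => (hm k).aestronglyMeasurable)
    (by
      filter_upwards [hQ] with k hQk
      refine Eventually.of_forall fun x hx => ?_
      rw [uIoc_of_le hR] at hx
      have a1 := (hk k).wt.one_le x
      have a2 := h.wt.one_le x
      have a3 := (hk k).wt.mono hx.2
      have a4 := h.wt.mono hx.2
      rw [Real.norm_eq_abs, abs_abs]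
      have b1 : SS (T k) (B k) x ^ 2 ≤ (SS ts bs R + 1) ^ 2 := by gcongr; linarith
      have b2 : SS ts bs x ^ 2 ≤ (SS ts bs R + 1) ^ 2 := by gcongr; linarith
      rw [abs_le]
      constructor <;> nlinarith [sq_nonneg (SS (T k) (B k) x), sq_nonneg (SS ts bs x)])
    intervalIntegrable_const
    (by
      have hc : (range ts).Countable := countable_range ts
      filter_upwards [hc.ae_notMem volume] with x hx hx2
      rw [uIoc_of_le hR] at hx2
      have := SS_conv hk h hTbound hbound hvague hx2.1.le hx
      have := ((this.pow 2).sub_const (SS ts bs x ^ 2)).abs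
      simpa using this)
  simpa using key

lemma exists_off (ts : ℕ → ℝ) (a : ℝ) : ∃ R, a < R ∧ R ∉ range ts := by
  have hd : Dense (range ts)ᶜ := (countable_range ts).dense_compl ℝ
  obtain ⟨R, hR, h2⟩ := hd.exists_gt a
  exact ⟨R, h2, hR⟩

lemma main_aux {C γ : ℝ} {T B : ℕ → ℕ → ℝ} {ts bs : ℕ → ℝ}
    (hk : ∀ k, Cfg γ (T k) (B k)) (h : Cfg γ ts bs)
    (hTbound : ∀ k (x : ℝ), treeMeasure (T k) (B k) (Set.Icc x (x + 1)) ≤ ENNReal.ofReal C)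
    (hbound : ∀ x : ℝ, treeMeasure ts bs (Set.Icc x (x + 1)) ≤ ENNReal.ofReal C)
    (hvague : ∀ f : ℝ → ℝ, Continuous f → HasCompactSupport f →
        Tendsto (fun k => ∫ x, f x ∂(treeMeasure (T k) (B k))) atTop
          (nhds (∫ x, f x ∂(treeMeasure ts bs))))
    (U : ℕ → ℂ → ℝ → ℂ) (u : ℂ → ℝ → ℂ)
    (hU : ∀ k (z : ℂ), 0 < z.im → IsL2Solution (T k) (B k) z 0 (U k z))
    (hu : ∀ z : ℂ, 0 < z.im → IsL2Solution ts bs z 0 (u z))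
    (K : Set ℂ) {y0 Z : ℝ} (hy0 : 0 < y0) (hZ0 : 0 ≤ Z) (hy : ∀ z ∈ K, y0 ≤ z.im)
    (hZ : ∀ z ∈ K, ‖z‖ ≤ Z) :
    TendstoUniformlyOn
        (fun k z => derivWithin (U k z) (offAtoms (T k) (Ici 0)) 0 / U k z 0)
        (fun z => derivWithin (u z) (offAtoms ts (Ici 0)) 0 / u z 0)
        atTop K := by
  obtain ⟨Mm, hMm⟩ : ∃ Mm : ℝ, Mm = 2/(γ/2)^2*(2*(γ/2) +
      (Z*(γ/2)^2+2)*(γ/2)/(4*((γ/2)^2*y0/(2*(Z*(γ/2)^2+2))))) := ⟨_, rfl⟩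
  have hγ := h.pos
  have hMm0 : 0 ≤ Mm := by rw [hMm]; positivity
  set M := (1 + (Z + 1) / y0) * Mm with hM
  have hM0 : 0 ≤ M := by positivity
  rw [Metric.tendstoUniformlyOn_iff]
  intro ε hε
  obtain ⟨R, hRl, hRD⟩ := exists_off ts (max 1 (4 * M / ε))
  have hR0 : 0 < R := zero_lt_one.trans ((le_max_left _ _).trans_lt hRl)
  have hRM : 4 * M < ε * R := by
    have := (le_max_right _ _).trans_lt hRl
    rw [div_lt_iff₀ hε] at this
    linarith
  set Q := SS ts bs R + 1 with hQdef
  set A := (1 + Mm ^ 2) * Real.exp ((1 + Z * Q ^ 2) * R) with hA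
  have hA0 : 0 ≤ A := by positivity
  have hQ : ∀ᶠ k in atTop, SS (T k) (B k) R ≤ Q :=
    ((SS_conv hk h hTbound hbound hvague hR0.le hRD).eventually
      (gt_mem_nhds (lt_add_one _))).mono fun k hk => hk.le
  have hJ := (J_conv hk h hTbound hbound hvague hR0.le hRD).const_mul (2*A+(Z+1)*A*R)
  rw [mul_zero] at hJ
  have hJ' := hJ.eventually (gt_mem_nhds (show 0 < ε * R / 2 by positivity))
  filter_upwards [hQ, hJ'] with k hQk hJk z hz
  have hzi : 0 < z.im := hy0.trans_le (hy z hz)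
  obtain ⟨V1, P1, s1, v1, p1, n1, i1⟩ := norm_sol (hk k) hzi (hU k z hzi)
  obtain ⟨V2, P2, s2, v2, p2, n2, i2⟩ := norm_sol h hzi (hu z hzi)
  have gen : ∀ (S : ℝ → ℝ) (D : Set ℝ) (V P : ℝ → ℂ), Wt S D γ → Sol_s12 S D z V P → V 0 = 1 →
      (∀ r, 0 ≤ r → 0 ≤ (qq V P r).im) → S R ≤ Q →
      -M ≤ hh z V P 0 ∧ ∀ r, 0 ≤ r → r ≤ R → ‖V r‖ ^ 2 + ‖P r‖ ^ 2 ≤ A := by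
    intro S D V P hS s v n hSR
    have hb : ‖P 0‖ ≤ Mm := by
      rw [hMm]
      exact s.m_bound hS hγ hy0 (hy z hz) (hZ z hz) n v
    constructor
    · have a1 := abs_hh_le (z := z) (V := V) (P := P) 0
      have a2 : ‖qq V P 0‖ ≤ Mm := by
        unfold qq; simpa [v] using hb
      have a3 : |(z.re + 1) / z.im| ≤ (Z + 1) / y0 := by
        rw [abs_div, abs_of_pos hzi]
        have : |z.re + 1| ≤ Z + 1 :=
          (abs_add_le _ _).trans (by
            have := (Complex.abs_re_le_norm z).trans (hZ z hz)
            simpa using this)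
        exact div_le_div₀ (by positivity) this hy0 (hy z hz)
      have a4 : (1 + |(z.re + 1) / z.im|) * ‖qq V P 0‖ ≤ M := by
        rw [hM]; gcongr
      have := neg_abs_le (hh z V P 0)
      linarith
    · intro r hr hrR
      refine (s.growth hS (hZ z hz) hSR hr hrR).trans ?_
      rw [hA, v]
      gcongr
      simp
  obtain ⟨m1, A1⟩ := gen _ _ V1 P1 (hk k).wt s1 v1 i1 hQk
  obtain ⟨m2, A2⟩ := gen _ _ V2 P2 h.wt s2 v2 i2 (by rw [hQdef]; linarith)
  have := compare (hk k).wt h.wt s1 s2 hzi hR0 (hZ z hz) A1 A2 (n1 R hR0.le) (n2 R hR0.le) m1 m2 v1 v2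
  rw [← p1, ← p2, dist_comm, dist_eq_norm]
  refine lt_of_mul_lt_mul_right ?_ hR0.le
  linarith

/-- continuity of the m-function under vague convergence: if measures
`μ_k ∈ M_a^{C,γ}(ℝ)` with atoms in `[γ, ∞)` converge vaguely to `μ ∈ M_a^{C,γ}(ℝ)` with
atoms in `[γ, ∞)`, then the m-functions `m₊(·, 0, μ_k)` converge to `m₊(·, 0, μ)`
uniformly on every compact subset of the open upper half-plane. -/
theorem m_function_continuous_vague
    (C γ : ℝ) (hC : 0 < C) (hγ : 0 < γ)
    (T : ℕ → ℕ → ℝ) (B : ℕ → ℕ → ℝ) (ts bs : ℕ → ℝ)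
    -- each μ_k belongs to M_a^{C,γ}(ℝ) with atoms in [γ, ∞)
    (hTsep : ∀ k n m, n ≠ m → γ ≤ |T k n - T k m|)
    (hTγ : ∀ k n, γ ≤ T k n)
    (hB : ∀ k n, 1 < B k n)
    (hTbound : ∀ k (x : ℝ), treeMeasure (T k) (B k) (Set.Icc x (x + 1)) ≤ ENNReal.ofReal C)
    -- μ belongs to M_a^{C,γ}(ℝ) with atoms in [γ, ∞)
    (hsep : ∀ n m, n ≠ m → γ ≤ |ts n - ts m|)
    (htγ : ∀ n, γ ≤ ts n)
    (hbs : ∀ n, 1 < bs n)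
    (hbound : ∀ x : ℝ, treeMeasure ts bs (Set.Icc x (x + 1)) ≤ ENNReal.ofReal C)
    -- vague convergence μ_k → μ
    (hvague : ∀ f : ℝ → ℝ, Continuous f → HasCompactSupport f →
        Tendsto (fun k => ∫ x, f x ∂(treeMeasure (T k) (B k))) atTop
          (nhds (∫ x, f x ∂(treeMeasure ts bs))))
    -- choices of nonzero square-integrable solutions defining the m-functions
    (U : ℕ → ℂ → ℝ → ℂ) (u : ℂ → ℝ → ℂ)
    (hU : ∀ k (z : ℂ), 0 < z.im → IsL2Solution (T k) (B k) z 0 (U k z))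
    (hu : ∀ z : ℂ, 0 < z.im → IsL2Solution ts bs z 0 (u z)) :
    ∀ K : Set ℂ, IsCompact K → K ⊆ {z : ℂ | 0 < z.im} →
      TendstoUniformlyOn
        (fun k z => derivWithin (U k z) (offAtoms (T k) (Ici 0)) 0 / U k z 0)
        (fun z => derivWithin (u z) (offAtoms ts (Ici 0)) 0 / u z 0)
        atTop K := by
  intro K hK hKsub
  have hk : ∀ k, Cfg γ (T k) (B k) := fun k => ⟨hγ, hTsep k, hTγ k, hB k⟩
  have h : Cfg γ ts bs := ⟨hγ, hsep, htγ, hbs⟩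
  rcases K.eq_empty_or_nonempty with rfl | hne
  · exact tendstoUniformlyOn_empty
  obtain ⟨z0, hz0, hmin⟩ := hK.exists_isMinOn hne Complex.continuous_im.continuousOn
  obtain ⟨z1, hz1, hmax⟩ := hK.exists_isMaxOn hne continuous_norm.continuousOn
  exact main_aux hk h hTbound hbound hvague U u hU hu K (hKsub hz0) (norm_nonneg z1)
    (fun z hz => hmin hz) (fun z hz => hmax hz)
end
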